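/- arXiv:2309.05522 — 3 statements merged into one kernel-verified Lean document; each statement's English description precedes it below -/
import Mathlib

section
/- Let p>1 be fixed. Then there exists a maximizer of 𝒲_p in the class A, i.e., there exists ρ ∈ A such that 𝒲_p(ρ) = sup{𝒲_p(ρ') : ρ' ∈ A}. -/
open MeasureTheory ENNReal Set Metric Filter

noncomputable section

/-- Euclidean space `ℝ^N`. -/
abbrev Euc (N : ℕ) := EuclideanSpace ℝ (Fin N)

/-- The measure `ρ·γ` with density `ρ` with respect to `γ`. -/
def densM {α : Type*} [MeasurableSpace α] (γ : Measure α) (ρ : α → ℝ) : Measure α :=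
  γ.withDensity fun x => ENNReal.ofReal (ρ x)

/-- `π` is a transport plan (coupling) with marginals `μ` and `ν`. -/
def IsCoupling {α : Type*} [MeasurableSpace α] (π : Measure (α × α)) (μ ν : Measure α) : Prop :=
  π.map Prod.fst = μ ∧ π.map Prod.snd = ν

/-- Transport cost `∬ d(x,y)^p dπ(x,y)`. -/
def tCost {α : Type*} [MeasurableSpace α] [Dist α] (p : ℝ) (π : Measure (α × α)) : ℝ≥0∞ :=
  ∫⁻ z, ENNReal.ofReal (dist z.1 z.2 ^ p) ∂π

/-- The `p`-th power `W_p(μ,ν)^p` of the `p`-Wasserstein distance. -/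
def WpPow {α : Type*} [MeasurableSpace α] [Dist α] (p : ℝ) (μ ν : Measure α) : ℝ≥0∞ :=
  ⨅ (π : Measure (α × α)) (_ : IsCoupling π μ ν), tCost p π

/-- The `p`-Wasserstein distance `W_p(μ,ν)`. -/
def Wp {α : Type*} [MeasurableSpace α] [Dist α] (p : ℝ) (μ ν : Measure α) : ℝ≥0∞ :=
  WpPow p μ ν ^ (1 / p)

/-- `ρ'` is an admissible competitor for the energy `𝒲_p(ρ)`:
measurable, nonnegative, `ρ + ρ' ≤ 1` a.e., same total mass as `ρ`. -/
def Adm {α : Type*} [MeasurableSpace α] (γ : Measure α) (ρ ρ' : α → ℝ) : Prop :=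
  Measurable ρ' ∧ (∀ x, 0 ≤ ρ' x) ∧ (∀ᵐ x ∂γ, ρ x + ρ' x ≤ 1) ∧
    ∫⁻ x, ENNReal.ofReal (ρ' x) ∂γ = ∫⁻ x, ENNReal.ofReal (ρ x) ∂γ

/-- The `p`-th power `𝒲_p(ρ)^p` of the Wasserstein energy of a density `ρ`. -/
def WEnergyPow {α : Type*} [MeasurableSpace α] [Dist α] (p : ℝ) (γ : Measure α) (ρ : α → ℝ) :
    ℝ≥0∞ :=
  ⨅ (ρ' : α → ℝ) (_ : Adm γ ρ ρ'), WpPow p (densM γ ρ) (densM γ ρ')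

/-- The Wasserstein energy `𝒲_p(ρ) = inf { W_p(ργ, ρ'γ) : ρ' admissible }`. -/
def WEnergy {α : Type*} [MeasurableSpace α] [Dist α] (p : ℝ) (γ : Measure α) (ρ : α → ℝ) :
    ℝ≥0∞ :=
  WEnergyPow p γ ρ ^ (1 / p)

/-- The class `A_m` of densities with values in `[0,1]` and total mass `m`. -/
def memA {α : Type*} [MeasurableSpace α] (γ : Measure α) (m : ℝ) (ρ : α → ℝ) : Prop :=
  Measurable ρ ∧ (∀ᵐ x ∂γ, 0 ≤ ρ x ∧ ρ x ≤ 1) ∧ ∫ x, ρ x ∂γ = m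

/-- The class `AP_ρ` of admissible plans: first marginal `ργ`, second marginal `≤ (1-ρ)γ`. -/
def AP {α : Type*} [MeasurableSpace α] (γ : Measure α) (ρ : α → ℝ) (π : Measure (α × α)) : Prop :=
  π.map Prod.fst = densM γ ρ ∧ π.map Prod.snd ≤ densM γ fun x => 1 - ρ x

/-- `z` belongs to the support of the measure `μ`. -/
def inSupport {α : Type*} [TopologicalSpace α] [MeasurableSpace α] (μ : Measure α) (z : α) :
    Prop :=
  ∀ U : Set α, IsOpen U → z ∈ U → 0 < μ U

lemma layer_cake' {α : Type*} [MeasurableSpace α] (μ : Measure α) [SFinite μ] (F : α → ℝ≥0∞)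
    (hF : Measurable F) :
    ∫⁻ x, F x ∂μ = ∫⁻ t in Ioi (0:ℝ), μ {x | ENNReal.ofReal t < F x} := by
  have h1 : ∀ x, F x = ∫⁻ t in Ioi (0:ℝ), indicator {t : ℝ | ENNReal.ofReal t < F x} 1 t := by
    intro x
    rw [lintegral_indicator_one, Measure.restrict_apply]
    · by_cases hx : F x = ⊤
      · have : {t : ℝ | ENNReal.ofReal t < F x} ∩ Ioi 0 = Ioi 0 := by
          ext t; simp [hx]
        rw [this, hx]; simp
      · have : {t : ℝ | ENNReal.ofReal t < F x} ∩ Ioi 0 = Ioo 0 (F x).toReal := by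
          ext t
          simp only [mem_inter_iff, mem_ofPred_eq, mem_Ioi, mem_Ioo]
          constructor
          · rintro ⟨h, h0⟩
            exact ⟨h0, (ENNReal.ofReal_lt_iff_lt_toReal h0.le hx).1 h⟩
          · rintro ⟨h0, h⟩
            exact ⟨(ENNReal.ofReal_lt_iff_lt_toReal h0.le hx).2 h, h0⟩
        rw [this]; simp [hx]
    · exact measurableSet_lt ENNReal.measurable_ofReal measurable_const
    · exact measurableSet_lt ENNReal.measurable_ofReal measurable_const
  have h2 : Measurable (Function.uncurry fun (x : α) (t : ℝ) =>
      indicator {t : ℝ | ENNReal.ofReal t < F x} (1 : ℝ → ℝ≥0∞) t) := by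
    have : (Function.uncurry fun (x : α) (t : ℝ) =>
      indicator {t : ℝ | ENNReal.ofReal t < F x} (1 : ℝ → ℝ≥0∞) t)
      = indicator {z : α × ℝ | ENNReal.ofReal z.2 < F z.1} 1 := by
      ext ⟨x, t⟩; simp [indicator]
    rw [this]
    exact measurable_one.indicator (measurableSet_lt (by fun_prop) (by fun_prop))
  conv_lhs => enter [2, x]; rw [h1 x]
  rw [lintegral_lintegral_swap h2.aemeasurable]
  refine lintegral_congr fun t => ?_
  rw [← lintegral_indicator_one (measurableSet_lt measurable_const hF)]
  refine lintegral_congr fun x => ?_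
  simp [indicator]

/-- 1D Brunn-Minkowski for compact sets -/
lemma bm1_compact (A B : Set ℝ) (hA : IsCompact A) (hB : IsCompact B) (hA0 : A.Nonempty)
    (hB0 : B.Nonempty) (D : Set ℝ) (h : ∀ a ∈ A, ∀ b ∈ B, a + b ∈ D) :
    volume A + volume B ≤ volume D := by
  obtain ⟨a, ha, ha'⟩ := hA.exists_isGreatest hA0
  obtain ⟨b, hb, hb'⟩ := hB.exists_isLeast hB0
  have e1 : volume A = volume ((fun x => x + b) '' A) := by simp
  have e2 : volume B = volume ((fun x => a + x) '' B) := by simp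
  have hm : MeasurableSet ((fun x => a + x) '' B) :=
    (hB.image (by fun_prop)).measurableSet
  have hi : ((fun x => x + b) '' A) ∩ ((fun x => a + x) '' B) ⊆ {a + b} := by
    rintro _ ⟨⟨x, hx, rfl⟩, y, hy, hxy⟩
    have := ha' hx
    have := hb' hy
    simp only at hxy
    simp only [mem_singleton_iff]; linarith
  rw [e1, e2, ← measure_union_add_inter _ hm, measure_mono_null hi (by simp), add_zero]
  apply measure_mono
  rintro _ (⟨x, hx, rfl⟩ | ⟨x, hx, rfl⟩)
  · exact h _ hx _ hb
  · exact h _ ha _ hx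

lemma bm1 (A B : Set ℝ) (hA : MeasurableSet A) (hB : MeasurableSet B) (hA0 : A.Nonempty)
    (hB0 : B.Nonempty) (D : Set ℝ) (h : ∀ a ∈ A, ∀ b ∈ B, a + b ∈ D) :
    volume A + volume B ≤ volume D := by
  rw [hA.measure_eq_iSup_isCompact, hB.measure_eq_iSup_isCompact]
  obtain ⟨a, ha⟩ := hA0
  obtain ⟨b, hb⟩ := hB0
  refine ENNReal.biSup_add_biSup_le' (p := fun K => K ⊆ A) (q := fun K => K ⊆ B)
    ⟨∅, by simp⟩ ⟨∅, by simp⟩ ?_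
  intro K hK L hL
  have key : ∀ K L, K ⊆ A → L ⊆ B → IsCompact K → IsCompact L → volume K + volume L ≤ volume D := by
    intro K L hK hL cK cL
    calc volume K + volume L ≤ volume (insert a K) + volume (insert b L) := by
          gcongr <;> exact subset_insert _ _
      _ ≤ volume D := by
          refine bm1_compact _ _ (cK.insert a) (cL.insert b) (insert_nonempty _ _)
            (insert_nonempty _ _) D ?_
          intro x hx y hy
          exact h _ (insert_subset ha hK hx) _ (insert_subset hb hL hy)
  by_cases cK : IsCompact K <;> by_cases cL : IsCompact L <;> simp only [cK, cL, iSup_pos, iSup_neg, not_false_eq_true]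
  · exact key K L hK hL cK cL
  · simpa using key K ∅ hK (by simp) cK (by simp)
  · simpa using key ∅ L (by simp) hL (by simp) cL
  · simp

lemma amgm2 (l : ℝ) (h0 : 0 < l) (h1 : l < 1) (a b : ℝ≥0∞) :
    a ^ l * b ^ (1 - l) ≤ ENNReal.ofReal l * a + ENNReal.ofReal (1 - l) * b := by
  have h1' : 0 < 1 - l := by linarith
  by_cases ha : a = ⊤
  · simp [ha, ENNReal.mul_top, h0]
  by_cases hb : b = ⊤
  · simp [hb, ENNReal.mul_top, h1]
  lift a to NNReal using ha
  lift b to NNReal using hb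
  have := NNReal.geom_mean_le_arith_mean2_weighted l.toNNReal (1-l).toNNReal a b
    (by rw [← Real.toNNReal_add h0.le h1'.le]; simp)
  rw [Real.coe_toNNReal _ h0.le, Real.coe_toNNReal _ h1'.le] at this
  rw [← ENNReal.coe_rpow_of_nonneg _ h0.le, ← ENNReal.coe_rpow_of_nonneg _ h1'.le]
  rw [ENNReal.ofReal, ENNReal.ofReal]
  exact_mod_cast this

open scoped Pointwise in
lemma pl1_core (l : ℝ) (h0 : 0 < l) (h1 : l < 1) (f g h : ℝ → ℝ≥0∞) (hf : Measurable f)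
    (hg : Measurable g) (hh : Measurable h) (f1 : ∀ x, f x ≤ 1) (g1 : ∀ x, g x ≤ 1)
    (fs : ∀ t < 1, ∃ x, t < f x) (gs : ∀ t < 1, ∃ x, t < g x)
    (H : ∀ x y, f x ^ l * g y ^ (1 - l) ≤ h (l * x + (1 - l) * y)) :
    ENNReal.ofReal l * (∫⁻ x, f x) + ENNReal.ofReal (1 - l) * (∫⁻ x, g x) ≤ ∫⁻ x, h x := by
  have h1' : 0 < 1 - l := by linarith
  rw [layer_cake' volume f hf, layer_cake' volume g hg, layer_cake' volume h hh]
  rw [← lintegral_const_mul', ← lintegral_const_mul', ← lintegral_add_left']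
  · apply lintegral_mono_ae
    filter_upwards [ae_restrict_mem measurableSet_Ioi] with t ht
    by_cases ht1 : ENNReal.ofReal t < 1
    · have e1 : ENNReal.ofReal l * volume {x | ENNReal.ofReal t < f x}
          = volume (l • {x | ENNReal.ofReal t < f x}) := by
        rw [Measure.addHaar_smul]; simp [abs_of_pos h0]
      have e2 : ENNReal.ofReal (1 - l) * volume {x | ENNReal.ofReal t < g x}
          = volume ((1 - l) • {x | ENNReal.ofReal t < g x}) := by
        rw [Measure.addHaar_smul]; simp [abs_of_pos h1']
      rw [e1, e2]
      apply bm1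
      · exact (measurableSet_lt measurable_const hf).const_smul₀ _
      · exact (measurableSet_lt measurable_const hg).const_smul₀ _
      · exact Set.Nonempty.smul_set (fs _ ht1)
      · exact Set.Nonempty.smul_set (gs _ ht1)
      · rintro _ ⟨x, hx, rfl⟩ _ ⟨y, hy, rfl⟩
        simp only [mem_ofPred_eq, smul_eq_mul] at *
        refine lt_of_lt_of_le ?_ (H x y)
        calc ENNReal.ofReal t = ENNReal.ofReal t ^ l * ENNReal.ofReal t ^ (1 - l) := by
              rw [← ENNReal.rpow_add_of_nonneg _ _ h0.le h1'.le]; simp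
          _ < _ := ENNReal.mul_lt_mul (ENNReal.rpow_lt_rpow hx h0) (ENNReal.rpow_lt_rpow hy h1')
    · have e1 : {x | ENNReal.ofReal t < f x} = ∅ := by
        ext x; simpa using (f1 x).trans (not_lt.1 ht1)
      have e2 : {x | ENNReal.ofReal t < g x} = ∅ := by
        ext x; simpa using (g1 x).trans (not_lt.1 ht1)
      rw [e1, e2]; simp
  · apply Measurable.aemeasurable
    apply Measurable.const_mul
    apply Antitone.measurable
    intro s t hst
    exact measure_mono fun x hx => lt_of_le_of_lt (ENNReal.ofReal_le_ofReal hst) hx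
  · simp
  · simp

lemma pl1_bdd (l : ℝ) (h0 : 0 < l) (h1 : l < 1) (f g h : ℝ → ℝ≥0∞) (hf : Measurable f)
    (hg : Measurable g) (hh : Measurable h) (M : ℝ≥0∞) (hM : M ≠ ⊤)
    (f1 : ∀ x, f x ≤ M) (g1 : ∀ x, g x ≤ M)
    (H : ∀ x y, f x ^ l * g y ^ (1 - l) ≤ h (l * x + (1 - l) * y)) :
    (∫⁻ x, f x) ^ l * (∫⁻ x, g x) ^ (1 - l) ≤ ∫⁻ x, h x := by
  have h1' : 0 < 1 - l := by linarith
  set α := ⨆ x, f x with hα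
  set β := ⨆ x, g x with hβ
  have hαt : α ≠ ⊤ := ne_top_of_le_ne_top hM (iSup_le f1)
  have hβt : β ≠ ⊤ := ne_top_of_le_ne_top hM (iSup_le g1)
  by_cases hα0 : α = 0
  · have : ∀ x, f x = 0 := by simpa [hα] using hα0
    simp [this, h0]
  by_cases hβ0 : β = 0
  · have : ∀ x, g x = 0 := by simpa [hβ] using hβ0
    simp [this, h1]
  set γ := α ^ l * β ^ (1 - l) with hγ
  have hγt : γ ≠ ⊤ := ENNReal.mul_ne_top (ENNReal.rpow_ne_top_of_nonneg h0.le hαt)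
    (ENNReal.rpow_ne_top_of_nonneg h1'.le hβt)
  have hγ0 : γ ≠ 0 := mul_ne_zero (by simp [hα0, hαt]) (by simp [hβ0, hβt])
  have hγi : γ⁻¹ = (α⁻¹) ^ l * (β⁻¹) ^ (1 - l) := by
    rw [ENNReal.inv_rpow, ENNReal.inv_rpow, ← ENNReal.mul_inv]
    · left; simp [hα0, hαt]
    · left; exact ENNReal.rpow_ne_top_of_nonneg h0.le hαt
  have sup : ∀ (u : ℝ → ℝ≥0∞) (a : ℝ≥0∞), a = ⨆ x, u x → a ≠ 0 → a ≠ ⊤ →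
      ∀ t < 1, ∃ x, t < a⁻¹ * u x := by
    intro u a ha ha0 hat t ht
    have : a * t < ⨆ x, u x := by
      rw [← ha]; conv_rhs => rw [← mul_one a]
      exact ENNReal.mul_lt_mul_right ha0 hat ht
    obtain ⟨x, hx⟩ := lt_iSup_iff.1 this
    refine ⟨x, ?_⟩
    have := ENNReal.mul_lt_mul_right (ENNReal.inv_ne_zero.2 hat) (ENNReal.inv_ne_top.2 ha0) hx
    rwa [← mul_assoc, ENNReal.inv_mul_cancel ha0 hat, one_mul] at this
  have core := pl1_core l h0 h1 (fun x => α⁻¹ * f x) (fun x => β⁻¹ * g x) (fun x => γ⁻¹ * h x)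
    (by fun_prop) (by fun_prop) (by fun_prop)
    (fun x => by rw [ENNReal.inv_mul_le_iff hα0 hαt, mul_one]; exact le_iSup f x)
    (fun x => by rw [ENNReal.inv_mul_le_iff hβ0 hβt, mul_one]; exact le_iSup g x)
    (sup f α rfl hα0 hαt) (sup g β rfl hβ0 hβt)
    (fun x y => by
      rw [ENNReal.mul_rpow_of_nonneg _ _ h0.le, ENNReal.mul_rpow_of_nonneg _ _ h1'.le, hγi,
        mul_mul_mul_comm]
      exact mul_le_mul_right (H x y) _)
  have := (amgm2 l h0 h1 _ _).trans core
  rw [lintegral_const_mul _ hf, lintegral_const_mul _ hg, lintegral_const_mul _ hh,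
    ENNReal.mul_rpow_of_nonneg _ _ h0.le, ENNReal.mul_rpow_of_nonneg _ _ h1'.le,
    mul_mul_mul_comm, ← hγi] at this
  rwa [ENNReal.mul_le_mul_iff_right (ENNReal.inv_ne_zero.2 hγt) (ENNReal.inv_ne_top.2 hγ0)] at this

lemma pl1 (l : ℝ) (h0 : 0 < l) (h1 : l < 1) (f g h : ℝ → ℝ≥0∞) (hf : Measurable f)
    (hg : Measurable g) (hh : Measurable h)
    (H : ∀ x y, f x ^ l * g y ^ (1 - l) ≤ h (l * x + (1 - l) * y)) :
    (∫⁻ x, f x) ^ l * (∫⁻ x, g x) ^ (1 - l) ≤ ∫⁻ x, h x := by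
  have h1' : 0 < 1 - l := by linarith
  by_cases hα0 : ∫⁻ x, f x = 0
  · simp [hα0, h0]
  by_cases hβ0 : ∫⁻ x, g x = 0
  · simp [hβ0, h1]
  have lim : ∀ u : ℝ → ℝ≥0∞, Measurable u →
      Tendsto (fun n : ℕ => ∫⁻ x, min (u x) n) atTop (nhds (∫⁻ x, u x)) := by
    intro u hu
    apply lintegral_tendsto_of_tendsto_of_monotone
    · intro n; fun_prop
    · refine Eventually.of_forall fun x m n hmn => ?_
      exact min_le_min_left _ (by exact_mod_cast hmn)
    · refine Eventually.of_forall fun x => ?_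
      have := (tendsto_const_nhds (x := u x)).min ENNReal.tendsto_nat_nhds_top
      simpa using this
  have t := ENNReal.Tendsto.mul ((lim f hf).ennrpow_const l) (Or.inl (by
    simp [hα0, h0.not_gt])) ((lim g hg).ennrpow_const (1 - l)) (Or.inl (by
    simp [hβ0, h1.not_gt]))
  refine le_of_tendsto' t fun n => ?_
  refine pl1_bdd l h0 h1 _ _ h (by fun_prop) (by fun_prop) hh n (by simp) (fun x => min_le_right _ _)
    (fun x => min_le_right _ _) fun x y => le_trans ?_ (H x y)
  gcongr <;> exact min_le_left _ _

lemma pl (n : ℕ) (l : ℝ) (h0 : 0 < l) (h1 : l < 1) : ∀ (f g h : (Fin n → ℝ) → ℝ≥0∞)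
    (_ : Measurable f) (_ : Measurable g) (_ : Measurable h)
    (_ : ∀ x y, f x ^ l * g y ^ (1 - l) ≤ h (l • x + (1 - l) • y)),
    (∫⁻ x, f x) ^ l * (∫⁻ x, g x) ^ (1 - l) ≤ ∫⁻ x, h x := by
  induction n with
  | zero =>
    intro f g h hf hg hh H
    simp only [lintegral_unique]
    have : (volume : Measure (Fin 0 → ℝ)) univ = 1 := by simp [volume_pi]
    simp only [this, mul_one]
    convert H default default
  | succ n ih =>
    intro f g h hf hg hh H
    have mp := (volume_preserving_piFinSuccAbove (fun _ : Fin (n + 1) => ℝ) 0).symm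
    have hc : ∀ (t : ℝ) (z : Fin n → ℝ), (MeasurableEquiv.piFinSuccAbove
        (fun _ : Fin (n + 1) => ℝ) 0).symm (t, z) = Fin.cons t z := by
      intro t z
      simp [MeasurableEquiv.piFinSuccAbove_symm_apply, Fin.consEquiv]
    have e : ∀ u : (Fin (n+1) → ℝ) → ℝ≥0∞, Measurable u →
        ∫⁻ x, u x = ∫⁻ t : ℝ, ∫⁻ z : Fin n → ℝ, u (Fin.cons t z) := by
      intro u hu
      rw [← mp.lintegral_comp hu]
      rw [Measure.volume_eq_prod, lintegral_prod]
      · simp only [hc]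
      · exact (hu.comp (MeasurableEquiv.measurable _)).aemeasurable
    have mc : Measurable fun q : ℝ × (Fin n → ℝ) => (Fin.cons q.1 q.2 : Fin (n+1) → ℝ) := by
      simp only [← hc]
      exact (MeasurableEquiv.piFinSuccAbove (fun _ : Fin (n + 1) => ℝ) 0).symm.measurable
    rw [e f hf, e g hg, e h hh]
    apply pl1 l h0 h1
    · exact (hf.comp mc).lintegral_prod_right'
    · exact (hg.comp mc).lintegral_prod_right'
    · exact (hh.comp mc).lintegral_prod_right'
    · intro x y
      have mcx : ∀ x : ℝ, Measurable fun q : (Fin n → ℝ) => (Fin.cons x q : Fin (n+1) → ℝ) := 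
        fun x => mc.comp (measurable_const.prodMk measurable_id)
      apply ih
      · exact hf.comp (mcx x)
      · exact hg.comp (mcx y)
      · exact hh.comp (mcx _)
      · intro z w
        convert H (Fin.cons x z) (Fin.cons y w) using 2
        ext i
        refine Fin.cases ?_ (fun j => ?_) i <;> simp



lemma pl_euc {N : ℕ} (l : ℝ) (h0 : 0 < l) (h1 : l < 1) (A C D : Set (Euc N))
    (hA : MeasurableSet A) (hC : MeasurableSet C) (hD : MeasurableSet D)
    (H : ∀ a ∈ A, ∀ c ∈ C, l • a + (1 - l) • c ∈ D) :
    volume A ^ l * volume C ^ (1 - l) ≤ volume D := by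
  have h1' : 0 < 1 - l := by linarith
  have mp := PiLp.volume_preserving_toLp (Fin N)
  have e : ∀ S : Set (Euc N), MeasurableSet S →
      volume S = ∫⁻ x : Fin N → ℝ, indicator (WithLp.toLp 2 ⁻¹' S) 1 x := by
    intro S hS
    rw [lintegral_indicator_one (mp.measurable hS), mp.measure_preimage hS.nullMeasurableSet]
  rw [e A hA, e C hC, e D hD]
  apply pl N l h0 h1
  · exact measurable_one.indicator (mp.measurable hA)
  · exact measurable_one.indicator (mp.measurable hC)
  · exact measurable_one.indicator (mp.measurable hD)
  · intro x y
    by_cases hx : WithLp.toLp 2 x ∈ A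
    · by_cases hy : WithLp.toLp 2 y ∈ C
      · have : WithLp.toLp 2 (l • x + (1 - l) • y) ∈ D := by
          simpa using H _ hx _ hy
        rw [indicator_of_mem (by exact hx), indicator_of_mem (by exact hy),
          indicator_of_mem (by exact this)]
        simp
      · rw [indicator_of_notMem (a := y) (by exact hy)]
        simp [h1]
    · rw [indicator_of_notMem (a := x) (by exact hx)]
      simp [h0]

/-- volume of the ball of radius `r` -/
def bv (N : ℕ) (r : ℝ) : ℝ≥0∞ := ENNReal.ofReal (r ^ N) * volume (ball (0 : Euc N) 1)

lemma om_ne_top {N : ℕ} : volume (ball (0 : Euc N) 1) ≠ ⊤ := measure_ball_lt_top.ne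
lemma om_ne_zero {N : ℕ} : volume (ball (0 : Euc N) 1) ≠ 0 :=
  (measure_ball_pos _ _ one_pos).ne'

lemma bv_lt {N : ℕ} (hN : 1 ≤ N) {a b : ℝ} (ha : 0 ≤ a) (hab : a < b) : bv N a < bv N b := by
  unfold bv
  rw [mul_comm, mul_comm (ENNReal.ofReal _)]
  refine ENNReal.mul_lt_mul_right om_ne_zero om_ne_top ?_
  rw [ENNReal.ofReal_lt_ofReal_iff (pow_pos (ha.trans_lt hab) _)]
  exact pow_lt_pow_left₀ hab ha (by omega)

lemma bv_le {N : ℕ} {a b : ℝ} (ha : 0 ≤ a) (hab : a ≤ b) : bv N a ≤ bv N b := by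
  unfold bv; gcongr

lemma bv_surj {N : ℕ} (hN : 1 ≤ N) (m : ℝ≥0∞) (hm : m ≠ ⊤) : ∃ r, 0 ≤ r ∧ bv N r = m := by
  refine ⟨(m / volume (ball (0 : Euc N) 1)).toReal ^ ((N : ℝ)⁻¹), by positivity, ?_⟩
  unfold bv
  rw [Real.rpow_inv_natCast_pow (by positivity) (by omega), ENNReal.ofReal_toReal,
    ENNReal.div_mul_cancel om_ne_zero om_ne_top]
  exact ENNReal.div_ne_top hm om_ne_zero

lemma bv_lt_iff {N : ℕ} (hN : 1 ≤ N) {a b : ℝ} (ha : 0 ≤ a) (hb : 0 ≤ b) :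
    bv N a < bv N b ↔ a < b := by
  refine ⟨fun h => ?_, bv_lt hN ha⟩
  by_contra h'
  exact absurd (bv_le hb (not_lt.1 h')) (not_le.2 h)

lemma bm_ball {N : ℕ} (hN : 1 ≤ N) (A D : Set (Euc N)) (hA : MeasurableSet A)
    (hD : MeasurableSet D) (a r : ℝ) (ha : 0 ≤ a) (hr : 0 ≤ r)
    (hAa : bv N a < volume A) (hAD : ∀ x ∈ A, ∀ z, dist x z ≤ r → z ∈ D) :
    bv N (a + r) < volume D := by
  have hsub : A ⊆ D := fun x hx => hAD x hx x (by simpa)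
  have fin : ∀ b, bv N b ≠ ⊤ := fun b => ENNReal.mul_ne_top (by simp) om_ne_top
  by_cases hAt : volume A = ⊤
  · have : volume D = ⊤ := by simpa [hAt] using measure_mono (μ := volume) hsub
    rw [this]; exact (fin _).lt_top
  rcases hr.eq_or_lt with rfl | hr
  · rw [add_zero]; exact hAa.trans_le (measure_mono hsub)
  obtain ⟨ρ, hρ0, hρ⟩ := bv_surj hN _ hAt
  have haρ : a < ρ := by rwa [← hρ, bv_lt_iff hN ha hρ0] at hAa
  have hρ0 : 0 < ρ := ha.trans_lt haρ
  refine (bv_lt hN (by positivity) (by linarith : a + r < ρ + r)).trans_le ?_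
  have hs : 0 < ρ + r := by positivity
  have hl0 : 0 < ρ / (ρ + r) := by positivity
  have hl1 : ρ / (ρ + r) < 1 := by rw [div_lt_one hs]; linarith
  have P := pl_euc (ρ / (ρ + r)) hl0 hl1 ((fun x => ρ • x) ⁻¹' A) (closedBall 0 1)
    ((fun x => (ρ + r) • x) ⁻¹' D) (hA.preimage (measurable_const_smul _)) isClosed_closedBall.measurableSet
    (hD.preimage (measurable_const_smul _)) (by
      intro x hx c hc
      refine hAD _ hx _ ?_
      have : (ρ + r) • ((ρ / (ρ + r)) • x + (1 - ρ / (ρ + r)) • c) = ρ • x + r • c := by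
        rw [smul_add, smul_smul, smul_smul]
        congr 2 <;> (field_simp; try ring)
      beta_reduce
      rw [this]
      simp only [dist_self_add_right, norm_smul, Real.norm_eq_abs, abs_of_pos hr]
      have : ‖c‖ ≤ 1 := by simpa using hc
      nlinarith)
  rw [Measure.addHaar_preimage_smul _ hρ0.ne', Measure.addHaar_preimage_smul _ hs.ne',
    Measure.addHaar_closedBall _ _ (by norm_num), ← hρ, bv, finrank_euclideanSpace_fin,
    abs_of_pos (by positivity), abs_of_pos (by positivity), ← mul_assoc,
    ← ENNReal.ofReal_mul (by positivity), inv_mul_cancel₀ (by positivity), one_pow,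
    ← ENNReal.rpow_add _ _ (by simpa using om_ne_zero) (by simpa using om_ne_top)] at P
  simp only [ENNReal.ofReal_one, one_mul, add_sub_cancel, ENNReal.rpow_one] at P
  calc bv N (ρ + r) ≤ ENNReal.ofReal ((ρ + r) ^ N) * (ENNReal.ofReal ((ρ + r) ^ N)⁻¹ * volume D) := by
        unfold bv; gcongr
    _ = volume D := by
        rw [← mul_assoc, ← ENNReal.ofReal_mul (by positivity), mul_inv_cancel₀ (by positivity)]
        simp

lemma vol_bv {N : ℕ} (hN : 1 ≤ N) (m : ℝ≥0∞) (hm : m ≠ ⊤) :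
    volume {x : Euc N | bv N ‖x‖ < m} = m := by
  obtain ⟨r, hr, rfl⟩ := bv_surj hN m hm
  have : {x : Euc N | bv N ‖x‖ < bv N r} = ball 0 r := by
    ext x; simp [bv_lt_iff hN (norm_nonneg x) hr]
  have hne : Nonempty (Fin N) := ⟨⟨0, hN⟩⟩
  rw [this, Measure.addHaar_ball _ _ hr, finrank_euclideanSpace_fin]
  rfl

lemma meas_bv {N : ℕ} : Measurable fun x : Euc N => bv N ‖x‖ := by
  unfold bv; fun_prop

/-- symmetric decreasing rearrangement -/
def sdr {N : ℕ} (φ : Euc N → ℝ≥0∞) (x : Euc N) : ℝ≥0∞ :=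
  volume ({t : ℝ | bv N ‖x‖ < volume {z | ENNReal.ofReal t < φ z}} ∩ Ioi 0)

lemma meas_lev {N : ℕ} (φ : Euc N → ℝ≥0∞) :
    Measurable fun t : ℝ => volume {z | ENNReal.ofReal t < φ z} := by
  apply Antitone.measurable
  intro s t hst
  exact measure_mono fun x hx => lt_of_le_of_lt (ENNReal.ofReal_le_ofReal hst) hx

lemma star_eq {N : ℕ} (φ : Euc N → ℝ≥0∞) (x : Euc N) :
    sdr φ x = ∫⁻ t in Ioi (0:ℝ),
      indicator {z : Euc N × ℝ | bv N ‖z.1‖ < volume {y | ENNReal.ofReal z.2 < φ y}} 1 (x, t) := by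
  unfold sdr
  have hm : MeasurableSet {t : ℝ | bv N ‖x‖ < volume {z | ENNReal.ofReal t < φ z}} :=
    measurableSet_lt measurable_const (meas_lev φ)
  rw [← Measure.restrict_apply hm, ← lintegral_indicator_one hm]
  rfl

lemma star_mset {N : ℕ} (φ : Euc N → ℝ≥0∞) :
    MeasurableSet {z : Euc N × ℝ | bv N ‖z.1‖ < volume {y | ENNReal.ofReal z.2 < φ y}} :=
  measurableSet_lt (meas_bv.comp measurable_fst) ((meas_lev φ).comp measurable_snd)

lemma star_meas {N : ℕ} (φ : Euc N → ℝ≥0∞) : Measurable (sdr φ) := by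
  have : sdr φ = _ := funext (star_eq φ)
  rw [this]
  exact (measurable_one.indicator (star_mset φ)).lintegral_prod_right'

lemma star_int {N : ℕ} (φ : Euc N → ℝ≥0∞) (S : Set (Euc N)) :
    ∫⁻ x in S, sdr φ x = ∫⁻ t in Ioi (0:ℝ),
      volume ({x : Euc N | bv N ‖x‖ < volume {y | ENNReal.ofReal t < φ y}} ∩ S) := by
  simp only [star_eq]
  rw [lintegral_lintegral_swap (f := fun x t => indicator {z : Euc N × ℝ | bv N ‖z.1‖ <
    volume {y | ENNReal.ofReal z.2 < φ y}} 1 (x, t))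
    (measurable_one.indicator (star_mset φ)).aemeasurable]
  refine lintegral_congr fun t => ?_
  have hm : MeasurableSet {x : Euc N | bv N ‖x‖ < volume {y | ENNReal.ofReal t < φ y}} :=
    measurableSet_lt meas_bv measurable_const
  rw [← Measure.restrict_apply hm, ← lintegral_indicator_one hm]
  rfl

/-- The open ball of unit volume -/
def uB (N : ℕ) : Set (Euc N) := {x | bv N ‖x‖ < 1}

lemma lev_fin {N : ℕ} {φ : Euc N → ℝ≥0∞} (h : volume {z | 0 < φ z} ≠ ⊤) (t : ℝ) :
    volume {y | ENNReal.ofReal t < φ y} ≠ ⊤ :=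
  ne_top_of_le_ne_top h (measure_mono (by
    intro z hz
    have hz' : ENNReal.ofReal t < φ z := hz
    exact pos_of_gt hz'))

lemma star_total {N : ℕ} (hN : 1 ≤ N) (φ : Euc N → ℝ≥0∞) (hφ : Measurable φ)
    (h : volume {z | 0 < φ z} ≠ ⊤) : ∫⁻ x, sdr φ x = ∫⁻ x, φ x := by
  rw [← setLIntegral_univ, star_int, layer_cake' _ φ hφ]
  refine lintegral_congr fun t => ?_
  rw [inter_univ, vol_bv hN _ (lev_fin h t)]

lemma star_HL {N : ℕ} (hN : 1 ≤ N) (φ : Euc N → ℝ≥0∞) (hφ : Measurable φ)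
    (F : Euc N → ℝ≥0∞) (hF : Measurable F)
    (hF1 : ∀ᵐ x, F x ≤ 1) (hFi : ∫⁻ x, F x = 1) :
    ∫⁻ x, φ x * F x ≤ ∫⁻ x in uB N, sdr φ x := by
  have : ∫⁻ x, φ x * F x = ∫⁻ x, φ x ∂(volume.withDensity F) := by
    rw [lintegral_withDensity_eq_lintegral_mul _ hF hφ]
    simp [mul_comm]
  rw [this, layer_cake' _ φ hφ, star_int]
  refine lintegral_mono fun t => ?_
  have e : {x : Euc N | bv N ‖x‖ < volume {y | ENNReal.ofReal t < φ y}} ∩ uB N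
      = {x : Euc N | bv N ‖x‖ < min (volume {y | ENNReal.ofReal t < φ y}) 1} := by
    ext x; simp [uB]
  rw [e, vol_bv hN _ (by simp)]
  rw [withDensity_apply _ (measurableSet_lt measurable_const hφ)]
  refine le_min ?_ ?_
  · calc _ ≤ ∫⁻ x in {x | ENNReal.ofReal t < φ x}, 1 := lintegral_mono_ae (ae_restrict_of_ae hF1)
      _ = _ := by simp
  · exact (setLIntegral_le_lintegral _ _).trans hFi.le

lemma star_ineq {N : ℕ} (hN : 1 ≤ N) (φ ψ : Euc N → ℝ≥0∞) (hφ : Measurable φ)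
    (hψ : Measurable ψ) (K : ℝ → ℝ) (hK0 : ∀ r, 0 ≤ r → 0 ≤ K r)
    (hKm : ∀ r s, 0 ≤ r → r ≤ s → K r ≤ K s)
    (H : ∀ x y, φ x ≤ ψ y + ENNReal.ofReal (K (dist x y))) (x y : Euc N) :
    sdr φ x ≤ sdr ψ y + ENNReal.ofReal (K (dist x y)) := by
  set k := K (dist x y) with hk
  have hk0 : 0 ≤ k := hK0 _ dist_nonneg
  have key : ∀ s t : ℝ, 0 < s → s + k < t → bv N ‖x‖ < volume {z | ENNReal.ofReal t < φ z} →
      bv N ‖y‖ < volume {z | ENNReal.ofReal s < ψ z} := by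
    intro s t hs hst hx
    have h1 := bm_ball hN _ {z | ENNReal.ofReal s < ψ z} (measurableSet_lt measurable_const hφ)
      (measurableSet_lt measurable_const hψ) ‖x‖ (dist x y) (norm_nonneg _) dist_nonneg hx (by
        intro a ha z hz
        have h2 := H a z
        have h3 : ENNReal.ofReal (K (dist a z)) ≤ ENNReal.ofReal k :=
          ENNReal.ofReal_le_ofReal (hKm _ _ dist_nonneg hz)
        have h4 : ENNReal.ofReal s + ENNReal.ofReal k < ψ z + ENNReal.ofReal k := by
          rw [← ENNReal.ofReal_add hs.le hk0]
          calc _ ≤ ENNReal.ofReal t := ENNReal.ofReal_le_ofReal hst.le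
            _ < φ a := ha
            _ ≤ _ := h2
            _ ≤ _ := by gcongr
        exact lt_of_add_lt_add_right h4)
    refine lt_of_le_of_lt (bv_le (norm_nonneg _) ?_) h1
    have := norm_le_norm_add_norm_sub' y x
    rwa [dist_comm, dist_eq_norm]
  by_cases hT : sdr ψ y = ⊤
  · simp [hT]
  have : ({t : ℝ | bv N ‖x‖ < volume {z | ENNReal.ofReal t < φ z}} ∩ Ioi 0) ⊆
      Ioc 0 ((sdr ψ y).toReal + k) := by
    rintro t ⟨ht, ht0⟩
    refine ⟨ht0, ?_⟩
    have : Ioo 0 (t - k) ⊆ ({t : ℝ | bv N ‖y‖ < volume {z | ENNReal.ofReal t < ψ z}} ∩ Ioi 0) := by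
      rintro s ⟨hs0, hs⟩
      exact ⟨key s t hs0 (by linarith) ht, hs0⟩
    have := measure_mono (μ := volume) this
    rw [Real.volume_Ioo, sub_zero] at this
    change _ ≤ sdr ψ y at this
    have := (ENNReal.ofReal_le_iff_le_toReal hT).1 this
    linarith
  refine (measure_mono this).trans ?_
  rw [Real.volume_Ioc, sub_zero, ENNReal.ofReal_add (by positivity) hk0, ENNReal.ofReal_toReal hT]


lemma lp_duality {α β : Type} [Fintype α] [Fintype β] (a : α → ℝ) (b : β → ℝ)
    (c : α → β → ℝ) (Λ m V : ℝ) (ha : ∀ i, 0 ≤ a i) (hb : ∀ j, 0 ≤ b j) (hc : ∀ i j, 0 ≤ c i j)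
    (hΛ : 0 ≤ Λ)
    (H : ∀ P : α → β → ℝ, (∀ i j, 0 ≤ P i j) → (∀ i, ∑ j, P i j ≤ a i) →
      (∀ j, ∑ i, P i j ≤ b j) → V ≤ (∑ i, ∑ j, c i j * P i j) + Λ * (m - ∑ i, ∑ j, P i j)) :
    ∃ (u : α → ℝ) (v : β → ℝ), (∀ i, 0 ≤ u i ∧ u i ≤ Λ) ∧ (∀ j, 0 ≤ v j ∧ v j ≤ Λ) ∧
      (∀ i j, u i ≤ c i j + v j) ∧
      V ≤ (∑ i, a i * u i) + Λ * (m - ∑ i, a i) - ∑ j, v j * b j := by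
  classical
  let X : Set (α → β → ℝ) := {P | (∀ i j, 0 ≤ P i j) ∧ ∀ i, ∑ j, P i j ≤ a i}
  let Y : Set (β → ℝ) := Icc 0 (fun _ => Λ)
  let f : (α → β → ℝ) → (β → ℝ) → ℝ := fun P v =>
    (∑ i, ∑ j, (c i j - Λ + v j) * P i j) - ∑ j, v j * b j
  have hXne : X.Nonempty := ⟨0, by simp [X], by simpa [X] using ha⟩
  have hYne : Y.Nonempty := ⟨0, by simp [Y], fun j => hΛ⟩
  have hXc : Convex ℝ X := by
    rintro P ⟨hP, hP'⟩ Q ⟨hQ, hQ'⟩ s t hs ht hst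
    refine ⟨fun i j => ?_, fun i => ?_⟩
    · have := hP i j; have := hQ i j
      simp only [Pi.add_apply, Pi.smul_apply, smul_eq_mul]; positivity
    · simp only [Pi.add_apply, Pi.smul_apply, smul_eq_mul, Finset.sum_add_distrib, ← Finset.mul_sum]
      calc _ ≤ s * a i + t * a i := by gcongr; exacts [hP' i, hQ' i]
        _ = a i := by rw [← add_mul, hst, one_mul]
  have hXk : IsCompact X := by
    have : IsCompact (Icc (0 : α → β → ℝ) (fun i _ => a i)) := isCompact_Icc
    refine this.of_isClosed_subset ?_ ?_
    · have e : X = (⋂ i, ⋂ j, {P | 0 ≤ P i j}) ∩ ⋂ i, {P | ∑ j, P i j ≤ a i} := by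
        ext P; simp [X]
      rw [e]
      refine IsClosed.inter (isClosed_iInter fun i => isClosed_iInter fun j => ?_)
        (isClosed_iInter fun i => ?_)
      · exact isClosed_le (by fun_prop) (by fun_prop)
      · exact isClosed_le (by fun_prop) (by fun_prop)
    · rintro P ⟨hP, hP'⟩
      exact ⟨fun i j => hP i j, fun i j =>
        (Finset.single_le_sum (fun k _ => hP i k) (Finset.mem_univ j)).trans (hP' i)⟩
  have hYc : Convex ℝ Y := convex_Icc _ _
  have hYk : IsCompact Y := isCompact_Icc
  obtain ⟨P0, hP0, v0, hv0, sad⟩ := Sion.exists_isSaddlePointOn (f := f) hXne hXc hXk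
    (fun v _ => (Continuous.lowerSemicontinuous (by simp only [f]; fun_prop)).lowerSemicontinuousOn _)
    (fun v _ => ConvexOn.quasiconvexOn ⟨hXc, by
      intro P _ Q _ s t hs ht hst
      apply le_of_eq
      simp only [f, Pi.add_apply, Pi.smul_apply, smul_eq_mul, mul_sub, Finset.mul_sum]
      rw [sub_add_sub_comm, ← Finset.sum_add_distrib, ← Finset.sum_add_distrib]
      congr 1
      · refine Finset.sum_congr rfl fun i _ => ?_
        rw [← Finset.sum_add_distrib]
        refine Finset.sum_congr rfl fun j _ => by ring
      · refine Finset.sum_congr rfl fun i _ => ?_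
        rw [← add_mul, hst, one_mul]⟩)
    hYc hYne hYk
    (fun P _ => (Continuous.upperSemicontinuous (by simp only [f]; fun_prop)).upperSemicontinuousOn _)
    (fun P _ => ConcaveOn.quasiconcaveOn ⟨hYc, by
      intro v _ w _ s t hs ht hst
      apply le_of_eq
      simp only [f, Pi.add_apply, Pi.smul_apply, smul_eq_mul, mul_sub, Finset.mul_sum]
      rw [sub_add_sub_comm, ← Finset.sum_add_distrib, ← Finset.sum_add_distrib]
      congr 1
      · refine Finset.sum_congr rfl fun i _ => ?_
        rw [← Finset.sum_add_distrib]
        refine Finset.sum_congr rfl fun j _ => ?_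
        linear_combination (c i j - Λ) * P i j * hst
      · refine Finset.sum_congr rfl fun i _ => by ring⟩)
  have row : ∀ i, ∃ (p : β → ℝ) (u : ℝ), (∀ j, 0 ≤ p j) ∧ ∑ j, p j ≤ a i ∧ 0 ≤ u ∧ u ≤ Λ ∧
      (∀ j, u ≤ c i j + v0 j) ∧ ∑ j, (c i j - Λ + v0 j) * p j = a i * (u - Λ) := by
    intro i
    by_cases h : ∃ j, c i j + v0 j < Λ
    · obtain ⟨j1, hj1⟩ := h
      have : Nonempty β := ⟨j1⟩
      obtain ⟨j0, hj0⟩ := Finite.exists_min fun j => c i j + v0 j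
      refine ⟨fun j => if j = j0 then a i else 0, c i j0 + v0 j0, ?_, ?_, ?_, ?_, hj0, ?_⟩
      · intro j; dsimp only; split_ifs; exacts [ha i, le_rfl]
      · simp
      · exact add_nonneg (hc _ _) (hv0.1 j0)
      · exact (hj0 j1).trans hj1.le
      · simp; ring
    · push Not at h
      exact ⟨0, Λ, by simp, by simpa using ha i, hΛ, le_rfl, h, by simp⟩
  choose p u hp hpa hu0 huΛ huc hpu using row
  refine ⟨u, v0, fun i => ⟨hu0 i, huΛ i⟩, fun j => ⟨hv0.1 j, hv0.2 j⟩, huc, ?_⟩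
  let v : β → ℝ := fun j => if b j < ∑ i, P0 i j then Λ else 0
  have hv : v ∈ Y := by
    refine ⟨fun j => ?_, fun j => ?_⟩ <;> simp only [v, Pi.zero_apply] <;> split_ifs <;> simp [hΛ]
  have key := sad p ⟨hp, hpa⟩ v hv
  have e1 : f p v0 = (∑ i, a i * u i) - Λ * (∑ i, a i) - ∑ j, v0 j * b j := by
    simp only [f, hpu, mul_sub, Finset.sum_sub_distrib, Finset.mul_sum]
    congr 2
    refine Finset.sum_congr rfl fun i _ => by ring
  let θ : β → ℝ := fun j => if b j < ∑ i, P0 i j then b j / ∑ i, P0 i j else 1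
  have hcol : ∀ j, 0 ≤ ∑ i, P0 i j := fun j => Finset.sum_nonneg fun i _ => hP0.1 i j
  have hθ0 : ∀ j, 0 ≤ θ j := by
    intro j; simp only [θ]; split_ifs
    · exact div_nonneg (hb j) (hcol j)
    · exact zero_le_one
  have hθ1 : ∀ j, θ j ≤ 1 := by
    intro j; simp only [θ]; split_ifs with h
    · exact div_le_one_of_le₀ h.le (hcol j)
    · exact le_rfl
  have e2 := H (fun i j => P0 i j * θ j) (fun i j => mul_nonneg (hP0.1 i j) (hθ0 j))
    (fun i => le_trans (Finset.sum_le_sum fun j _ =>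
      mul_le_of_le_one_right (hP0.1 i j) (hθ1 j)) (hP0.2 i))
    (fun j => by
      rw [← Finset.sum_mul]
      simp only [θ]; split_ifs with h
      · rw [mul_div_cancel₀]; exact ((hb j).trans_lt h).ne'
      · simpa using h)
  have e3 : (∑ i, ∑ j, c i j * (P0 i j * θ j)) - Λ * (∑ i, ∑ j, P0 i j * θ j) ≤ f P0 v := by
    simp only [f]
    rw [Finset.sum_comm, Finset.sum_comm (f := fun i j => P0 i j * θ j),
      Finset.sum_comm (f := fun i j => (c i j - Λ + v j) * P0 i j), Finset.mul_sum,
      ← Finset.sum_sub_distrib, ← Finset.sum_sub_distrib]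
    refine Finset.sum_le_sum fun j _ => ?_
    have hcP : 0 ≤ ∑ i, c i j * P0 i j := Finset.sum_nonneg fun i _ => mul_nonneg (hc i j) (hP0.1 i j)
    have s1 : ∑ i, c i j * (P0 i j * θ j) = (∑ i, c i j * P0 i j) * θ j := by
      rw [Finset.sum_mul]; exact Finset.sum_congr rfl fun i _ => by ring
    have s2 : ∑ i, (c i j - Λ + v j) * P0 i j
        = (∑ i, c i j * P0 i j) - Λ * (∑ i, P0 i j) + v j * ∑ i, P0 i j := by
      rw [Finset.mul_sum, Finset.mul_sum, ← Finset.sum_sub_distrib, ← Finset.sum_add_distrib]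
      exact Finset.sum_congr rfl fun i _ => by ring
    rw [s1, s2, ← Finset.sum_mul]
    set C := ∑ i, c i j * P0 i j
    set S := ∑ i, P0 i j
    by_cases h : b j < S
    · have h2 : S * θ j = b j := by
        simp only [θ, S, if_pos h]
        rw [mul_div_cancel₀]; exact ((hb j).trans_lt h).ne'
      have h3 : v j = Λ := by simp only [v, S, if_pos h]
      rw [h2, h3]
      have := hθ1 j
      nlinarith
    · have h2 : θ j = 1 := by simp only [θ, S, if_neg h]
      have h3 : v j = 0 := by simp only [v, S, if_neg h]
      rw [h2, h3]; linarith
  simp only [mul_sub] at e2 ⊢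
  linarith


lemma primal {N : ℕ} (p : ℝ) (f : Euc N → ℝ) (hf01 : ∀ᵐ x, 0 ≤ f x ∧ f x ≤ 1)
    (h : Euc N × Euc N → ℝ≥0∞) (hh : Measurable h)
    (h1 : ∀ᵐ x, ∫⁻ y, h (x, y) = ENNReal.ofReal (f x))
    (h2 : ∀ᵐ y, ∫⁻ x, h (x, y) ≤ ENNReal.ofReal (1 - f y)) :
    WEnergyPow p volume f ≤ ∫⁻ z, ENNReal.ofReal (dist z.1 z.2 ^ p) * h z
      ∂((volume : Measure (Euc N)).prod volume) := by
  let ρ : Euc N → ℝ := fun y => (∫⁻ x, h (x, y)).toReal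
  have hρm : Measurable ρ := hh.lintegral_prod_left'.ennreal_toReal
  have hρ : ∀ᵐ y, ENNReal.ofReal (ρ y) = ∫⁻ x, h (x, y) := by
    filter_upwards [h2] with y hy
    exact ENNReal.ofReal_toReal (ne_top_of_le_ne_top ENNReal.ofReal_ne_top hy)
  have adm : Adm volume f ρ := by
    refine ⟨hρm, fun y => ENNReal.toReal_nonneg, ?_, ?_⟩
    · filter_upwards [h2, hf01] with y hy hy'
      have := ENNReal.toReal_mono ENNReal.ofReal_ne_top hy
      rw [ENNReal.toReal_ofReal (by linarith)] at this
      simp only [ρ]; linarith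
    · rw [lintegral_congr_ae hρ, ← lintegral_lintegral_swap (f := fun x y => h (x, y))
        hh.aemeasurable, lintegral_congr_ae h1]
  refine iInf₂_le_of_le ρ adm ?_
  refine iInf₂_le_of_le ((volume.prod volume).withDensity h) ⟨?_, ?_⟩ ?_
  · ext s hs
    rw [Measure.map_apply measurable_fst hs, withDensity_apply _ (measurable_fst hs),
      densM, withDensity_apply _ hs]
    have : (Prod.fst ⁻¹' s : Set (Euc N × Euc N)) = s ×ˢ univ := by ext; simp
    rw [this, setLIntegral_prod _ hh.aemeasurable]
    simp only [Measure.restrict_univ]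
    exact lintegral_congr_ae (ae_restrict_of_ae h1)
  · ext s hs
    rw [Measure.map_apply measurable_snd hs, withDensity_apply _ (measurable_snd hs),
      densM, withDensity_apply _ hs]
    have : (Prod.snd ⁻¹' s : Set (Euc N × Euc N)) = univ ×ˢ s := by ext; simp
    rw [this, setLIntegral_prod_symm _ hh.aemeasurable]
    simp only [Measure.restrict_univ]
    refine (lintegral_congr_ae (ae_restrict_of_ae hρ)).symm
  · rw [tCost, lintegral_withDensity_eq_lintegral_mul _ hh (by fun_prop)]
    simp [mul_comm]

/-- cube cells of side `L` -/
def cq (N : ℕ) (L : ℝ) (x : Euc N) : Fin N → ℤ := fun i => ⌊x i / L⌋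

lemma cq_meas {N : ℕ} (L : ℝ) : Measurable (cq N L) := by
  unfold cq
  refine measurable_pi_lambda _ fun i => ?_
  exact Int.measurable_floor.comp (by fun_prop)

lemma cq_dist {N : ℕ} (hN : 1 ≤ N) {L : ℝ} (hL : 0 < L) (x y : Euc N) (h : cq N L x = cq N L y) :
    dist x y ≤ N * L := by
  rw [EuclideanSpace.dist_eq]
  apply Real.sqrt_le_iff.2 ⟨by positivity, ?_⟩
  have : ∀ i, dist (x i) (y i) ^ 2 ≤ L ^ 2 := by
    intro i
    have hi : ⌊x i / L⌋ = ⌊y i / L⌋ := congrFun h i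
    have := Int.abs_sub_lt_one_of_floor_eq_floor hi
    rw [← sub_div, abs_div, abs_of_pos hL, div_lt_one hL] at this
    rw [Real.dist_eq]
    exact pow_le_pow_left₀ (abs_nonneg _) this.le 2
  calc _ ≤ ∑ i : Fin N, L ^ 2 := Finset.sum_le_sum fun i _ => this i
    _ = N * L ^ 2 := by simp
    _ ≤ (N * L) ^ 2 := by
      have : (1:ℝ) ≤ N := by exact_mod_cast hN
      rw [mul_pow]
      gcongr
      nlinarith

lemma cq_vol {N : ℕ} {L : ℝ} (hL : 0 < L) (k : Fin N → ℤ) :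
    volume (cq N L ⁻¹' {k}) = ENNReal.ofReal L ^ N := by
  have mp := PiLp.volume_preserving_ofLp (Fin N)
  have : cq N L ⁻¹' {k} = WithLp.ofLp ⁻¹' (Set.pi univ fun i => Ico (k i * L) ((k i + 1) * L)) := by
    ext x
    simp only [mem_preimage, mem_singleton_iff, Set.mem_pi, mem_univ, true_imp_iff, mem_Ico, cq,
      funext_iff, Int.floor_eq_iff, le_div_iff₀ hL, div_lt_iff₀ hL]
  rw [this, mp.measure_preimage (MeasurableSet.univ_pi fun i => measurableSet_Ico).nullMeasurableSet,
    Real.volume_pi_Ico]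
  simp [add_mul]

lemma residual_cost {N : ℕ} (hN : 1 ≤ N) (p : ℝ) (hp : 1 < p) (f : Euc N → ℝ) (hfm : Measurable f)
    (hf01 : ∀ᵐ x, 0 ≤ f x ∧ f x ≤ 1)
    (hfi : ∫⁻ x, ENNReal.ofReal (f x) = 1)
    (h : Euc N × Euc N → ℝ≥0∞) (hh : Measurable h)
    (h1 : ∀ᵐ x, ∫⁻ y, h (x, y) ≤ ENNReal.ofReal (f x))
    (h2 : ∀ᵐ y, ∫⁻ x, h (x, y) ≤ ENNReal.ofReal (1 - f y)) :
    WEnergyPow p volume f ≤ (∫⁻ z, ENNReal.ofReal (dist z.1 z.2 ^ p) * h z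
      ∂((volume : Measure (Euc N)).prod volume)) + ENNReal.ofReal ((N * 3) ^ p) *
        (1 - ∫⁻ z, h z ∂((volume : Measure (Euc N)).prod volume)) := by
  set F : Euc N → ℝ≥0∞ := fun x => ENNReal.ofReal (f x) with hF
  set G : Euc N → ℝ≥0∞ := fun x => ENNReal.ofReal (1 - f x) with hG
  have mF : Measurable F := by fun_prop
  have mG : Measurable G := by fun_prop
  have hFG : ∀ᵐ x, F x + G x = 1 := by
    filter_upwards [hf01] with x hx
    rw [hF, hG]; beta_reduce
    rw [← ENNReal.ofReal_add hx.1 (by linarith)]; simp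
  have mh1 : Measurable fun x => ∫⁻ y, h (x, y) := hh.lintegral_prod_right'
  have mh2 : Measurable fun y => ∫⁻ x, h (x, y) := hh.lintegral_prod_left'
  set r : Euc N → ℝ≥0∞ := fun x => F x - ∫⁻ y, h (x, y) with hr
  set g : Euc N → ℝ≥0∞ := fun y => G y - ∫⁻ x, h (x, y) with hg
  have mr : Measurable r := mF.sub mh1
  have mg : Measurable g := mG.sub mh2
  let q := cq N 3
  have mq : Measurable q := cq_meas 3
  have mC : ∀ k, MeasurableSet (q ⁻¹' {k}) := fun k => mq (measurableSet_singleton k)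
  have hhtot : ∫⁻ y, ∫⁻ x, h (x, y) = ∫⁻ x, ∫⁻ y, h (x, y) :=
    (lintegral_lintegral_swap (f := fun x y => h (x, y)) hh.aemeasurable).symm
  have hhle : ∫⁻ x, ∫⁻ y, h (x, y) ≤ 1 := (lintegral_mono_ae h1).trans hfi.le
  let Gk : (Fin N → ℤ) → ℝ≥0∞ := fun k => ∫⁻ y in q ⁻¹' {k}, g y
  have hGk1 : ∀ k, 1 ≤ Gk k := by
    intro k
    have e1 : (3:ℝ≥0∞) ≤ volume (q ⁻¹' {k}) := by
      rw [cq_vol (by norm_num)]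
      simp only [ENNReal.ofReal_ofNat]
      exact le_self_pow₀ (by norm_num) (by omega)
    have e2 : volume (q ⁻¹' {k}) = (∫⁻ x in q ⁻¹' {k}, F x) + ∫⁻ x in q ⁻¹' {k}, G x := by
      rw [← lintegral_add_left mF, lintegral_congr_ae (ae_restrict_of_ae hFG)]
      simp
    have e3 : ∫⁻ x in q ⁻¹' {k}, F x ≤ 1 := (setLIntegral_le_lintegral _ _).trans hfi.le
    have e4 : ∫⁻ x in q ⁻¹' {k}, G x ≤ Gk k + 1 := by
      calc _ ≤ ∫⁻ y in q ⁻¹' {k}, (g y + ∫⁻ x, h (x, y)) := lintegral_mono fun y => le_tsub_add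
        _ = Gk k + ∫⁻ y in q ⁻¹' {k}, ∫⁻ x, h (x, y) := lintegral_add_left mg _
        _ ≤ _ := by
          gcongr
          exact (setLIntegral_le_lintegral _ _).trans (hhtot.le.trans hhle)
    have : (2:ℝ≥0∞) + 1 ≤ 2 + Gk k := by
      calc (2:ℝ≥0∞) + 1 = 3 := by norm_num
        _ ≤ _ := e1
        _ ≤ 1 + (Gk k + 1) := by rw [e2]; gcongr
        _ = _ := by rw [← one_add_one_eq_two]; ring
    exact (ENNReal.add_le_add_iff_left (by norm_num)).1 this
  have hGkt : ∀ k, Gk k ≠ ⊤ := by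
    intro k
    refine ne_top_of_le_ne_top (b := volume (q ⁻¹' {k})) ?_ ?_
    · rw [cq_vol (by norm_num)]; simp
    · calc Gk k ≤ ∫⁻ x in q ⁻¹' {k}, 1 := by
            apply lintegral_mono_ae
            apply ae_restrict_of_ae
            filter_upwards [hFG] with x hx
            exact tsub_le_self.trans (le_add_self.trans hx.le)
        _ = _ := by simp
  have hGk0 : ∀ k, Gk k ≠ 0 := fun k => (zero_lt_one.trans_le (hGk1 k)).ne'
  have mGk : Measurable fun x => Gk (q x) := (Measurable.of_discrete (f := Gk)).comp mq
  have mD : MeasurableSet {z : Euc N × Euc N | q z.1 = q z.2} :=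
    measurableSet_eq_fun (mq.comp measurable_fst) (mq.comp measurable_snd)
  let h' : Euc N × Euc N → ℝ≥0∞ := indicator {z : Euc N × Euc N | q z.1 = q z.2}
    fun z => r z.1 * g z.2 / Gk (q z.1)
  have mh' : Measurable h' := by
    refine Measurable.indicator ?_ mD
    exact ((mr.comp measurable_fst).mul (mg.comp measurable_snd)).div (mGk.comp measurable_fst)
  have i1 : ∀ x, ∫⁻ y, h' (x, y) = r x := by
    intro x
    have : ∀ y, h' (x, y) = (r x / Gk (q x)) * indicator (q ⁻¹' {q x}) g y := by
      intro y
      by_cases hy : q x = q y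
      · rw [indicator_of_mem (by simp [hy])]
        simp only [h']
        rw [indicator_of_mem (by exact hy), div_eq_mul_inv, div_eq_mul_inv]; ring
      · rw [indicator_of_notMem (by simpa using Ne.symm hy)]
        simp only [h']
        rw [indicator_of_notMem (by exact hy), mul_zero]
    simp only [this]
    rw [lintegral_const_mul _ (mg.indicator (mC _)), lintegral_indicator (mC _)]
    exact ENNReal.div_mul_cancel (hGk0 _) (hGkt _)
  have i2 : ∀ y, ∫⁻ x, h' (x, y) ≤ g y := by
    intro y
    have : ∀ x, h' (x, y) = (g y / Gk (q y)) * indicator (q ⁻¹' {q y}) r x := by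
      intro x
      by_cases hy : q x = q y
      · rw [indicator_of_mem (by simp [hy])]
        simp only [h']
        rw [indicator_of_mem (by exact hy), div_eq_mul_inv, div_eq_mul_inv]; simp only [hy]; ring
      · rw [indicator_of_notMem (by simpa using hy)]
        simp only [h']
        rw [indicator_of_notMem (by exact hy), mul_zero]
    simp only [this]
    rw [lintegral_const_mul _ (mr.indicator (mC _)), lintegral_indicator (mC _)]
    calc _ ≤ g y / Gk (q y) * Gk (q y) := by
          gcongr
          calc _ ≤ ∫⁻ x, r x := setLIntegral_le_lintegral _ _
            _ ≤ ∫⁻ x, F x := lintegral_mono fun x => tsub_le_self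
            _ = 1 := hfi
            _ ≤ _ := hGk1 _
      _ = _ := ENNReal.div_mul_cancel (hGk0 _) (hGkt _)
  refine (primal p f hf01 (fun z => h z + h' z) (hh.add mh') ?_ ?_).trans ?_
  · filter_upwards [h1] with x hx
    rw [lintegral_add_right (g := fun y => h' (x, y)) _ (mh'.comp measurable_prodMk_left), i1]
    exact add_tsub_cancel_of_le hx
  · filter_upwards [h2] with y hy
    rw [lintegral_add_right (g := fun x => h' (x, y)) _ (mh'.comp measurable_prodMk_right)]
    exact (add_le_add_right (i2 y) _).trans (add_tsub_cancel_of_le hy).le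
  · simp only [mul_add]
    rw [lintegral_add_right _ (by fun_prop)]
    gcongr
    calc _ ≤ ∫⁻ z, ENNReal.ofReal ((N * 3) ^ p) * h' z ∂(volume.prod volume) := by
          refine lintegral_mono fun z => ?_
          by_cases hz : q z.1 = q z.2
          · gcongr
            exact cq_dist hN (by norm_num) _ _ hz
          · simp only [h']
            rw [indicator_of_notMem (by exact hz)]; simp
      _ = ENNReal.ofReal ((N * 3) ^ p) * ∫⁻ z, h' z ∂(volume.prod volume) :=
          lintegral_const_mul _ mh'
      _ ≤ _ := by
          gcongr
          rw [lintegral_prod _ mh'.aemeasurable, lintegral_prod _ hh.aemeasurable]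
          simp only [i1, hr]
          rw [lintegral_sub mh1 (ne_top_of_le_ne_top (by simp) hhle) h1, hfi]



lemma sum_ind_le {X ι : Type*} [Fintype ι] (A : ι → Set X) (hA : Pairwise (Function.onFun Disjoint A))
    (F : X → ℝ≥0∞) (x : X) : ∑ i, indicator (A i) F x ≤ F x := by
  have := congrFun (Finset.indicator_biUnion Finset.univ A (f := F)
    (fun i _ j _ hij => hA hij)) x
  rw [← this]
  exact indicator_le_self _ _ x

lemma disc_cost {N : ℕ} (hN : 1 ≤ N) (p : ℝ) (hp : 1 < p) (f : Euc N → ℝ) (hfm : Measurable f)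
    (hf01 : ∀ᵐ x, 0 ≤ f x ∧ f x ≤ 1)
    (hfi : ∫⁻ x, ENNReal.ofReal (f x) = 1)
    {α β : Type} [Fintype α] [Fintype β] (A : α → Set (Euc N)) (B : β → Set (Euc N))
    (mA : ∀ i, MeasurableSet (A i)) (mB : ∀ i, MeasurableSet (B i))
    (dA : Pairwise (Function.onFun Disjoint A)) (dB : Pairwise (Function.onFun Disjoint B))
    (c : α → β → ℝ) (hc : ∀ i j, 0 ≤ c i j)
    (hcd : ∀ i j, ∀ x ∈ A i, ∀ y ∈ B j, dist x y ^ p ≤ c i j)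
    (P : α → β → ℝ) (hP : ∀ i j, 0 ≤ P i j)
    (hPA : ∀ i, ∑ j, P i j ≤ (∫⁻ x in A i, ENNReal.ofReal (f x)).toReal)
    (hPB : ∀ j, ∑ i, P i j ≤ (∫⁻ x in B j, ENNReal.ofReal (1 - f x)).toReal)
    (hBt : ∀ j, ∫⁻ x in B j, ENNReal.ofReal (1 - f x) ≠ ⊤) :
    WEnergyPow p volume f ≤ ENNReal.ofReal ((∑ i, ∑ j, c i j * P i j) +
      (N * 3) ^ p * (1 - ∑ i, ∑ j, P i j)) ∧
      0 ≤ (∑ i, ∑ j, c i j * P i j) + (N * 3) ^ p * (1 - ∑ i, ∑ j, P i j) := by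
  classical
  set F : Euc N → ℝ≥0∞ := fun x => ENNReal.ofReal (f x) with hF
  set G : Euc N → ℝ≥0∞ := fun x => ENNReal.ofReal (1 - f x) with hG
  have mF : Measurable F := by fun_prop
  have mG : Measurable G := by fun_prop
  set a : α → ℝ≥0∞ := fun i => ∫⁻ x in A i, F x with ha
  set b : β → ℝ≥0∞ := fun i => ∫⁻ x in B i, G x with hb
  have hat : ∀ i, a i ≠ ⊤ := fun i => ne_top_of_le_ne_top (by simp)
    ((setLIntegral_le_lintegral _ _).trans hfi.le)
  set Q : α → β → ℝ≥0∞ := fun i j => ENNReal.ofReal (P i j) with hQ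
  have hQA : ∀ i, ∑ j, Q i j ≤ a i := by
    intro i
    simp only [hQ]
    rw [← ENNReal.ofReal_sum_of_nonneg fun j _ => hP i j]
    exact ENNReal.ofReal_le_of_le_toReal (hPA i)
  have hQB : ∀ j, ∑ i, Q i j ≤ b j := by
    intro j
    simp only [hQ]
    rw [← ENNReal.ofReal_sum_of_nonneg fun i _ => hP i j]
    exact ENNReal.ofReal_le_of_le_toReal (hPB j)
  have hQa : ∀ i j, Q i j ≤ a i := fun i j =>
    (Finset.single_le_sum (f := fun j => Q i j) (fun _ _ => zero_le) (Finset.mem_univ j)).trans (hQA i)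
  have hQb : ∀ i j, Q i j ≤ b j := fun i j =>
    (Finset.single_le_sum (f := fun i => Q i j) (fun _ _ => zero_le) (Finset.mem_univ i)).trans (hQB j)
  set w : α → β → ℝ≥0∞ := fun i j => Q i j / a i / b j with hw
  have wb : ∀ i j, w i j * b j = Q i j / a i := by
    intro i j
    by_cases h : b j = 0
    · have : Q i j = 0 := by simpa [h] using hQb i j
      simp [hw, this]
    · exact ENNReal.div_mul_cancel h (hBt j)
  have wba : ∀ i j, w i j * b j * a i = Q i j := by
    intro i j
    rw [wb]
    by_cases h : a i = 0
    · have : Q i j = 0 := by simpa [h] using hQa i j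
      simp [this]
    · exact ENNReal.div_mul_cancel h (hat i)
  have wa : ∀ i j, w i j * a i = Q i j / b j := by
    intro i j
    by_cases h : b j = 0
    · have : Q i j = 0 := by simpa [h] using hQb i j
      simp [hw, this]
    · rw [← wba i j, ENNReal.eq_div_iff h (hBt j)]; ring
  let h : Euc N × Euc N → ℝ≥0∞ := fun z =>
    ∑ i, ∑ j, w i j * (indicator (A i) F z.1 * indicator (B j) G z.2)
  have mFA : ∀ i, Measurable (indicator (A i) F) := fun i => mF.indicator (mA i)
  have mGB : ∀ j, Measurable (indicator (B j) G) := fun j => mG.indicator (mB j)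
  have mh : Measurable h := by
    refine Finset.measurable_sum _ fun i _ => Finset.measurable_sum _ fun j _ => ?_
    exact (((mFA i).comp measurable_fst).mul ((mGB j).comp measurable_snd)).const_mul _
  have mt : ∀ i j, Measurable fun z : Euc N × Euc N =>
      w i j * (indicator (A i) F z.1 * indicator (B j) G z.2) := fun i j =>
    (((mFA i).comp measurable_fst).mul ((mGB j).comp measurable_snd)).const_mul _
  have mt' : ∀ i j, Measurable fun z : Euc N × Euc N =>
      indicator (A i) F z.1 * indicator (B j) G z.2 := fun i j =>
    ((mFA i).comp measurable_fst).mul ((mGB j).comp measurable_snd)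
  have key := residual_cost hN p hp f hfm hf01 hfi h mh ?_ ?_
  · have mass : ∫⁻ z, h z ∂((volume : Measure (Euc N)).prod volume) = ∑ i, ∑ j, Q i j := by
      simp only [h]
      rw [lintegral_finsetSum _ fun i _ => Finset.measurable_sum _ fun j _ => mt i j]
      refine Finset.sum_congr rfl fun i _ => ?_
      rw [lintegral_finsetSum _ fun j _ => mt i j]
      refine Finset.sum_congr rfl fun j _ => ?_
      rw [lintegral_const_mul _ (mt' i j),
        lintegral_prod_mul (mFA i).aemeasurable (mGB j).aemeasurable, lintegral_indicator (mA i),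
        lintegral_indicator (mB j), ← wba i j]
      simp only [ha, hb]; ring
    have cost : ∫⁻ z, ENNReal.ofReal (dist z.1 z.2 ^ p) * h z
        ∂((volume : Measure (Euc N)).prod volume) ≤ ∑ i, ∑ j, ENNReal.ofReal (c i j) * Q i j := by
      calc _ ≤ ∫⁻ z, ∑ i, ∑ j, ENNReal.ofReal (c i j) *
            (w i j * (indicator (A i) F z.1 * indicator (B j) G z.2))
            ∂((volume : Measure (Euc N)).prod volume) := by
            refine lintegral_mono fun z => ?_
            simp only [h, Finset.mul_sum]
            refine Finset.sum_le_sum fun i _ => Finset.sum_le_sum fun j _ => ?_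
            by_cases h1 : z.1 ∈ A i
            · by_cases h2 : z.2 ∈ B j
              · gcongr
                exact hcd i j _ h1 _ h2
              · simp [h2]
            · simp [h1]
        _ = _ := by
            rw [lintegral_finsetSum _ fun i _ => Finset.measurable_sum _ fun j _ =>
              (mt i j).const_mul _]
            refine Finset.sum_congr rfl fun i _ => ?_
            rw [lintegral_finsetSum _ fun j _ => (mt i j).const_mul _]
            refine Finset.sum_congr rfl fun j _ => ?_
            rw [lintegral_const_mul _ (mt i j),
              lintegral_const_mul _ (mt' i j),
              lintegral_prod_mul (mFA i).aemeasurable (mGB j).aemeasurable,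
              lintegral_indicator (mA i), lintegral_indicator (mB j), ← wba i j]
            simp only [ha, hb]; ring
    have hPs : ∑ i, ∑ j, Q i j = ENNReal.ofReal (∑ i, ∑ j, P i j) := by
      rw [ENNReal.ofReal_sum_of_nonneg fun i _ => Finset.sum_nonneg fun j _ => hP i j]
      refine Finset.sum_congr rfl fun i _ => ?_
      rw [ENNReal.ofReal_sum_of_nonneg fun j _ => hP i j]
    have hcs : ∑ i, ∑ j, ENNReal.ofReal (c i j) * Q i j = ENNReal.ofReal (∑ i, ∑ j, c i j * P i j) := by
      rw [ENNReal.ofReal_sum_of_nonneg fun i _ => Finset.sum_nonneg fun j _ =>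
        mul_nonneg (hc i j) (hP i j)]
      refine Finset.sum_congr rfl fun i _ => ?_
      rw [ENNReal.ofReal_sum_of_nonneg fun j _ => mul_nonneg (hc i j) (hP i j)]
      refine Finset.sum_congr rfl fun j _ => ?_
      rw [ENNReal.ofReal_mul (hc i j)]
    have hP0 : 0 ≤ ∑ i, ∑ j, P i j := Finset.sum_nonneg fun i _ => Finset.sum_nonneg fun j _ => hP i j
    have hC0 : 0 ≤ ∑ i, ∑ j, c i j * P i j :=
      Finset.sum_nonneg fun i _ => Finset.sum_nonneg fun j _ => mul_nonneg (hc i j) (hP i j)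
    have hP1 : ∑ i, ∑ j, P i j ≤ 1 := by
      have : ∑ i, ∑ j, Q i j ≤ 1 := by
        calc _ ≤ ∑ i, a i := Finset.sum_le_sum fun i _ => hQA i
          _ = ∫⁻ x, ∑ i, indicator (A i) F x := by
            rw [lintegral_finsetSum _ fun i _ => mFA i]
            refine Finset.sum_congr rfl fun i _ => ?_
            rw [lintegral_indicator (mA i)]
          _ ≤ ∫⁻ x, F x := lintegral_mono fun x => sum_ind_le A dA F x
          _ = 1 := hfi
      rw [hPs] at this
      simpa using this
    have hΛ : (0:ℝ) ≤ (N * 3) ^ p := by positivity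
    refine ⟨?_, add_nonneg hC0 (mul_nonneg hΛ (by linarith))⟩
    rw [ENNReal.ofReal_add hC0 (mul_nonneg hΛ (by linarith)), ENNReal.ofReal_mul hΛ,
      ENNReal.ofReal_sub _ hP0, ENNReal.ofReal_one, ← hPs, ← hcs]
    refine key.trans ?_
    rw [mass]
    gcongr
  · refine Eventually.of_forall fun x => ?_
    simp only [h]
    rw [lintegral_finsetSum _ fun i _ => Finset.measurable_sum _ fun j _ =>
      ((mGB j).const_mul _).const_mul _]
    refine le_trans (Finset.sum_le_sum fun i _ => ?_) (sum_ind_le A dA F x)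
    rw [lintegral_finsetSum _ fun j _ => ((mGB j).const_mul _).const_mul _]
    calc _ = ∑ j, indicator (A i) F x * (Q i j / a i) := by
          refine Finset.sum_congr rfl fun j _ => ?_
          rw [lintegral_const_mul _ ((mGB j).const_mul _), lintegral_const_mul _ (mGB j),
            lintegral_indicator (mB j), ← wb]
          simp only [hb]; ring
      _ = indicator (A i) F x * ((∑ j, Q i j) / a i) := by
          simp only [div_eq_mul_inv]
          rw [← Finset.mul_sum, Finset.sum_mul]
      _ ≤ indicator (A i) F x * 1 := by
          gcongr
          exact (ENNReal.div_le_div_right (hQA i) _).trans ENNReal.div_self_le_one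
      _ = _ := mul_one _
  · refine Eventually.of_forall fun y => ?_
    simp only [h]
    have e : ∀ x, ∑ i, ∑ j, w i j * (indicator (A i) F x * indicator (B j) G y)
        = ∑ j, ∑ i, w i j * indicator (B j) G y * indicator (A i) F x := by
      intro x
      rw [Finset.sum_comm]
      refine Finset.sum_congr rfl fun j _ => Finset.sum_congr rfl fun i _ => by ring
    simp only [e]
    rw [lintegral_finsetSum _ fun j _ => Finset.measurable_sum _ fun i _ =>
      ((mFA i).const_mul _)]
    refine le_trans (Finset.sum_le_sum fun j _ => ?_) (sum_ind_le B dB G y)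
    rw [lintegral_finsetSum _ fun i _ => ((mFA i).const_mul _)]
    calc _ = ∑ i, indicator (B j) G y * (Q i j / b j) := by
          refine Finset.sum_congr rfl fun i _ => ?_
          rw [lintegral_const_mul _ (mFA i),
            lintegral_indicator (mA i), ← wa]
          simp only [ha]; ring
      _ = indicator (B j) G y * ((∑ i, Q i j) / b j) := by
          simp only [div_eq_mul_inv]
          rw [← Finset.mul_sum, Finset.sum_mul]
      _ ≤ indicator (B j) G y * 1 := by
          gcongr
          exact (ENNReal.div_le_div_right (hQB j) _).trans ENNReal.div_self_le_one
      _ = _ := mul_one _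

lemma uB_meas {N : ℕ} : MeasurableSet (uB N) := measurableSet_lt meas_bv measurable_const

lemma weak_dual {N : ℕ} (hN : 1 ≤ N) (φ ψ : Euc N → ℝ≥0∞) (hφ : Measurable φ)
    (hψ : Measurable ψ) (K : ℝ → ℝ) (hK0 : ∀ r, 0 ≤ r → 0 ≤ K r)
    (hKm : ∀ r s, 0 ≤ r → r ≤ s → K r ≤ K s)
    (H : ∀ x y, φ x ≤ ψ y + ENNReal.ofReal (K (dist x y)))
    (ρ' : Euc N → ℝ) (adm : Adm volume ((uB N).indicator 1) ρ') (π : Measure (Euc N × Euc N))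
    (hπ : IsCoupling π (densM volume ((uB N).indicator 1)) (densM volume ρ')) :
    ∫⁻ x in uB N, sdr φ x ≤ (∫⁻ y in (uB N)ᶜ, sdr ψ y) +
      ∫⁻ z, ENNReal.ofReal (K (dist z.1 z.2)) ∂π := by
  have mφ := star_meas φ
  have mψ := star_meas ψ
  have hρm := adm.1
  have e1 : ∫⁻ x in uB N, sdr φ x = ∫⁻ z, sdr φ z.1 ∂π := by
    rw [← lintegral_map (f := sdr φ) mφ measurable_fst, hπ.1, densM,
      lintegral_withDensity_eq_lintegral_mul _ _ mφ, ← lintegral_indicator uB_meas]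
    · refine lintegral_congr fun x => ?_
      by_cases hx : x ∈ uB N <;> simp [hx]
    · exact (measurable_one.indicator uB_meas).ennreal_ofReal
  have e2 : ∫⁻ z, sdr ψ z.2 ∂π ≤ ∫⁻ y in (uB N)ᶜ, sdr ψ y := by
    rw [← lintegral_map (f := sdr ψ) mψ measurable_snd, hπ.2, densM,
      lintegral_withDensity_eq_lintegral_mul _ (by fun_prop) mψ, ← lintegral_indicator uB_meas.compl]
    refine lintegral_mono_ae ?_
    filter_upwards [adm.2.2.1] with y hy
    by_cases hyB : y ∈ uB N
    · simp only [hyB, indicator_of_mem, Pi.one_apply] at hy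
      have : ρ' y ≤ 0 := by linarith
      simp [ENNReal.ofReal_of_nonpos this]
    · simp only [hyB, not_false_eq_true, indicator_of_notMem] at hy
      rw [indicator_of_mem (by exact hyB)]
      have : ENNReal.ofReal (ρ' y) ≤ 1 := by simpa using hy
      exact mul_le_of_le_one_left' this
  rw [e1]
  calc _ ≤ ∫⁻ z, (sdr ψ z.2 + ENNReal.ofReal (K (dist z.1 z.2))) ∂π :=
        lintegral_mono fun z => star_ineq hN φ ψ hφ hψ K hK0 hKm H z.1 z.2
    _ = (∫⁻ z, sdr ψ z.2 ∂π) + ∫⁻ z, ENNReal.ofReal (K (dist z.1 z.2)) ∂π :=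
        lintegral_add_left (mψ.comp measurable_snd) _
    _ ≤ _ := by gcongr

lemma combine {N : ℕ} (hN : 1 ≤ N) (f : Euc N → ℝ) (hfm : Measurable f)
    (hf01 : ∀ᵐ x, 0 ≤ f x ∧ f x ≤ 1) (hfi : ∫⁻ x, ENNReal.ofReal (f x) = 1)
    (W e : ℝ≥0∞) (φ ψ : Euc N → ℝ≥0∞) (hφ : Measurable φ)
    (hψ : Measurable ψ) (K : ℝ → ℝ) (hK0 : ∀ r, 0 ≤ r → 0 ≤ K r)
    (hKm : ∀ r s, 0 ≤ r → r ≤ s → K r ≤ K s)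
    (H : ∀ x y, φ x ≤ ψ y + ENNReal.ofReal (K (dist x y)))
    (hψs : volume {z | 0 < ψ z} ≠ ⊤) (hψi : ∫⁻ x, ψ x ≠ ⊤)
    (hW : W + ∫⁻ y, ψ y * ENNReal.ofReal (1 - f y) ≤ (∫⁻ x, φ x * ENNReal.ofReal (f x)) + e)
    (ρ' : Euc N → ℝ) (adm : Adm volume ((uB N).indicator 1) ρ') (π : Measure (Euc N × Euc N))
    (hπ : IsCoupling π (densM volume ((uB N).indicator 1)) (densM volume ρ')) :
    W ≤ (∫⁻ z, ENNReal.ofReal (K (dist z.1 z.2)) ∂π) + e := by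
  have mF : Measurable fun x => ENNReal.ofReal (f x) := by fun_prop
  have hF1 : ∀ᵐ x, ENNReal.ofReal (f x) ≤ 1 := by
    filter_upwards [hf01] with x hx
    simpa using hx.2
  have a1 := star_HL hN φ hφ _ mF hF1 hfi
  have a2 := star_HL hN ψ hψ _ mF hF1 hfi
  have a3 := star_total hN ψ hψ hψs
  have a4 := weak_dual hN φ ψ hφ hψ K hK0 hKm H ρ' adm π hπ
  have a5 : ∫⁻ x, ψ x = (∫⁻ x, ψ x * ENNReal.ofReal (f x)) + ∫⁻ y, ψ y * ENNReal.ofReal (1 - f y) := by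
    rw [← lintegral_add_left (by fun_prop)]
    refine lintegral_congr_ae ?_
    filter_upwards [hf01] with x hx
    rw [← mul_add, ← ENNReal.ofReal_add hx.1 (by linarith)]; simp
  have a6 := lintegral_add_compl (μ := volume) (sdr ψ) (uB_meas (N := N))
  rw [a3] at a6
  have t1 : ∫⁻ x in uB N, sdr ψ x ≠ ⊤ := ne_top_of_le_ne_top hψi (by rw [← a6]; exact le_self_add)
  have t2 : ∫⁻ x in (uB N)ᶜ, sdr ψ x ≠ ⊤ := ne_top_of_le_ne_top hψi (by rw [← a6]; exact le_add_self)
  set x1 := ∫⁻ x in uB N, sdr ψ x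
  set x2 := ∫⁻ x in (uB N)ᶜ, sdr ψ x
  set C := ∫⁻ z, ENNReal.ofReal (K (dist z.1 z.2)) ∂π
  refine (ENNReal.add_le_add_iff_right (ENNReal.add_ne_top.2 ⟨t1, t2⟩)).1 ?_
  calc W + (x1 + x2) = (W + ∫⁻ y, ψ y * ENNReal.ofReal (1 - f y)) +
        (∫⁻ x, ψ x * ENNReal.ofReal (f x)) := by rw [a6, a5]; ring
    _ ≤ ((x2 + C) + e) + x1 := by
        exact add_le_add (hW.trans (add_le_add (a1.trans a4) le_rfl)) a2
    _ = C + e + (x1 + x2) := by ring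


lemma cell_int {X ι : Type*} [MeasurableSpace X] [MeasurableSpace ι] [MeasurableSingletonClass ι]
    (μ : Measure X) (q : X → ι) (hq : Measurable q)
    (S : Finset ι) (g : ι → ℝ≥0∞) (hg : ∀ k, k ∉ S → g k = 0) (F : X → ℝ≥0∞) (hF : Measurable F) :
    ∫⁻ x, g (q x) * F x ∂μ = ∑ k ∈ S, g k * ∫⁻ x in q ⁻¹' {k}, F x ∂μ := by
  classical
  have mk : ∀ k, MeasurableSet (q ⁻¹' {k}) := fun k => hq (measurableSet_singleton k)
  have e : ∀ x, g (q x) * F x = ∑ k ∈ S, g k * indicator (q ⁻¹' {k}) F x := by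
    intro x
    by_cases h : q x ∈ S
    · rw [Finset.sum_eq_single_of_mem (q x) h]
      · simp
      · intro k _ hk
        rw [indicator_of_notMem (by simpa using hk.symm), mul_zero]
    · rw [hg _ h, zero_mul, Finset.sum_eq_zero]
      intro k hk
      rw [indicator_of_notMem, mul_zero]
      rintro hx
      have : q x = k := hx
      exact h (this ▸ hk)
  simp only [e]
  rw [lintegral_finsetSum _ fun k _ => (hF.indicator (mk k)).const_mul _]
  refine Finset.sum_congr rfl fun k _ => ?_
  rw [lintegral_const_mul _ (hF.indicator (mk k)), lintegral_indicator (mk k)]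

lemma approx {N : ℕ} (hN : 1 ≤ N) (p : ℝ) (hp : 1 < p) (f : Euc N → ℝ) (hfm : Measurable f)
    (hf01 : ∀ᵐ x, 0 ≤ f x ∧ f x ≤ 1) (hfi : ∫⁻ x, ENNReal.ofReal (f x) = 1)
    (η ε : ℝ) (hη : 0 < η) (hε : 0 < ε)
    (ρ' : Euc N → ℝ) (adm : Adm volume ((uB N).indicator 1) ρ') (π : Measure (Euc N × Euc N))
    (hπ : IsCoupling π (densM volume ((uB N).indicator 1)) (densM volume ρ')) :
    WEnergyPow p volume f ≤ (∫⁻ z, ENNReal.ofReal ((dist z.1 z.2 + η) ^ p) ∂π) +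
      ENNReal.ofReal ((N * 3) ^ p * ε) := by
  classical
  have hN' : (0:ℝ) < N := by exact_mod_cast hN
  set Λ : ℝ := (N * 3) ^ p with hΛd
  have hΛ : 0 ≤ Λ := by positivity
  obtain ⟨δ, hδ, hD⟩ : ∃ δ : ℝ, 0 < δ ∧ 4 * (N * δ) = η := ⟨η / (4 * N), by positivity, by field_simp⟩
  set D : ℝ := N * δ with hDd
  have hD0 : 0 ≤ D := by positivity
  set q := cq N δ with hq
  have mq : Measurable q := cq_meas δ
  let F : Euc N → ℝ≥0∞ := fun x => ENNReal.ofReal (f x)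
  let G : Euc N → ℝ≥0∞ := fun x => ENNReal.ofReal (1 - f x)
  have mF : Measurable F := by fun_prop
  have mG : Measurable G := by fun_prop
  have mC : ∀ k, MeasurableSet (q ⁻¹' {k}) := fun k => mq (measurableSet_singleton k)
  have dC : Pairwise (Function.onFun Disjoint fun k => q ⁻¹' {k}) := by
    intro i j hij
    exact Disjoint.preimage _ (by simpa using hij)
  have vC : ∀ k, volume (q ⁻¹' {k}) = ENNReal.ofReal δ ^ N := fun k => cq_vol hδ k
  have neC : ∀ k, (q ⁻¹' {k}).Nonempty := by
    intro k
    apply nonempty_of_measure_ne_zero (μ := volume)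
    rw [vC]
    have : ENNReal.ofReal δ ≠ 0 := by simpa using hδ
    exact pow_ne_zero _ this
  choose zr hzr using neC
  have hzq : ∀ k, q (zr k) = k := fun k => hzr k
  have hzd : ∀ x, dist x (zr (q x)) ≤ D := fun x => cq_dist hN hδ _ _ (hzq (q x)).symm
  have hat : ∀ k, ∫⁻ x in q ⁻¹' {k}, F x ≠ ⊤ := fun k => ne_top_of_le_ne_top (by simp)
    ((setLIntegral_le_lintegral _ _).trans hfi.le)
  have hbt : ∀ k, ∫⁻ x in q ⁻¹' {k}, G x ≠ ⊤ := by
    intro k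
    refine ne_top_of_le_ne_top (b := volume (q ⁻¹' {k})) (by rw [vC]; exact ENNReal.pow_ne_top (by simp)) ?_
    calc _ ≤ ∫⁻ x in q ⁻¹' {k}, 1 := by
          refine lintegral_mono_ae (ae_restrict_of_ae ?_)
          filter_upwards [hf01] with x hx
          simpa [G] using hx.1
      _ = _ := by simp
  let a : (Fin N → ℤ) → ℝ := fun k => (∫⁻ x in q ⁻¹' {k}, F x).toReal
  let b : (Fin N → ℤ) → ℝ := fun k => (∫⁻ x in q ⁻¹' {k}, G x).toReal
  obtain ⟨S, hS⟩ : ∃ S : Finset (Fin N → ℤ), 1 - ε ≤ ∑ k ∈ S, a k := by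
    have h1 : ∑' k, ∫⁻ x in q ⁻¹' {k}, F x = 1 := by
      rw [← lintegral_iUnion mC dC, show (⋃ k, q ⁻¹' {k}) = univ from by ext x; simp]
      simpa using hfi
    have h2 : ENNReal.ofReal (1 - ε) < ∑' k, ∫⁻ x in q ⁻¹' {k}, F x := by
      rw [h1]; simpa using hε
    rw [ENNReal.tsum_eq_iSup_sum, lt_iSup_iff] at h2
    obtain ⟨S, hS⟩ := h2
    refine ⟨S, ?_⟩
    rw [← ENNReal.toReal_sum fun k _ => hat k]
    exact (ENNReal.ofReal_le_iff_le_toReal (ENNReal.sum_ne_top.2 fun k _ => hat k)).1 hS.le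
  obtain ⟨R, hR⟩ : ∃ R : ℝ, ∀ x, q x ∈ S → ‖x‖ ≤ R := by
    refine ⟨D + ∑ k ∈ S, ‖zr k‖, fun x hx => ?_⟩
    have h1 := hzd x
    have h2 := Finset.single_le_sum (f := fun k => ‖zr k‖) (fun k _ => norm_nonneg _) hx
    have h3 : ‖x‖ ≤ dist x (zr (q x)) + ‖zr (q x)‖ := by
      rw [dist_eq_norm]; simpa using norm_add_le (x - zr (q x)) (zr (q x))
    linarith
  obtain ⟨T, hT⟩ : ∃ T : Finset (Fin N → ℤ), ∀ y, q y ∉ T → R + N * 3 < ‖y‖ := by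
    refine ⟨Fintype.piFinset fun _ => Finset.Icc ⌊-(R + N * 3) / δ⌋ ⌊(R + N * 3) / δ⌋, fun y hy => ?_⟩
    by_contra hlt
    push Not at hlt
    apply hy
    rw [Fintype.mem_piFinset]
    intro i
    have h1 : |y i| ≤ R + N * 3 := (by simpa using PiLp.norm_apply_le y i : |y i| ≤ ‖y‖).trans hlt
    rw [abs_le] at h1
    rw [Finset.mem_Icc]
    exact ⟨Int.floor_le_floor (by gcongr; exact h1.1), Int.floor_le_floor (by gcongr; exact h1.2)⟩
  let c : (Fin N → ℤ) → (Fin N → ℤ) → ℝ := fun i j => (dist (zr i) (zr j) + 2 * D) ^ p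
  have hc : ∀ i j, 0 ≤ c i j := fun i j => by positivity
  have hcl : ∀ x y, dist x y ^ p ≤ c (q x) (q y) := by
    intro x y
    refine Real.rpow_le_rpow dist_nonneg ?_ (by linarith)
    have h1 := hzd x
    have h2 := hzd y
    have h3 := dist_triangle4 x (zr (q x)) (zr (q y)) y
    rw [dist_comm (zr (q y)) y] at h3
    linarith
  have hcu : ∀ x y, c (q x) (q y) ≤ (dist x y + η) ^ p := by
    intro x y
    refine Real.rpow_le_rpow (by positivity) ?_ (by linarith)
    have h1 := hzd x
    have h2 := hzd y
    have h3 := dist_triangle4 (zr (q x)) x y (zr (q y))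
    rw [dist_comm (zr (q x)) x] at h3
    linarith
  have hdisc := disc_cost hN p hp f hfm hf01 hfi (α := S) (β := T) (fun i => q ⁻¹' {i.1})
    (fun j => q ⁻¹' {j.1}) (fun i => mC _) (fun j => mC _)
    (fun i j hij => dC (fun h => hij (Subtype.ext h))) (fun i j hij => dC (fun h => hij (Subtype.ext h)))
    (fun i j => c i j) (fun i j => hc _ _) (fun i j x hx y hy => by
      have hx' : q x = i.1 := hx
      have hy' : q y = j.1 := hy
      have := hcl x y
      rwa [hx', hy'] at this)
  have hWt : WEnergyPow p volume f ≠ ⊤ := by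
    refine ne_top_of_le_ne_top ENNReal.ofReal_ne_top (hdisc 0 (by simp) (by simp) (by simp) fun j => hbt _).1
  obtain ⟨u, v, hu, hv, huv, hV⟩ := lp_duality (α := S) (β := T) (fun i => a i) (fun j => b j)
    (fun i j => c i j) Λ 1 (WEnergyPow p volume f).toReal (fun i => ENNReal.toReal_nonneg)
    (fun i => ENNReal.toReal_nonneg) (fun i j => hc _ _) hΛ (fun P hP hPA hPB => by
      obtain ⟨h1, h2⟩ := hdisc P hP hPA hPB fun j => hbt _
      exact ENNReal.toReal_le_of_le_ofReal h2 h1)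
  let u' : (Fin N → ℤ) → ℝ := fun k => if h : k ∈ S then u ⟨k, h⟩ else 0
  let v' : (Fin N → ℤ) → ℝ := fun k => if h : k ∈ T then v ⟨k, h⟩ else 0
  have hu0 : ∀ k, 0 ≤ u' k := by
    intro k
    simp only [u']
    split_ifs with h
    · exact (hu _).1
    · exact le_rfl
  have hv0 : ∀ k, 0 ≤ v' k := by
    intro k
    simp only [v']
    split_ifs with h
    · exact (hv _).1
    · exact le_rfl
  have s1 : ∑ i : S, a i * u i = ∑ k ∈ S, a k * u' k := by
    rw [← Finset.sum_coe_sort S]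
    refine Finset.sum_congr rfl fun i _ => ?_
    simp [u']
  have s2 : ∑ i : S, a i = ∑ k ∈ S, a k := Finset.sum_coe_sort S a
  have s3 : ∑ i : T, v i * b i = ∑ k ∈ T, v' k * b k := by
    rw [← Finset.sum_coe_sort T]
    refine Finset.sum_congr rfl fun i _ => ?_
    simp [v']
  rw [s1, s2, s3] at hV
  let g : (Fin N → ℤ) → ℝ≥0∞ := fun k => ENNReal.ofReal (u' k)
  let g' : (Fin N → ℤ) → ℝ≥0∞ := fun k => ENNReal.ofReal (v' k)
  have hg : ∀ k, k ∉ S → g k = 0 := fun k hk => by simp [g, u', hk]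
  have hg' : ∀ k, k ∉ T → g' k = 0 := fun k hk => by simp [g', v', hk]
  have i1 : ∫⁻ x, g (q x) * F x = ENNReal.ofReal (∑ k ∈ S, a k * u' k) := by
    rw [cell_int _ q mq S g hg F mF, ENNReal.ofReal_sum_of_nonneg fun k _ =>
      mul_nonneg ENNReal.toReal_nonneg (hu0 k)]
    refine Finset.sum_congr rfl fun k _ => ?_
    rw [mul_comm, ENNReal.ofReal_mul ENNReal.toReal_nonneg, ENNReal.ofReal_toReal (hat k)]
  have i2 : ∫⁻ x, g' (q x) * G x = ENNReal.ofReal (∑ k ∈ T, v' k * b k) := by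
    rw [cell_int _ q mq T g' hg' G mG, ENNReal.ofReal_sum_of_nonneg fun k _ =>
      mul_nonneg (hv0 k) ENNReal.toReal_nonneg]
    refine Finset.sum_congr rfl fun k _ => ?_
    rw [ENNReal.ofReal_mul (hv0 k), ENNReal.ofReal_toReal (hbt k)]
  have i3 : ∫⁻ x, g' (q x) ≠ ⊤ := by
    have := cell_int volume q mq T g' hg' (fun _ => 1) measurable_const
    simp only [mul_one] at this
    rw [this]
    refine ENNReal.sum_ne_top.2 fun k _ => ENNReal.mul_ne_top ENNReal.ofReal_ne_top ?_
    simp only [setLIntegral_one, vC]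
    exact ENNReal.pow_ne_top (by simp)
  refine combine hN f hfm hf01 hfi _ _ (fun x => g (q x)) (fun y => g' (q y))
    ((Measurable.of_discrete (f := g)).comp mq) ((Measurable.of_discrete (f := g')).comp mq)
    (fun r => (r + η) ^ p) (fun r hr => by positivity)
    (fun r s hr hrs => Real.rpow_le_rpow (by positivity) (by linarith) (by linarith)) ?_ ?_ i3 ?_
    ρ' adm π hπ
  · intro x y
    by_cases hx : q x ∈ S
    · by_cases hy : q y ∈ T
      · simp only [g, g']
        rw [← ENNReal.ofReal_add (hv0 _) (by positivity)]
        apply ENNReal.ofReal_le_ofReal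
        have h1 := huv ⟨q x, hx⟩ ⟨q y, hy⟩
        have h2 := hcu x y
        simp only [u', v', hx, hy, dif_pos]
        simp only at h1
        linarith
      · have h1 := hR x hx
        have h2 := hT y hy
        have h3 : ‖y‖ ≤ dist x y + ‖x‖ := by
          rw [dist_comm, dist_eq_norm]; simpa using norm_add_le (y - x) x
        refine le_add_left (ENNReal.ofReal_le_ofReal ?_)
        have h4 : u' (q x) ≤ Λ := by simpa only [u', hx, dif_pos] using (hu ⟨q x, hx⟩).2
        refine h4.trans (Real.rpow_le_rpow (by positivity) (by linarith) (by linarith))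
    · simp only [hg _ hx]; exact zero_le
  · refine ne_top_of_le_ne_top (b := volume (⋃ k ∈ T, q ⁻¹' {k})) ?_ (measure_mono ?_)
    · refine ne_top_of_le_ne_top ?_ (measure_biUnion_finset_le T _)
      refine ENNReal.sum_ne_top.2 fun k _ => ?_
      rw [vC]
      exact ENNReal.pow_ne_top (by simp)
    · intro y hy
      have hy' : 0 < g' (q y) := hy
      have : q y ∈ T := by
        by_contra h
        simp [hg' _ h] at hy'
      simpa using this
  · change _ + ∫⁻ y, g' (q y) * G y ≤ (∫⁻ x, g (q x) * F x) + _
    rw [i1, i2, ← ENNReal.ofReal_toReal hWt, ← ENNReal.ofReal_add ENNReal.toReal_nonneg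
      (Finset.sum_nonneg fun k _ => mul_nonneg (hv0 k) ENNReal.toReal_nonneg),
      ← ENNReal.ofReal_add (Finset.sum_nonneg fun k _ => mul_nonneg ENNReal.toReal_nonneg (hu0 k))
      (by positivity)]
    apply ENNReal.ofReal_le_ofReal
    have : Λ * (1 - ∑ k ∈ S, a k) ≤ Λ * ε := mul_le_mul_of_nonneg_left (by linarith) hΛ
    linarith

lemma uB_vol {N : ℕ} (hN : 1 ≤ N) : volume (uB N) = 1 := vol_bv hN 1 (by simp)

lemma energy_le {N : ℕ} (hN : 1 ≤ N) (p : ℝ) (hp : 1 < p) (f : Euc N → ℝ) (hfm : Measurable f)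
    (hf01 : ∀ᵐ x, 0 ≤ f x ∧ f x ≤ 1) (hfi : ∫⁻ x, ENNReal.ofReal (f x) = 1) :
    WEnergyPow p volume f ≤ WEnergyPow p volume ((uB N).indicator 1) := by
  refine le_iInf₂ fun ρ' adm => le_iInf₂ fun π hπ => ?_
  have hp0 : 0 < p := by linarith
  by_cases htop : tCost p π = ⊤
  · rw [htop]; exact le_top
  have hmass : π univ = 1 := by
    have : (π.map Prod.fst) univ = 1 := by
      rw [hπ.1, densM, withDensity_apply _ MeasurableSet.univ, Measure.restrict_univ, ← uB_vol hN,
        ← lintegral_indicator_one uB_meas]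
      refine lintegral_congr fun x => ?_
      by_cases hx : x ∈ uB N <;> simp [hx]
    rwa [Measure.map_apply measurable_fst MeasurableSet.univ, preimage_univ] at this
  let t : ℕ → ℝ := fun n => 1 / ((n:ℝ) + 1)
  have ht0 : ∀ n, 0 < t n := fun n => by positivity
  have ht1 : ∀ n, t n ≤ 1 := fun n => by
    simp only [t]; rw [div_le_one (by positivity)]; linarith [(Nat.cast_nonneg n : (0:ℝ) ≤ n)]
  have htl : Tendsto t atTop (nhds 0) := tendsto_one_div_add_atTop_nhds_zero_nat
  have hle : ∀ n, WEnergyPow p volume f ≤ (∫⁻ z, ENNReal.ofReal ((dist z.1 z.2 + t n) ^ p) ∂π) +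
      ENNReal.ofReal ((N * 3) ^ p * t n) := fun n =>
    approx hN p hp f hfm hf01 hfi (t n) (t n) (ht0 n) (ht0 n) ρ' adm π hπ
  have hlim2 : Tendsto (fun n => ENNReal.ofReal ((N * 3) ^ p * t n)) atTop (nhds 0) := by
    have := ENNReal.tendsto_ofReal (htl.const_mul (((N:ℝ) * 3) ^ p))
    simpa using this
  have hlim1 : Tendsto (fun n => ∫⁻ z, ENNReal.ofReal ((dist z.1 z.2 + t n) ^ p) ∂π) atTop
      (nhds (tCost p π)) := by
    refine tendsto_lintegral_of_dominated_convergence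
      (fun z => ENNReal.ofReal (2 ^ p) * (ENNReal.ofReal (dist z.1 z.2 ^ p) + 1)) (fun n => ?_)
      (fun n => Eventually.of_forall fun z => ?_) ?_ (Eventually.of_forall fun z => ?_)
    · fun_prop
    · have hd : 0 ≤ dist z.1 z.2 := dist_nonneg
      beta_reduce
      rw [← ENNReal.ofReal_one, ← ENNReal.ofReal_add (by positivity) zero_le_one,
        ← ENNReal.ofReal_mul (by positivity)]
      apply ENNReal.ofReal_le_ofReal
      have h1 : dist z.1 z.2 + t n ≤ 2 * max (dist z.1 z.2) 1 := by
        have := ht1 n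
        linarith [le_max_left (dist z.1 z.2) 1, le_max_right (dist z.1 z.2) 1]
      have hpos := (ht0 n).le
      calc _ ≤ (2 * max (dist z.1 z.2) 1) ^ p := Real.rpow_le_rpow (by positivity) h1 hp0.le
        _ = 2 ^ p * (max (dist z.1 z.2) 1) ^ p := Real.mul_rpow (by norm_num) (by positivity)
        _ ≤ _ := by
          gcongr
          rcases max_cases (dist z.1 z.2) 1 with ⟨h, _⟩ | ⟨h, _⟩
          · rw [h]; linarith
          · rw [h, Real.one_rpow]
            have : 0 ≤ dist z.1 z.2 ^ p := by positivity
            linarith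
    · rw [lintegral_const_mul' _ _ ENNReal.ofReal_ne_top, lintegral_add_right _ measurable_const]
      refine ENNReal.mul_ne_top ENNReal.ofReal_ne_top (ENNReal.add_ne_top.2 ⟨htop, ?_⟩)
      simp [hmass]
    · apply ENNReal.tendsto_ofReal
      have : Tendsto (fun n => dist z.1 z.2 + t n) atTop (nhds (dist z.1 z.2)) := by
        simpa using htl.const_add (dist z.1 z.2)
      exact this.rpow_const (Or.inr hp0.le)
  have := ge_of_tendsto' (hlim1.add hlim2) hle
  simpa using this

lemma final_thm {N : ℕ} (hN : 1 ≤ N) (p : ℝ) (hp : 1 < p) :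
    ∃ ρ : Euc N → ℝ, memA volume 1 ρ ∧
      WEnergy p volume ρ =
        ⨆ (ρ' : Euc N → ℝ) (_ : memA volume 1 ρ'), WEnergy p volume ρ' := by
  have hm : memA volume 1 ((uB N).indicator 1) := by
    refine ⟨measurable_one.indicator uB_meas, Eventually.of_forall fun x => ?_, ?_⟩
    · by_cases hx : x ∈ uB N <;> simp [hx]
    · rw [integral_indicator_one uB_meas, Measure.real, uB_vol hN]; simp
  refine ⟨_, hm, le_antisymm (le_iSup₂_of_le _ hm le_rfl) (iSup₂_le fun f hf => ?_)⟩
  obtain ⟨hfm, hf01, hfi⟩ := hf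
  refine ENNReal.rpow_le_rpow (energy_le hN p hp f hfm hf01 ?_) (by positivity)
  have hint : Integrable f volume := by
    by_contra h
    rw [integral_undef h] at hfi
    exact zero_ne_one hfi
  rw [← ofReal_integral_eq_lintegral_ofReal hint (hf01.mono fun x hx => hx.1), hfi, ENNReal.ofReal_one]


/-- For `p > 1` there exists a maximizer of the Wasserstein energy `𝒲_p` in the
class `A` of densities with values in `[0,1]` and unit mass. -/
theorem exists_maximizer {N : ℕ} (hN : 1 ≤ N) (p : ℝ) (hp : 1 < p) :
    ∃ ρ : Euc N → ℝ, memA volume 1 ρ ∧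
      WEnergy p volume ρ =
        ⨆ (ρ' : Euc N → ℝ) (_ : memA volume 1 ρ'), WEnergy p volume ρ' := by
  exact final_thm hN p hp
end
end

section
/- Let p>1 and m>0. Let w: (0,+∞) → (0,+∞) be a non-decreasing weight, set γ = w·ℒ¹ on X = [0,+∞), and let I = [0,ℓ] be the unique interval with ∫_I w dx = m. Then for every measurable density ρ: [0,+∞) → [0,1] with ∫ ρ w dx = m, one has 𝒲_p(χ_I) ≥ 𝒲_p(ρ), where 𝒲_p is the weighted Wasserstein energy on (X, |·|, γ). Moreover, equality holds if and only if ρ = χ_I γ-almost everywhere. -/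
open MeasureTheory ENNReal Set Metric Filter

noncomputable section

structure GHD (γ : Measure ℝ) (G H : ℝ → ℝ) : Prop where
  cdf : ∀ x, γ (Iic x) = ENNReal.ofReal (G x)
  cont : Continuous G
  mono : Monotone G
  zero : ∀ x, x ≤ 0 → G x = 0
  smono : ∀ x y, 0 ≤ x → x < y → G x < G y
  Hnn : ∀ t, 0 ≤ t → 0 ≤ H t
  inv : ∀ t, 0 ≤ t → G (H t) = t
  HG : ∀ x, 0 ≤ x → H (G x) = x
  conc : ∀ s t d, 0 ≤ s → s ≤ t → 0 ≤ d → H (t + d) - H t ≤ H (s + d) - H s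

lemma GHD.le_iff {γ : Measure ℝ} {G H : ℝ → ℝ} (h : GHD γ G H) {t x : ℝ} (ht : 0 < t) :
    H t ≤ x ↔ t ≤ G x := by
  constructor
  · intro hx
    rw [← h.inv t ht.le]
    exact h.mono hx
  · intro hx
    by_contra! hlt
    by_cases h0 : 0 ≤ x
    · have := h.smono x (H t) h0 hlt
      rw [h.inv t ht.le] at this
      linarith
    · rw [h.zero x (by linarith)] at hx
      linarith

lemma GHD.Hlt {γ : Measure ℝ} {G H : ℝ → ℝ} (h : GHD γ G H) {s t : ℝ} (hs : 0 ≤ s) (hst : s < t) :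
    H s < H t := by
  by_contra! hle
  have := h.mono hle
  rw [h.inv s hs, h.inv t (by linarith)] at this
  linarith

lemma GHD.Hle {γ : Measure ℝ} {G H : ℝ → ℝ} (h : GHD γ G H) {s t : ℝ} (hs : 0 ≤ s) (hst : s ≤ t) :
    H s ≤ H t := by
  rcases hst.eq_or_lt with rfl | h'
  · rfl
  · exact (h.Hlt hs h').le

lemma GHD.nonneg {γ : Measure ℝ} {G H : ℝ → ℝ} (h : GHD γ G H) (x : ℝ) : 0 ≤ G x := by
  have := h.mono (min_le_left x 0)
  rwa [h.zero _ (min_le_right x 0)] at this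

lemma exists_GH (w : ℝ → ℝ) (hw_meas : Measurable w) (hw_pos : ∀ x, 0 < x → 0 < w x)
    (hw_mono : ∀ x y, 0 < x → x ≤ y → w x ≤ w y)
    (γ : Measure ℝ)
    (hγ : γ = (volume.restrict (Set.Ioi (0 : ℝ))).withDensity fun x => ENNReal.ofReal (w x)) :
    ∃ G H, GHD γ G H := by
  set v : ℝ → ℝ := fun x => if 0 < x then w x else 0 with hv
  have vmono : Monotone v := by
    intro x y hxy
    simp only [hv]
    split_ifs with h1 h2
    · exact hw_mono x y h1 hxy
    · linarith
    · exact (hw_pos y ‹_›).le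
    · rfl
  have vnn : ∀ x, 0 ≤ v x := by
    intro x
    simp only [hv]
    split_ifs with h1
    · exact (hw_pos x h1).le
    · rfl
  have vint : ∀ a b, IntervalIntegrable v volume a b := fun a b => vmono.intervalIntegrable
  set G : ℝ → ℝ := fun x => ∫ u in (0:ℝ)..x, v u with hG
  have Gsub : ∀ a b, G b - G a = ∫ u in a..b, v u := fun a b =>
    intervalIntegral.integral_interval_sub_left (vint _ _) (vint _ _)
  have Gcont : Continuous G := intervalIntegral.continuous_primitive vint 0
  have Gzero : ∀ x, x ≤ 0 → G x = 0 := by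
    intro x hx
    simp only [hG]
    rw [intervalIntegral.integral_congr (g := fun _ => (0:ℝ))]
    · simp
    · intro u hu
      rw [uIcc_of_ge hx] at hu
      simp only [hv]
      rw [if_neg (not_lt.2 hu.2)]
  have Gmono : Monotone G := by
    intro a b hab
    have : 0 ≤ G b - G a := by
      rw [Gsub]
      exact intervalIntegral.integral_nonneg hab (fun u _ => vnn u)
    linarith
  have Gs : ∀ x y, 0 ≤ x → x < y → G x < G y := by
    intro x y hx hxy
    have : 0 < G y - G x := by
      rw [Gsub]
      apply intervalIntegral.intervalIntegral_pos_of_pos_on (vint _ _) _ hxy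
      intro u hu
      have : 0 < u := lt_of_le_of_lt hx hu.1
      simp only [hv]
      rw [if_pos this]
      exact hw_pos u this
    linarith
  have Gconv : ∀ x y h, x ≤ y → 0 ≤ h → G (x + h) - G x ≤ G (y + h) - G y := by
    intro x y h hxy hh
    rw [Gsub, Gsub]
    have e : ∫ u in y..(y+h), v u = ∫ u in x..(x+h), v (u + (y - x)) := by
      rw [intervalIntegral.integral_comp_add_right]
      congr 1 <;> ring
    rw [e]
    apply intervalIntegral.integral_mono_on (by linarith) (vint _ _)
    · apply Monotone.intervalIntegrable
      intro a b hab
      exact vmono (by linarith)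
    · intro u _
      exact vmono (by linarith)
  have Gtop : ∀ t, 0 ≤ t → ∃ x, 0 ≤ x ∧ G x = t := by
    intro t ht
    have h1 : 0 < v 1 := by simp only [hv]; rw [if_pos one_pos]; exact hw_pos 1 one_pos
    have hb : t ≤ G (1 + t / v 1) := by
      have h2 : G (1 + t / v 1) - G 1 ≥ t := by
        rw [Gsub]
        have : ∫ u in (1:ℝ)..(1 + t / v 1), v 1 ≤ ∫ u in (1:ℝ)..(1 + t / v 1), v u := by
          apply intervalIntegral.integral_mono_on
          · have := div_nonneg ht h1.le
            linarith
          · simp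
          · exact vint _ _
          · intro u hu
            exact vmono hu.1
        rw [intervalIntegral.integral_const] at this
        simp only [add_sub_cancel_left, smul_eq_mul] at this
        rw [div_mul_cancel₀ _ h1.ne'] at this
        exact this
      have h3 : 0 ≤ G 1 := by
        have := Gmono (zero_le_one (α := ℝ)); rwa [Gzero 0 le_rfl] at this
      linarith
    have h0 : (0:ℝ) ≤ 1 + t / v 1 := by
      have := div_nonneg ht h1.le
      linarith
    obtain ⟨x, hx, hxt⟩ := intermediate_value_Icc h0 Gcont.continuousOn
      (show t ∈ Icc (G 0) (G (1 + t / v 1)) from ⟨by rw [Gzero 0 le_rfl]; exact ht, hb⟩)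
    exact ⟨x, hx.1, hxt⟩
  choose! H hH1 hH2 using Gtop
  have Ginj : ∀ x y, 0 ≤ x → 0 ≤ y → G x = G y → x = y := by
    intro x y hx hy hxy
    rcases lt_trichotomy x y with h | h | h
    · have := Gs x y hx h; linarith
    · exact h
    · have := Gs y x hy h; linarith
  refine ⟨G, H, ?_, Gcont, Gmono, Gzero, Gs, hH1, hH2, ?_, ?_⟩
  · intro x
    have e1 : γ = volume.withDensity fun x => ENNReal.ofReal (v x) := by
      rw [hγ, ← withDensity_indicator measurableSet_Ioi]
      congr 1
      ext u
      simp only [hv, indicator, mem_Ioi]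
      split_ifs <;> simp
    by_cases hx : 0 ≤ x
    · rw [e1, withDensity_apply _ measurableSet_Iic]
      have : ∫⁻ u in Iic x, ENNReal.ofReal (v u) = ∫⁻ u in Ioc 0 x, ENNReal.ofReal (v u) := by
        rw [← lintegral_indicator measurableSet_Iic, ← lintegral_indicator measurableSet_Ioc]
        congr 1
        ext u
        simp only [indicator, mem_Iic, mem_Ioc, hv]
        by_cases h1 : 0 < u <;> simp [h1]
      rw [this, ← ofReal_integral_eq_lintegral_ofReal]
      · simp only [hG]
        rw [intervalIntegral.integral_of_le hx]
      · exact (vint 0 x).1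
      · exact Filter.Eventually.of_forall vnn
    · have hx' : x ≤ 0 := by linarith
      rw [Gzero x hx', e1, withDensity_apply _ measurableSet_Iic]
      rw [setLIntegral_congr_fun (g := fun _ => 0) measurableSet_Iic]
      · simp
      · intro u hu
        simp only [hv]
        rw [if_neg (not_lt.2 (le_trans hu hx'))]
        simp
  · intro x hx
    have := Gmono hx
    rw [Gzero 0 le_rfl] at this
    exact Ginj _ _ (hH1 _ this) hx (hH2 _ this)
  · intro s t d hs hst hd
    have hHm : ∀ a b, 0 ≤ a → a ≤ b → H a ≤ H b := by
      intro a b ha hab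
      by_contra! hlt
      have := Gs _ _ (hH1 b (by linarith)) hlt
      rw [hH2 a ha, hH2 b (by linarith)] at this
      linarith
    have h1 := Gconv (H s) (H t) (H (s + d) - H s) (hHm s t hs hst)
      (by have := hHm s (s + d) hs (by linarith); linarith)
    have e : H s + (H (s + d) - H s) = H (s + d) := by ring
    rw [e, hH2 _ (by linarith), hH2 _ hs, hH2 _ (by linarith : 0 ≤ t)] at h1
    by_contra! hlt
    have h2 := Gs (H t + (H (s + d) - H s)) (H (t + d)) (by
      have := hH1 t (by linarith)
      have := hHm s (s + d) hs (by linarith)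
      linarith) (by linarith)
    rw [hH2 (t + d) (by linarith)] at h2
    linarith

lemma qmap (m : ℝ) (F Q : ℝ → ℝ) (ν : Measure ℝ) [IsFiniteMeasure ν]
    (hν : ∀ x, ν (Iic x) = ENNReal.ofReal (F x)) (hFm : ∀ x, F x ≤ m)
    (hQ : ∀ t ∈ Ioo 0 m, ∀ x, Q t ≤ x ↔ t ≤ F x) :
    AEMeasurable Q (volume.restrict (Ioo 0 m)) ∧ (volume.restrict (Ioo 0 m)).map Q = ν := by
  have hmon : MonotoneOn Q (Ioo 0 m) := by
    intro s hs t ht hst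
    rw [hQ s hs]
    exact hst.trans ((hQ t ht _).1 le_rfl)
  have hae : AEMeasurable Q (volume.restrict (Ioo 0 m)) :=
    aemeasurable_restrict_of_monotoneOn measurableSet_Ioo hmon
  refine ⟨hae, ?_⟩
  haveI : IsFiniteMeasure ((volume.restrict (Ioo 0 m)).map Q) := by
    haveI : IsFiniteMeasure (volume.restrict (Ioo (0:ℝ) m)) := ⟨by simp⟩
    infer_instance
  apply Measure.ext_of_Iic
  intro x
  rw [Measure.map_apply_of_aemeasurable hae measurableSet_Iic, hν]
  rw [Measure.restrict_apply' measurableSet_Ioo]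
  have : Q ⁻¹' Iic x ∩ Ioo 0 m = Ioc 0 (F x) ∩ Ioo 0 m := by
    ext t
    simp only [mem_inter_iff, mem_preimage, mem_Iic, mem_Ioc]
    constructor
    · rintro ⟨h1, h2⟩
      exact ⟨⟨h2.1, (hQ t h2 x).1 h1⟩, h2⟩
    · rintro ⟨h1, h2⟩
      exact ⟨(hQ t h2 x).2 h1.2, h2⟩
  rw [this]
  apply le_antisymm
  · refine (measure_mono inter_subset_left).trans ?_
    simp
  · have : Ioo 0 (F x) ⊆ Ioc 0 (F x) ∩ Ioo 0 m := by
      intro t ht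
      exact ⟨⟨ht.1, ht.2.le⟩, ht.1, ht.2.trans_le (hFm x)⟩
    refine le_trans ?_ (measure_mono this)
    simp

lemma exists_q (m : ℝ) (F : ℝ → ℝ) (hc : Continuous F) (hmon : Monotone F)
    (h0 : ∀ x, x ≤ 0 → F x ≤ 0) (htop : ∀ t, t < m → ∃ x, t ≤ F x) :
    ∃ Q : ℝ → ℝ, ∀ t ∈ Ioo 0 m, F (Q t) = t ∧ ∀ x, Q t ≤ x ↔ t ≤ F x := by
  refine ⟨fun t => sInf {x | t ≤ F x}, ?_⟩
  intro t ht
  have hcl : IsClosed {x | t ≤ F x} := isClosed_le continuous_const hc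
  have hbd : ∀ x ∈ {x | t ≤ F x}, 0 ≤ x := by
    intro x hx
    by_contra! hlt
    have := h0 x hlt.le
    have h2 : t ≤ F x := hx
    linarith [ht.1]
  have hbb : BddBelow {x | t ≤ F x} := ⟨0, hbd⟩
  obtain ⟨y, hy⟩ := htop t ht.2
  have hmem : sInf {x | t ≤ F x} ∈ {x | t ≤ F x} := hcl.csInf_mem ⟨y, hy⟩ hbb
  have hge : t ≤ F (sInf {x | t ≤ F x}) := hmem
  constructor
  · apply le_antisymm _ hge
    obtain ⟨z, -, hz⟩ := intermediate_value_Icc (hbd y hy) hc.continuousOn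
      (show t ∈ Icc (F 0) (F y) from ⟨(h0 0 le_rfl).trans ht.1.le, hy⟩)
    have : sInf {x | t ≤ F x} ≤ z := csInf_le hbb hz.ge
    exact (hmon this).trans hz.le
  · intro x
    exact ⟨fun h => hge.trans (hmon h), fun h => csInf_le hbb h⟩

lemma pow_int {p : ℝ} (hp : 1 < p) (x s y : ℝ) :
    ∫ u in x..s, p * (y - u) ^ (p - 1) = (y - x) ^ p - (y - s) ^ p := by
  rw [intervalIntegral.integral_const_mul,
    intervalIntegral.integral_comp_sub_left (fun z => z ^ (p - 1)) y,
    integral_rpow (Or.inl (by linarith))]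
  rw [sub_add_cancel]
  field_simp

section lower
variable {γ : Measure ℝ} {G H : ℝ → ℝ}

def TT (G H : ℝ → ℝ) (m : ℝ) (u : ℝ) : ℝ := H (G u + m) - u

def PH (G H : ℝ → ℝ) (p m : ℝ) (x : ℝ) : ℝ := ∫ u in (0:ℝ)..x, p * (TT G H m u) ^ (p - 1)

lemma TT_nn (h : GHD γ G H) {m : ℝ} (hm : 0 < m) (u : ℝ) : 0 ≤ TT G H m u := by
  unfold TT
  by_cases hu : 0 ≤ u
  · have := h.Hle (h.nonneg u) (by linarith : G u ≤ G u + m)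
    rw [h.HG u hu] at this
    linarith
  · have := h.Hnn (G u + m) (by linarith [h.nonneg u])
    linarith

lemma TT_anti (h : GHD γ G H) {m : ℝ} (hm : 0 < m) : Antitone (TT G H m) := by
  intro u v huv
  unfold TT
  rcases le_total 0 u with hu | hu
  · have := h.conc (G u) (G v) m (h.nonneg u) (h.mono huv) hm.le
    rwa [h.HG u hu, h.HG v (hu.trans huv)] at this
  · rcases le_total 0 v with hv | hv
    · have := h.conc 0 (G v) m le_rfl (h.nonneg v) hm.le
      have e : H 0 = 0 := by have := h.HG 0 le_rfl; rwa [h.zero 0 le_rfl] at this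
      rw [e, h.HG v hv] at this
      rw [h.zero u hu]
      linarith
    · rw [h.zero u hu, h.zero v hv]
      linarith

lemma PT_anti (h : GHD γ G H) {p m : ℝ} (hp : 1 < p) (hm : 0 < m) :
    Antitone fun u => p * (TT G H m u) ^ (p - 1) := by
  intro u v huv
  have := Real.rpow_le_rpow (TT_nn h hm v) (TT_anti h hm huv) (by linarith : 0 ≤ p - 1)
  exact mul_le_mul_of_nonneg_left this (by linarith)

lemma PT_nn (h : GHD γ G H) {p m : ℝ} (hp : 1 < p) (hm : 0 < m) (u : ℝ) :
    0 ≤ p * (TT G H m u) ^ (p - 1) :=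
  mul_nonneg (by linarith) (Real.rpow_nonneg (TT_nn h hm u) _)

lemma PH_sub (h : GHD γ G H) {p m : ℝ} (hp : 1 < p) (hm : 0 < m) (a b : ℝ) :
    PH G H p m b - PH G H p m a = ∫ u in a..b, p * (TT G H m u) ^ (p - 1) :=
  intervalIntegral.integral_interval_sub_left (PT_anti h hp hm).intervalIntegrable
    (PT_anti h hp hm).intervalIntegrable

lemma PH_cont (h : GHD γ G H) {p m : ℝ} (hp : 1 < p) (hm : 0 < m) : Continuous (PH G H p m) :=
  intervalIntegral.continuous_primitive (fun _ _ => (PT_anti h hp hm).intervalIntegrable) 0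

lemma PH_mono (h : GHD γ G H) {p m : ℝ} (hp : 1 < p) (hm : 0 < m) : Monotone (PH G H p m) := by
  intro a b hab
  have : 0 ≤ PH G H p m b - PH G H p m a := by
    rw [PH_sub h hp hm]
    exact intervalIntegral.integral_nonneg hab (fun u _ => PT_nn h hp hm u)
  linarith

lemma PH_nn (h : GHD γ G H) {p m : ℝ} (hp : 1 < p) (hm : 0 < m) {x : ℝ} (hx : 0 ≤ x) :
    0 ≤ PH G H p m x := by
  have := PH_mono h hp hm hx
  simpa [PH] using this

lemma key_ineq (h : GHD γ G H) {p m : ℝ} (hp : 1 < p) (hm : 0 < m) {x t : ℝ} (hx : 0 ≤ x)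
    (ht : 0 ≤ t) (hxt : x ≤ H (t + m)) :
    (H (t + m) - H t) ^ p + PH G H p m (H t) ≤ (H (t + m) - x) ^ p + PH G H p m x := by
  set y := H (t + m) with hy
  have hs : H t ≤ y := h.Hle ht (by linarith)
  have hint : ∀ a b, IntervalIntegrable (fun u => p * (y - u) ^ (p - 1)) volume a b := by
    intro a b
    apply Continuous.intervalIntegrable
    apply continuous_const.mul
    exact (continuous_const.sub continuous_id).rpow_const (fun _ => Or.inr (by linarith))
  rcases le_total x (H t) with hc | hc
  · have e1 := pow_int hp x (H t) y
    have e2 := PH_sub h hp hm x (H t)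
    have : ∫ u in x..(H t), p * (TT G H m u) ^ (p - 1) ≤ ∫ u in x..(H t), p * (y - u) ^ (p - 1) := by
      apply intervalIntegral.integral_mono_on hc (PT_anti h hp hm).intervalIntegrable (hint _ _)
      intro u hu
      apply mul_le_mul_of_nonneg_left _ (by linarith)
      apply Real.rpow_le_rpow (TT_nn h hm u) _ (by linarith)
      unfold TT
      have h1 := h.mono hu.2
      rw [h.inv t ht] at h1
      have := h.Hle (by linarith [h.nonneg u]) (by linarith : G u + m ≤ t + m)
      linarith
    linarith
  · have e1 := pow_int hp (H t) x y
    have e2 := PH_sub h hp hm (H t) x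
    have : ∫ u in (H t)..x, p * (y - u) ^ (p - 1) ≤ ∫ u in (H t)..x, p * (TT G H m u) ^ (p - 1) := by
      apply intervalIntegral.integral_mono_on hc (hint _ _) (PT_anti h hp hm).intervalIntegrable
      intro u hu
      apply mul_le_mul_of_nonneg_left _ (by linarith)
      apply Real.rpow_le_rpow (by linarith [hu.2]) _ (by linarith)
      unfold TT
      have h1 := h.mono hu.1
      rw [h.inv t ht] at h1
      have := h.Hle (by linarith) (by linarith : t + m ≤ G u + m)
      linarith
    linarith

def KA (G H : ℝ → ℝ) (p m t : ℝ) : ℝ := (H (t + m) - H t) ^ p + PH G H p m (H t)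

lemma KA_mono (h : GHD γ G H) {p m : ℝ} (hp : 1 < p) (hm : 0 < m) {s t : ℝ} (hs : 0 ≤ s)
    (hst : s ≤ t) : KA G H p m s ≤ KA G H p m t := by
  unfold KA
  have ht : 0 ≤ t := hs.trans hst
  have h0 : H t ≤ H (t + m) := h.Hle ht (by linarith)
  rcases le_total (H t) (H (s + m)) with hc | hc
  · refine (key_ineq h hp hm (h.Hnn t ht) hs hc).trans ?_
    have := h.Hle (by linarith) (by linarith : s + m ≤ t + m)
    have := Real.rpow_le_rpow (by linarith : 0 ≤ H (s + m) - H t)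
      (by linarith : H (s + m) - H t ≤ H (t + m) - H t) (by linarith : 0 ≤ p)
    linarith
  · refine (key_ineq h hp hm (h.Hnn (s + m) (by linarith)) hs le_rfl).trans ?_
    have h1 := PH_mono h hp hm hc
    have h2 := Real.rpow_nonneg (by linarith : 0 ≤ H (t + m) - H t) p
    rw [sub_self, Real.zero_rpow (by linarith)]
    linarith

def PS (G H : ℝ → ℝ) (p m y : ℝ) : ℝ := KA G H p m m - KA G H p m (max (G y - m) 0)

lemma PS_meas (h : GHD γ G H) {p m : ℝ} (hp : 1 < p) (hm : 0 < m) : Measurable (PS G H p m) := by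
  unfold PS
  have : Monotone fun y => KA G H p m (max (G y - m) 0) := by
    intro a b hab
    apply KA_mono h hp hm (le_max_right _ _)
    have := h.mono hab
    exact max_le_max (by linarith) le_rfl
  exact measurable_const.sub this.measurable

lemma gfin (h : GHD γ G H) (x : ℝ) : γ (Iic x) < ⊤ := by
  rw [h.cdf]; exact ENNReal.ofReal_lt_top

lemma g_neg (h : GHD γ G H) : ∀ᵐ x ∂γ, 0 ≤ x := by
  rw [ae_iff]
  apply measure_mono_null (t := Iic 0)
  · intro x hx
    simp only [not_le, mem_ofPred_eq] at hx
    exact hx.le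
  · rw [h.cdf, h.zero 0 le_rfl]; simp

lemma g_Ioc (h : GHD γ G H) {a b : ℝ} (hab : a ≤ b) : γ (Ioc a b) = ENNReal.ofReal (G b - G a) := by
  have e : Ioc a b = Iic b \ Iic a := by
    ext x
    simp only [mem_Ioc, mem_diff, mem_Iic, not_le]
    exact and_comm
  rw [e, measure_diff (Iic_subset_Iic.2 hab) measurableSet_Iic.nullMeasurableSet
    (gfin h a).ne, h.cdf, h.cdf, ENNReal.ofReal_sub _ (h.nonneg a)]

lemma qmap1 (h : GHD γ G H) {m : ℝ} (hm : 0 < m) :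
    AEMeasurable H (volume.restrict (Ioo 0 m)) ∧
      (volume.restrict (Ioo 0 m)).map H = γ.restrict (Iic (H m)) := by
  haveI : IsFiniteMeasure (γ.restrict (Iic (H m))) := ⟨by simpa using gfin h (H m)⟩
  apply qmap m (fun x => min (G x) m)
  · intro x
    rw [Measure.restrict_apply measurableSet_Iic, Iic_inter_Iic, h.cdf]
    congr 1
    rcases le_total x (H m) with hx | hx
    · have := h.mono hx
      rw [h.inv m hm.le] at this
      simp [hx, this]
    · have := h.mono hx
      rw [h.inv m hm.le] at this
      simp [hx, this, h.inv m hm.le]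
  · intro x; exact min_le_right _ _
  · intro t ht x
    rw [h.le_iff ht.1, le_min_iff]
    exact ⟨fun h => ⟨h, ht.2.le⟩, fun h => h.1⟩

lemma qmap2 (h : GHD γ G H) {m : ℝ} (hm : 0 < m) :
    AEMeasurable (fun t => H (t + m)) (volume.restrict (Ioo 0 m)) ∧
      (volume.restrict (Ioo 0 m)).map (fun t => H (t + m)) = γ.restrict (Ioc (H m) (H (m + m))) := by
  have h12 : H m ≤ H (m + m) := h.Hle hm.le (by linarith)
  haveI : IsFiniteMeasure (γ.restrict (Ioc (H m) (H (m + m)))) := ⟨by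
    simpa using lt_of_le_of_lt (measure_mono Ioc_subset_Iic_self) (gfin h (H (m + m)))⟩
  apply qmap m (fun x => min (G x - m) m)
  · intro x
    rw [Measure.restrict_apply measurableSet_Iic, inter_comm, ← Iic_inter_Ioi, inter_right_comm,
      Iic_inter_Iic, Iic_inter_Ioi]
    rcases le_total x (H m) with hx | hx
    · have := h.mono hx
      rw [h.inv m hm.le] at this
      rw [Ioc_eq_empty (by simp; intro _; exact hx), measure_empty, eq_comm, ENNReal.ofReal_eq_zero]
      exact (min_le_left _ _).trans (by linarith)
    · rw [g_Ioc h (le_min h12 hx), h.inv m hm.le]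
      congr 1
      rcases le_total (H (m + m)) x with hx2 | hx2
      · have := h.mono hx2
        rw [h.inv _ (by linarith)] at this
        rw [min_eq_left hx2, min_eq_right (by linarith), h.inv _ (by linarith)]
        ring
      · have := h.mono hx2
        rw [h.inv _ (by linarith)] at this
        rw [min_eq_right hx2, min_eq_left (by linarith)]
  · intro x; exact min_le_right _ _
  · intro t ht x
    rw [h.le_iff (by linarith [ht.1]), le_min_iff]
    exact ⟨fun h => ⟨by linarith, ht.2.le⟩, fun h => by linarith [h.1]⟩

/-- The optimal value. -/
def CC (H : ℝ → ℝ) (p m : ℝ) : ℝ≥0∞ :=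
  ∫⁻ t in Ioo 0 m, ENNReal.ofReal ((H (t + m) - H t) ^ p)

lemma lower_bound (h : GHD γ G H) {p m : ℝ} (hp : 1 < p) (hm : 0 < m) :
    CC H p m ≤ WEnergyPow p γ ((Set.Icc 0 (H m)).indicator fun _ => (1 : ℝ)) := by
  unfold WEnergyPow
  refine le_iInf₂ fun ρ' hρ' => ?_
  unfold WpPow
  refine le_iInf₂ fun π hπ => ?_
  obtain ⟨hρ1, hρ2, hρ3, hρ4⟩ := hρ'
  obtain ⟨hπ1, hπ2⟩ := hπ
  have hμ : densM γ ((Set.Icc 0 (H m)).indicator fun _ => (1 : ℝ)) = γ.restrict (Iic (H m)) := by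
    unfold densM
    have : (fun x => ENNReal.ofReal ((Set.Icc 0 (H m)).indicator (fun _ => (1 : ℝ)) x))
        =ᵐ[γ] (Iic (H m)).indicator 1 := by
      filter_upwards [g_neg h] with x hx
      simp only [indicator, mem_Icc, mem_Iic, hx, true_and]
      split_ifs <;> simp
    rw [withDensity_congr_ae this, withDensity_indicator_one measurableSet_Iic]
  have hν : densM γ ρ' ≤ γ.restrict (Ioi (H m)) := by
    rw [← withDensity_indicator_one measurableSet_Ioi]
    unfold densM
    apply withDensity_mono
    filter_upwards [g_neg h, hρ3] with x hx hx3
    simp only [indicator, mem_Icc, hx, true_and] at hx3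
    simp only [indicator, mem_Ioi, Pi.one_apply]
    by_cases h1 : x ≤ H m
    · rw [if_pos h1] at hx3
      rw [if_neg (not_lt.2 h1)]
      have : ρ' x ≤ 0 := by linarith
      simpa using this
    · rw [if_neg h1] at hx3
      rw [if_pos (not_le.1 h1)]
      have : ρ' x ≤ 1 := by linarith
      simpa using this
  rw [hμ] at hπ1
  set K := KA G H p m m with hK
  have ae1 : ∀ᵐ z ∂π, 0 ≤ z.1 ∧ z.1 ≤ H m := by
    have : ∀ᵐ x ∂(π.map Prod.fst), 0 ≤ x ∧ x ≤ H m := by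
      rw [hπ1]
      filter_upwards [ae_restrict_of_ae (g_neg h), ae_restrict_mem measurableSet_Iic] with x h1 h2
      exact ⟨h1, h2⟩
    exact ae_of_ae_map measurable_fst.aemeasurable this
  have ae2 : ∀ᵐ z ∂π, H m < z.2 := by
    have : ∀ᵐ x ∂(π.map Prod.snd), H m < x := by
      rw [hπ2]
      exact (Measure.absolutelyContinuous_of_le hν).ae_le (ae_restrict_mem measurableSet_Ioi)
    exact ae_of_ae_map measurable_snd.aemeasurable this
  have pt : ∀ᵐ z ∂π, ENNReal.ofReal K ≤ ENNReal.ofReal (dist z.1 z.2 ^ p)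
      + ENNReal.ofReal (PH G H p m z.1) + ENNReal.ofReal (PS G H p m z.2) := by
    filter_upwards [ae1, ae2] with z h1 h2
    have hG : m ≤ G z.2 := by
      have := h.mono h2.le
      rwa [h.inv m hm.le] at this
    have e : H (G z.2 - m + m) = z.2 := by
      rw [sub_add_cancel, h.HG]
      linarith [h1.1, h1.2]
    have h3 := key_ineq h hp hm h1.1 (by linarith : 0 ≤ G z.2 - m) (by rw [e]; linarith)
    have h4 : dist z.1 z.2 = z.2 - z.1 := by
      rw [dist_comm, Real.dist_eq, abs_of_nonneg]
      linarith
    have h5 := Real.rpow_nonneg (dist_nonneg (x := z.1) (y := z.2)) p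
    have h6 := PH_nn h hp hm h1.1
    rw [← ENNReal.ofReal_add h5 h6]
    refine le_trans ?_ ENNReal.ofReal_add_le
    apply ENNReal.ofReal_le_ofReal
    rw [h4]
    unfold PS
    rw [max_eq_left (by linarith)]
    have : KA G H p m (G z.2 - m) ≤ (z.2 - z.1) ^ p + PH G H p m z.1 := by
      unfold KA
      rw [e] at h3 ⊢
      exact h3
    linarith
  have mPH : Measurable fun x => ENNReal.ofReal (PH G H p m x) :=
    (PH_cont h hp hm).measurable.ennreal_ofReal
  have mPS : Measurable fun x => ENNReal.ofReal (PS G H p m x) :=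
    (PS_meas h hp hm).ennreal_ofReal
  have I1 : ENNReal.ofReal K * ENNReal.ofReal m ≤ tCost p π
      + ∫⁻ x, ENNReal.ofReal (PH G H p m x) ∂(γ.restrict (Iic (H m)))
      + ∫⁻ y, ENNReal.ofReal (PS G H p m y) ∂(densM γ ρ') := by
    have := lintegral_mono_ae pt
    have m1 : Measurable fun z : ℝ × ℝ => ENNReal.ofReal (PS G H p m z.2) := mPS.comp measurable_snd
    have m2 : Measurable fun z : ℝ × ℝ => ENNReal.ofReal (PH G H p m z.1) := mPH.comp measurable_fst
    rw [lintegral_const, lintegral_add_right _ m1, lintegral_add_right _ m2] at this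
    rw [← hπ1, ← hπ2, lintegral_map mPH measurable_fst, lintegral_map mPS measurable_snd]
    have e : π univ = ENNReal.ofReal m := by
      have e1 : (π.map Prod.fst) univ = π univ := by
        rw [Measure.map_apply measurable_fst MeasurableSet.univ, preimage_univ]
      rw [← e1, hπ1, Measure.restrict_apply_univ, h.cdf, h.inv m hm.le]
    rw [e] at this
    exact this
  have q1 := qmap1 h hm
  have q2 := qmap2 h hm
  have I2 : ∫⁻ y, ENNReal.ofReal (PS G H p m y) ∂(densM γ ρ') ≤
      ∫⁻ y, ENNReal.ofReal (PS G H p m y) ∂(γ.restrict (Ioc (H m) (H (m + m)))) := by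
    refine (lintegral_mono' hν le_rfl).trans ?_
    rw [← Ioc_union_Ioi_eq_Ioi (h.Hle hm.le (by linarith : m ≤ m + m))]
    refine (lintegral_union_le _ _ _).trans ?_
    have : ∫⁻ y in Ioi (H (m + m)), ENNReal.ofReal (PS G H p m y) ∂γ = 0 := by
      rw [setLIntegral_congr_fun (g := fun _ => 0) measurableSet_Ioi]
      · simp
      · intro y hy
        have h1 := h.mono (le_of_lt hy)
        rw [h.inv _ (by linarith)] at h1
        simp only [ENNReal.ofReal_eq_zero]
        unfold PS
        have := KA_mono h hp hm hm.le (by linarith [le_max_left (G y - m) 0] : m ≤ max (G y - m) 0)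
        linarith
    rw [this, add_zero]
  rw [← q1.2, lintegral_map' mPH.aemeasurable q1.1] at I1
  rw [← q2.2, lintegral_map' mPS.aemeasurable q2.1] at I2
  have I3 : (CC H p m + ∫⁻ t in Ioo 0 m, ENNReal.ofReal (PH G H p m (H t)))
      + ∫⁻ t in Ioo 0 m, ENNReal.ofReal (PS G H p m (H (t + m)))
      = ENNReal.ofReal K * ENNReal.ofReal m := by
    unfold CC
    have m1 : AEMeasurable (fun t => ENNReal.ofReal (PH G H p m (H t)))
      (volume.restrict (Ioo 0 m)) := mPH.comp_aemeasurable q1.1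
    have m2 : AEMeasurable (fun t => ENNReal.ofReal (PS G H p m (H (t + m))))
      (volume.restrict (Ioo 0 m)) := mPS.comp_aemeasurable q2.1
    rw [← lintegral_add_right' _ m1, ← lintegral_add_right' _ m2]
    rw [setLIntegral_congr_fun (g := fun _ => ENNReal.ofReal K) measurableSet_Ioo]
    · simp
    · intro t ht
      have ht0 : 0 ≤ t := ht.1.le
      have h1 : H t ≤ H (t + m) := h.Hle ht0 (by linarith)
      have h2 := Real.rpow_nonneg (by linarith : 0 ≤ H (t + m) - H t) p
      have h3 := PH_nn h hp hm (h.Hnn t ht0)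
      have h4 : PS G H p m (H (t + m)) = K - KA G H p m t := by
        unfold PS
        rw [h.inv _ (by linarith), add_sub_cancel_right, max_eq_left ht0]
      have h5 : 0 ≤ K - KA G H p m t := by
        have := KA_mono h hp hm ht0 ht.2.le
        linarith
      simp only [Function.comp]
      rw [h4, ← ENNReal.ofReal_add h2 h3, ← ENNReal.ofReal_add (add_nonneg h2 h3) h5]
      congr 1
      unfold KA
      ring
  have fin : ENNReal.ofReal K * ENNReal.ofReal m ≠ ⊤ :=
    ENNReal.mul_ne_top ENNReal.ofReal_ne_top ENNReal.ofReal_ne_top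
  have f1 : ∫⁻ t in Ioo 0 m, ENNReal.ofReal (PH G H p m (H t)) ≠ ⊤ := by
    intro ht
    rw [ht] at I3
    simp only [add_top, top_add] at I3
    exact fin I3.symm
  have f2 : ∫⁻ t in Ioo 0 m, ENNReal.ofReal (PS G H p m (H (t + m))) ≠ ⊤ := by
    intro ht
    rw [ht] at I3
    simp only [add_top, top_add] at I3
    exact fin I3.symm
  have I4 := I1.trans (add_le_add_right I2 _)
  rw [← I3] at I4
  exact ENNReal.le_of_add_le_add_right f1 (ENNReal.le_of_add_le_add_right f2 I4)
end lower

lemma cont_of_G {G F : ℝ → ℝ} (hG : Continuous G) (hF : Monotone F)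
    (h : ∀ x y, x ≤ y → F y - F x ≤ G y - G x) : Continuous F := by
  rw [continuous_iff_continuousAt]
  intro x
  have h1 : Tendsto (fun y => dist (G y) (G x)) (nhds x) (nhds 0) := by
    rw [← tendsto_iff_dist_tendsto_zero]
    exact hG.continuousAt
  unfold ContinuousAt
  rw [tendsto_iff_dist_tendsto_zero]
  refine squeeze_zero (fun _ => dist_nonneg) (fun y => ?_) h1
  rw [Real.dist_eq, Real.dist_eq]
  rcases le_total x y with hxy | hxy
  · have a := hF hxy
    have b := h x y hxy
    rw [abs_of_nonneg (by linarith)]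
    exact b.trans (le_abs_self _)
  · have a := hF hxy
    have b := h y x hxy
    rw [abs_of_nonpos (by linarith), neg_sub]
    exact b.trans (by rw [abs_sub_comm]; exact le_abs_self _)

lemma sub_Ioc (μ : Measure ℝ) (F : ℝ → ℝ) (h : ∀ x, μ (Iic x) = ENNReal.ofReal (F x))
    (hF : ∀ x, 0 ≤ F x) {a b : ℝ} (hab : a ≤ b) : μ (Ioc a b) = ENNReal.ofReal (F b - F a) := by
  have e : Ioc a b = Iic b \ Iic a := by
    ext x
    simp only [mem_Ioc, mem_diff, mem_Iic, not_le]
    exact and_comm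
  rw [e, measure_diff (Iic_subset_Iic.2 hab) measurableSet_Iic.nullMeasurableSet
    (by rw [h]; exact ENNReal.ofReal_ne_top), h, h, ENNReal.ofReal_sub _ (hF a)]

lemma competitor {γ : Measure ℝ} {G H : ℝ → ℝ} (h : GHD γ G H) {p m : ℝ} (hm : 0 < m)
    (ρ : ℝ → ℝ) (hρ_meas : Measurable ρ) (hρ01 : ∀ᵐ x ∂γ, 0 ≤ ρ x ∧ ρ x ≤ 1)
    (hρ_mass : ∫⁻ x, ENNReal.ofReal (ρ x) ∂γ = ENNReal.ofReal m)
    (R : ℝ → ℝ) (hR : ∀ x, densM γ ρ (Iic x) = ENNReal.ofReal (R x)) (hR0 : ∀ x, 0 ≤ R x)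
    (hRm : ∀ x, R x ≤ m) (hRmono : Monotone R)
    (D : ℝ → ℝ) (hD : Monotone D)
    (hDN : ∀ x y, x ≤ y → D y - D x ≤ (G y - R y) - (G x - R x))
    (D0 : ∀ x, x ≤ 0 → D x = 0) (Dm : ∀ x, D x ≤ m) (Dtop : ∀ t, t < m → ∃ x, t ≤ D x)
    (Q1 Q2 : ℝ → ℝ) (hQ1 : ∀ t ∈ Ioo 0 m, ∀ x, Q1 t ≤ x ↔ t ≤ R x)
    (hQ2 : ∀ t ∈ Ioo 0 m, ∀ x, Q2 t ≤ x ↔ t ≤ D x) :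
    WEnergyPow p γ ρ ≤ ∫⁻ t in Ioo 0 m, ENNReal.ofReal (|Q1 t - Q2 t| ^ p) := by
  have Dc : Continuous D := by
    apply cont_of_G h.cont hD
    intro x y hxy
    have := hDN x y hxy
    have := hRmono hxy
    linarith
  have Mm : Monotone fun x => (G x - R x) - D x := by
    intro x y hxy
    have := hDN x y hxy
    simp only
    linarith
  have Mc : Continuous fun x => (G x - R x) - D x := by
    apply cont_of_G h.cont Mm
    intro x y hxy
    have := hD hxy
    have := hRmono hxy
    linarith
  let SD : StieltjesFunction ℝ := ⟨D, hD, fun x => Dc.continuousWithinAt⟩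
  let SM : StieltjesFunction ℝ := ⟨fun x => (G x - R x) - D x, Mm, fun x => Mc.continuousWithinAt⟩
  have hlf : IsLocallyFiniteMeasure γ := by
    refine ⟨fun x => ⟨Iic (x + 1), Iic_mem_nhds (by linarith), ?_⟩⟩
    exact gfin h _
  set η : Measure ℝ := γ.withDensity fun x => ENNReal.ofReal (1 - ρ x) with hη
  have hsum : η + densM γ ρ = γ := by
    unfold densM
    rw [hη, ← withDensity_add_left (by fun_prop)]
    conv_rhs => rw [← withDensity_one (μ := γ)]
    apply withDensity_congr_ae
    filter_upwards [hρ01] with x hx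
    simp only [Pi.add_apply, Pi.one_apply]
    rw [← ENNReal.ofReal_add (by linarith [hx.2]) hx.1]
    simp
  have hηle : η ≤ γ := by
    conv_rhs => rw [← hsum]
    exact Measure.le_add_right le_rfl
  have hηlf : IsLocallyFiniteMeasure η := by
    refine ⟨fun x => ⟨Iic (x + 1), Iic_mem_nhds (by linarith), ?_⟩⟩
    exact lt_of_le_of_lt (hηle _) (gfin h _)
  have hηeq : η = SD.measure + SM.measure := by
    apply Measure.ext_of_Ioc
    intro a b hab
    rw [Measure.add_apply, StieltjesFunction.measure_Ioc, StieltjesFunction.measure_Ioc]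
    change η (Ioc a b) = ENNReal.ofReal (D b - D a) +
      ENNReal.ofReal ((G b - R b) - D b - ((G a - R a) - D a))
    rw [← ENNReal.ofReal_add (by linarith [hD hab.le]) (by have := hDN a b hab.le; linarith)]
    have e1 : η (Ioc a b) + densM γ ρ (Ioc a b) = γ (Ioc a b) := by
      rw [← Measure.add_apply, hsum]
    rw [sub_Ioc _ R hR hR0 hab.le, g_Ioc h hab.le] at e1
    have e2 : ENNReal.ofReal (G b - G a) = ENNReal.ofReal ((G b - G a) - (R b - R a))
        + ENNReal.ofReal (R b - R a) := by
      rw [← ENNReal.ofReal_add]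
      · congr 1; ring
      · have := hDN a b hab.le
        have := hD hab.le
        linarith
      · linarith [hRmono hab.le]
    rw [e2] at e1
    rw [(ENNReal.add_left_inj ENNReal.ofReal_ne_top).1 e1]
    congr 1; ring
  have hνη : SD.measure ≤ η := by
    rw [hηeq]; exact Measure.le_add_right le_rfl
  have hDt : Tendsto D atTop (nhds m) := by
    apply tendsto_atTop_isLUB hD
    constructor
    · rintro _ ⟨x, rfl⟩; exact Dm x
    · intro b hb
      by_contra! hlt
      obtain ⟨x, hx⟩ := Dtop ((b + m) / 2) (by linarith)
      have := hb ⟨x, rfl⟩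
      linarith
  have hDb : Tendsto D atBot (nhds 0) := by
    apply tendsto_const_nhds.congr'
    filter_upwards [eventually_le_atBot 0] with x hx
    exact (D0 x hx).symm
  have νuniv : SD.measure univ = ENNReal.ofReal m := by
    rw [StieltjesFunction.measure_univ SD hDb hDt, sub_zero]
  have νIic : ∀ x, SD.measure (Iic x) = ENNReal.ofReal (D x) := by
    intro x
    rw [StieltjesFunction.measure_Iic SD hDb]
    change ENNReal.ofReal (D x - 0) = _
    rw [sub_zero]
  have νfin : IsFiniteMeasure SD.measure := ⟨by rw [νuniv]; exact ENNReal.ofReal_lt_top⟩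
  have νac : SD.measure ≪ γ := Measure.absolutelyContinuous_of_le (hνη.trans hηle)
  set r : ℝ → ℝ := fun x => (SD.measure.rnDeriv γ x).toReal with hr
  have hrae : (fun x => ENNReal.ofReal (r x)) =ᵐ[γ] SD.measure.rnDeriv γ := by
    filter_upwards [Measure.rnDeriv_lt_top SD.measure γ] with x hx
    simp only [hr]
    rw [ENNReal.ofReal_toReal hx.ne]
  have hdens : densM γ r = SD.measure := by
    unfold densM
    rw [withDensity_congr_ae hrae, Measure.withDensity_rnDeriv_eq _ _ νac]
  have hle : ∀ᵐ x ∂γ, SD.measure.rnDeriv γ x ≤ ENNReal.ofReal (1 - ρ x) := by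
    apply ae_le_of_forall_setLIntegral_le_of_sigmaFinite
    · exact Measure.measurable_rnDeriv _ _
    · intro s hs _
      rw [← withDensity_apply _ hs, ← withDensity_apply _ hs, Measure.withDensity_rnDeriv_eq _ _ νac]
      exact hνη s
  have hadm : Adm γ ρ r := by
    refine ⟨(Measure.measurable_rnDeriv _ _).ennreal_toReal, fun x => ENNReal.toReal_nonneg, ?_, ?_⟩
    · filter_upwards [hle, hρ01] with x hx h01
      have := ENNReal.toReal_mono ENNReal.ofReal_ne_top hx
      rw [ENNReal.toReal_ofReal (by linarith [h01.2])] at this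
      simp only [hr]
      linarith
    · rw [hρ_mass]
      have : densM γ r univ = ENNReal.ofReal m := by rw [hdens, νuniv]
      unfold densM at this
      rwa [withDensity_apply _ MeasurableSet.univ, setLIntegral_univ] at this
  have μuniv : densM γ ρ univ = ENNReal.ofReal m := by
    unfold densM
    rwa [withDensity_apply _ MeasurableSet.univ, setLIntegral_univ]
  have μfin : IsFiniteMeasure (densM γ ρ) := ⟨by rw [μuniv]; exact ENNReal.ofReal_lt_top⟩
  have q1 := qmap m R Q1 (densM γ ρ) hR hRm hQ1
  have q2 := qmap m D Q2 SD.measure νIic Dm hQ2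
  unfold WEnergyPow
  refine (iInf₂_le r hadm).trans ?_
  unfold WpPow
  rw [hdens]
  have hpair : AEMeasurable (fun t => (Q1 t, Q2 t)) (volume.restrict (Ioo 0 m)) := q1.1.prodMk q2.1
  have hcpl : IsCoupling ((volume.restrict (Ioo 0 m)).map fun t => (Q1 t, Q2 t)) (densM γ ρ)
      SD.measure := by
    constructor
    · rw [AEMeasurable.map_map_of_aemeasurable measurable_fst.aemeasurable hpair]
      exact q1.2
    · rw [AEMeasurable.map_map_of_aemeasurable measurable_snd.aemeasurable hpair]
      exact q2.2
  refine (iInf₂_le (f := fun (π : Measure (ℝ × ℝ)) (_ : IsCoupling π (densM γ ρ) SD.measure) =>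
    tCost p π) _ hcpl).trans ?_
  unfold tCost
  rw [lintegral_map' _ hpair]
  · exact le_of_eq rfl
  · apply Measurable.aemeasurable
    apply Measurable.ennreal_ofReal
    exact (measurable_fst.dist measurable_snd).pow_const p

lemma CC_fin {γ : Measure ℝ} {G H : ℝ → ℝ} (h : GHD γ G H) {p m : ℝ} (hp : 1 < p) (hm : 0 < m) :
    CC H p m ≠ ⊤ := by
  unfold CC
  have : ∫⁻ t in Ioo 0 m, ENNReal.ofReal ((H (t + m) - H t) ^ p) ≤
      ∫⁻ t in Ioo 0 m, ENNReal.ofReal ((H (0 + m) - H 0) ^ p) := by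
    apply setLIntegral_mono' measurableSet_Ioo
    intro t ht
    apply ENNReal.ofReal_le_ofReal
    have := h.Hle ht.1.le (by linarith : t ≤ t + m)
    apply Real.rpow_le_rpow (by linarith) _ (by linarith)
    exact h.conc 0 t m le_rfl ht.1.le hm.le
  refine ne_top_of_le_ne_top ?_ this
  rw [setLIntegral_const]
  exact ENNReal.mul_ne_top ENNReal.ofReal_ne_top (by simp)

lemma CC_meas {γ : Measure ℝ} {G H : ℝ → ℝ} (h : GHD γ G H) {p m : ℝ} (hm : 0 < m) :
    AEMeasurable (fun t => ENNReal.ofReal ((H (t + m) - H t) ^ p)) (volume.restrict (Ioo 0 m)) := by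
  have q1 := (qmap1 h hm).1
  have q2 := (qmap2 h hm).1
  exact ((q2.sub q1).pow_const p).ennreal_ofReal

lemma clamp_sum (a g δ m : ℝ) (h1 : 0 ≤ δ) (h2 : δ ≤ m) :
    min (max (a - (g - δ)) 0) δ + min (max (a - g) 0) m + min (max (a - (g + m)) 0) (m - δ)
      = min (max (a - (g - δ)) 0) (2 * m) := by
  rcases le_total a (g - δ) with h | h
  · rw [max_eq_right (by linarith), max_eq_right (by linarith), max_eq_right (by linarith),
      min_eq_left (by linarith), min_eq_left (by linarith), min_eq_left (by linarith),
      min_eq_left (by linarith)]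
    ring
  rw [max_eq_left (by linarith : 0 ≤ a - (g - δ))]
  rcases le_total a g with h' | h'
  · rw [max_eq_right (by linarith), max_eq_right (by linarith),
      min_eq_left (by linarith), min_eq_left (by linarith), min_eq_left (by linarith),
      min_eq_left (by linarith)]
    ring
  rw [max_eq_left (by linarith : 0 ≤ a - g), min_eq_right (by linarith : δ ≤ a - (g - δ))]
  rcases le_total a (g + m) with h'' | h''
  · rw [max_eq_right (by linarith),
      min_eq_left (by linarith), min_eq_left (by linarith), min_eq_left (by linarith)]
    ring
  rw [max_eq_left (by linarith : 0 ≤ a - (g + m)), min_eq_right (by linarith : m ≤ a - g)]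
  rcases le_total (a - (g + m)) (m - δ) with h3 | h3
  · rw [min_eq_left h3, min_eq_left (by linarith)]
    ring
  · rw [min_eq_right h3, min_eq_right (by linarith)]
    ring

lemma clamp_mono (c e a b : ℝ) (hab : a ≤ b) :
    min (max (a - c) 0) e ≤ min (max (b - c) 0) e := by
  gcongr

lemma clamp_lip (c e a b : ℝ) (hab : a ≤ b) :
    min (max (b - c) 0) e - min (max (a - c) 0) e ≤ b - a := by
  have h1 : max (b - c) 0 ≤ max (a - c) 0 + (b - a) := by
    apply max_le
    · linarith [le_max_left (a - c) 0]
    · linarith [le_max_right (a - c) 0]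
  rcases le_total (max (a - c) 0) e with h | h
  · rw [min_eq_left h]
    linarith [min_le_left (max (b - c) 0) e]
  · rw [min_eq_right h]
    linarith [min_le_right (max (b - c) 0) e]

lemma shifted {γ : Measure ℝ} {G H : ℝ → ℝ} (h : GHD γ G H) {p m : ℝ} (hp : 1 < p) (hm : 0 < m)
    (ρ : ℝ → ℝ) (hρ_meas : Measurable ρ) (hρ01 : ∀ᵐ x ∂γ, 0 ≤ ρ x ∧ ρ x ≤ 1)
    (hρ_mass : ∫⁻ x, ENNReal.ofReal (ρ x) ∂γ = ENNReal.ofReal m)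
    (R : ℝ → ℝ) (hR : ∀ x, densM γ ρ (Iic x) = ENNReal.ofReal (R x)) (hR0 : ∀ x, 0 ≤ R x)
    (hRm : ∀ x, R x ≤ m) (hRmono : Monotone R) (g : ℝ) (hg : 0 < g)
    (hRg : ∀ x, R x = min (max (G x - g) 0) m) :
    WEnergyPow p γ ρ < CC H p m := by
  obtain ⟨δ, hδ0, hδg, hδm⟩ : ∃ δ, 0 < δ ∧ δ ≤ g ∧ δ < m :=
    ⟨min g (m / 2), lt_min hg (by linarith), min_le_left _ _,
      (min_le_right _ _).trans_lt (by linarith)⟩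
  set D : ℝ → ℝ := fun x => min (max (G x - (g - δ)) 0) δ + min (max (G x - (g + m)) 0) (m - δ)
    with hD
  have hDR : ∀ x, D x + R x = min (max (G x - (g - δ)) 0) (2 * m) := by
    intro x
    rw [← clamp_sum (G x) g δ m hδ0.le hδm.le, hRg]
    simp only [hD]
    ring
  set Q2 : ℝ → ℝ := fun t => if t ≤ δ then H (g - δ + t) else H (g + m + (t - δ)) with hQ2
  have key := competitor h (p := p) hm ρ hρ_meas hρ01 hρ_mass R hR hR0 hRm hRmono D
    (by
      intro x y hxy
      have := h.mono hxy
      exact add_le_add (clamp_mono _ _ _ _ this) (clamp_mono _ _ _ _ this))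
    (by
      intro x y hxy
      have := h.mono hxy
      have h1 := hDR x
      have h2 := hDR y
      have := clamp_lip (g - δ) (2 * m) _ _ this
      linarith)
    (by
      intro x hx
      simp only [hD]
      rw [h.zero x hx, max_eq_right (by linarith), max_eq_right (by linarith),
        min_eq_left (by linarith), min_eq_left (by linarith), add_zero])
    (by
      intro x
      simp only [hD]
      linarith [min_le_right (max (G x - (g - δ)) 0) δ,
        min_le_right (max (G x - (g + m)) 0) (m - δ)])
    (by
      intro t ht
      refine ⟨H (g + m + m), ?_⟩
      simp only [hD]
      rw [h.inv _ (by linarith), max_eq_left (by linarith), max_eq_left (by linarith),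
        min_eq_right (by linarith), min_eq_right (by linarith)]
      linarith)
    (fun t => H (g + t)) Q2
    (by
      intro t ht x
      rw [h.le_iff (by linarith [ht.1]), hRg, le_min_iff, le_max_iff]
      constructor
      · intro h; exact ⟨Or.inl (by linarith), ht.2.le⟩
      · rintro ⟨h | h, -⟩
        · linarith
        · linarith [ht.1])
    (by
      intro t ht x
      simp only [hQ2, hD]
      split_ifs with hc
      · rw [h.le_iff (by linarith [ht.1])]
        constructor
        · intro h1
          have : t ≤ min (max (G x - (g - δ)) 0) δ := le_min (le_max_of_le_left (by linarith)) hc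
          have : 0 ≤ min (max (G x - (g + m)) 0) (m - δ) := le_min (le_max_right _ _) (by linarith)
          linarith
        · intro h1
          by_contra! hlt
          rw [max_eq_right (by linarith : G x - (g + m) ≤ 0),
            min_eq_left (by linarith : 0 ≤ m - δ)] at h1
          have := min_le_left (max (G x - (g - δ)) 0) δ
          have : max (G x - (g - δ)) 0 < t := max_lt (by linarith) ht.1
          linarith
      · rw [h.le_iff (by linarith [ht.1])]
        constructor
        · intro h1
          rw [min_eq_right (le_max_of_le_left (by linarith) : δ ≤ max (G x - (g - δ)) 0)]
          have : t - δ ≤ min (max (G x - (g + m)) 0) (m - δ) :=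
            le_min (le_max_of_le_left (by linarith)) (by linarith [ht.2])
          linarith
        · intro h1
          by_contra! hlt
          have := min_le_right (max (G x - (g - δ)) 0) δ
          have := min_le_left (max (G x - (g + m)) 0) (m - δ)
          have : max (G x - (g + m)) 0 < t - δ := max_lt (by linarith) (by linarith)
          linarith)
  have hlt : ∀ᵐ t ∂(volume.restrict (Ioo 0 m)), ENNReal.ofReal (|H (g + t) - Q2 t| ^ p) <
      ENNReal.ofReal ((H (t + m) - H t) ^ p) := by
    filter_upwards [ae_restrict_mem measurableSet_Ioo] with t ht
    have ht0 := ht.1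
    have a1 := h.Hlt ht0.le (by linarith : t < t + m)
    have a2 : |H (g + t) - Q2 t| < H (t + m) - H t := by
      simp only [hQ2]
      split_ifs with hc
      · have b1 := h.Hle (by linarith) (by linarith : g - δ + t ≤ g + t)
        rw [abs_of_nonneg (by linarith)]
        have b2 := h.conc t (g - δ + t) δ ht0.le (by linarith) hδ0.le
        rw [(by ring : g - δ + t + δ = g + t)] at b2
        have b3 := h.Hlt (by linarith) (by linarith : t + δ < t + m)
        linarith
      · have b1 := h.Hle (by linarith) (by linarith : g + t ≤ g + m + (t - δ))
        rw [abs_of_nonpos (by linarith)]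
        have b2 := h.conc t (g + t) (m - δ) ht0.le (by linarith) (by linarith)
        rw [(by ring : g + t + (m - δ) = g + m + (t - δ))] at b2
        have b3 := h.Hlt (by linarith) (by linarith : t + (m - δ) < t + m)
        linarith
    rw [ENNReal.ofReal_lt_ofReal_iff (Real.rpow_pos_of_pos (by linarith) _)]
    exact Real.rpow_lt_rpow (abs_nonneg _) a2 (by linarith)
  refine key.trans_lt ?_
  unfold CC
  apply lintegral_strict_mono _ (CC_meas h hm) _ hlt
  · intro h0
    rw [Measure.restrict_eq_zero, Real.volume_Ioo, ENNReal.ofReal_eq_zero] at h0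
    linarith
  · refine ne_top_of_le_ne_top (CC_fin h hp hm) ?_
    unfold CC
    exact lintegral_mono_ae (hlt.mono fun t ht => ht.le)

lemma fifo {γ : Measure ℝ} {G H : ℝ → ℝ} (h : GHD γ G H) {p m : ℝ} (hp : 1 < p) (hm : 0 < m)
    (ρ : ℝ → ℝ) (hρ_meas : Measurable ρ) (hρ01 : ∀ᵐ x ∂γ, 0 ≤ ρ x ∧ ρ x ≤ 1)
    (hρ_mass : ∫⁻ x, ENNReal.ofReal (ρ x) ∂γ = ENNReal.ofReal m)
    (R : ℝ → ℝ) (hR : ∀ x, densM γ ρ (Iic x) = ENNReal.ofReal (R x)) (hR0 : ∀ x, 0 ≤ R x)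
    (hRm : ∀ x, R x ≤ m) (hRmono : Monotone R)
    (hRG : ∀ x y, x ≤ y → R y - R x ≤ G y - G x) (hRz : ∀ x, x ≤ 0 → R x = 0)
    (hRtop : ∀ t, t < m → ∃ x, t ≤ R x) :
    WEnergyPow p γ ρ < CC H p m ∨ ∃ g, 0 ≤ g ∧ ∀ x, R x = min (max (G x - g) 0) m := by
  by_contra! hcon
  obtain ⟨hcon1, hcon2⟩ := hcon
  have Rc : Continuous R := cont_of_G h.cont hRmono hRG
  have hRleG : ∀ x, R x ≤ G x := by
    intro x
    rcases le_total x 0 with hx | hx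
    · rw [hRz x hx, h.zero x hx]
    · have := hRG 0 x hx
      rw [hRz 0 le_rfl, h.zero 0 le_rfl] at this
      linarith
  set N : ℝ → ℝ := fun x => G x - R x with hN
  have hNG : ∀ x, N x = G x - R x := fun x => rfl
  have Nmono : Monotone N := by
    intro x y hxy
    have := hRG x y hxy
    simp only [hN]; linarith
  set f : ℝ → ℝ := fun x => N x - R x with hf
  have fc : Continuous f := (h.cont.sub Rc).sub Rc
  have hfz : ∀ x, x ≤ 0 → f x = 0 := by
    intro x hx
    simp only [hf, hN]
    rw [hRz x hx, h.zero x hx]; ring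
  set M : ℝ → ℝ := fun x => sSup (f '' Iic x) with hM
  have hbdd : ∀ x, BddAbove (f '' Iic x) := by
    intro x
    refine ⟨N x, ?_⟩
    rintro _ ⟨u, hu, rfl⟩
    have := Nmono hu
    simp only [hf]
    linarith [hR0 u]
  have leM : ∀ u x, u ≤ x → f u ≤ M x := fun u x hux => le_csSup (hbdd x) ⟨u, hux, rfl⟩
  have Mle : ∀ x b, (∀ u, u ≤ x → f u ≤ b) → M x ≤ b := by
    intro x b hb
    apply csSup_le (show (f '' Iic x).Nonempty from ⟨f x, x, self_mem_Iic, rfl⟩)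
    rintro _ ⟨u, hu, rfl⟩
    exact hb u hu
  set D : ℝ → ℝ := fun x => N x - M x with hD
  have Dle : ∀ u x, u ≤ x → D x ≤ R u + N x - N u := by
    intro u x hux
    have := leM u x hux
    simp only [hD, hf] at this ⊢
    linarith
  have leD : ∀ x t, (∀ u, u ≤ x → t ≤ R u + N x - N u) → t ≤ D x := by
    intro x t ht
    have := Mle x (N x - t) (fun u hu => by
      have := ht u hu
      simp only [hf]; linarith)
    simp only [hD]; linarith
  have Dmono : Monotone D := by
    intro x y hxy
    apply leD
    intro u hu
    rcases le_total u x with hc | hc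
    · have := Dle u x hc
      have := Nmono hxy
      linarith
    · have h1 := Dle x x le_rfl
      have := Nmono hu
      have := hRmono hc
      linarith
  have hDN : ∀ x y, x ≤ y → D y - D x ≤ (G y - R y) - (G x - R x) := by
    intro x y hxy
    have : M x ≤ M y := Mle x _ fun u hu => leM u y (hu.trans hxy)
    simp only [hD, hN]; linarith
  have D0 : ∀ x, x ≤ 0 → D x = 0 := by
    intro x hx
    have hNz : N x = 0 := by simp only [hN]; rw [hRz x hx, h.zero x hx]; ring
    have h1 : M x ≤ 0 := Mle x 0 fun u hu => (hfz u (hu.trans hx)).le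
    have h2 : f x ≤ M x := leM x x le_rfl
    rw [hfz x hx] at h2
    simp only [hD]; linarith
  have DleR : ∀ x, D x ≤ R x := by
    intro x
    have := Dle x x le_rfl
    linarith
  have Dm : ∀ x, D x ≤ m := fun x => (DleR x).trans (hRm x)
  have Dtop : ∀ t, t < m → ∃ x, t ≤ D x := by
    intro t ht
    obtain ⟨K, hK⟩ := hRtop t ht
    have hGK := h.nonneg K
    refine ⟨H (G K + 2 * m), leD _ _ fun u hu => ?_⟩
    have hG : G (H (G K + 2 * m)) = G K + 2 * m := h.inv _ (by linarith)
    rcases le_total u K with hc | hc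
    · have h1 := Nmono hc
      have h2 := hNG (H (G K + 2 * m))
      have h3 := hNG K
      have := hRm (H (G K + 2 * m))
      have := hR0 K
      have := hR0 u
      linarith
    · have := Nmono hu
      have := hRmono hc
      linarith
  have Dc : Continuous D := by
    apply cont_of_G h.cont Dmono
    intro x y hxy
    have := hDN x y hxy
    have := hRmono hxy
    linarith
  obtain ⟨Q1, hQ1⟩ := exists_q m R Rc hRmono (fun x hx => (hRz x hx).le) hRtop
  obtain ⟨Q2, hQ2⟩ := exists_q m D Dc Dmono (fun x hx => (D0 x hx).le) Dtop
  have key := competitor h (p := p) hm ρ hρ_meas hρ01 hρ_mass R hR hR0 hRm hRmono D Dmono hDN D0 Dm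
    Dtop Q1 Q2 (fun t ht => (hQ1 t ht).2) (fun t ht => (hQ2 t ht).2)
  have pos : ∀ t ∈ Ioo 0 m, 0 ≤ Q1 t := by
    intro t ht
    by_contra! hlt
    have := hRz _ hlt.le
    rw [(hQ1 t ht).1] at this
    linarith [ht.1]
  have le12 : ∀ t ∈ Ioo 0 m, Q1 t ≤ Q2 t := by
    intro t ht
    rw [(hQ1 t ht).2]
    have := DleR (Q2 t)
    rwa [(hQ2 t ht).1] at this
  have le2 : ∀ t ∈ Ioo 0 m, Q2 t ≤ H (G (Q1 t) + m) := by
    intro t ht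
    have hG : G (H (G (Q1 t) + m)) = G (Q1 t) + m := h.inv _ (by linarith [h.nonneg (Q1 t)])
    rw [(hQ2 t ht).2]
    apply leD
    intro u hu
    have hRQ := (hQ1 t ht).1
    rcases le_total u (Q1 t) with hc | hc
    · have h2 := hNG (H (G (Q1 t) + m))
      have h3 := hNG u
      have h4 := hRm (H (G (Q1 t) + m))
      have h5 := hR0 u
      have h6 := hRG u (Q1 t) hc
      linarith
    · have := Nmono hu
      have := hRmono hc
      linarith
  have le3 : ∀ t ∈ Ioo 0 m, H (G (Q1 t) + m) - Q1 t ≤ H (t + m) - H t := by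
    intro t ht
    have h1 := hRleG (Q1 t)
    rw [(hQ1 t ht).1] at h1
    have := h.conc t (G (Q1 t)) m ht.1.le h1 hm.le
    rwa [h.HG _ (pos t ht)] at this
  have ptle : (fun t => ENNReal.ofReal (|Q1 t - Q2 t| ^ p)) ≤ᵐ[volume.restrict (Ioo 0 m)]
      fun t => ENNReal.ofReal ((H (t + m) - H t) ^ p) := by
    filter_upwards [ae_restrict_mem measurableSet_Ioo] with t ht
    apply ENNReal.ofReal_le_ofReal
    apply Real.rpow_le_rpow (abs_nonneg _) _ (by linarith)
    have := le12 t ht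
    have := le2 t ht
    have := le3 t ht
    rw [abs_of_nonpos (by linarith)]
    linarith
  have hfin : ∫⁻ t in Ioo 0 m, ENNReal.ofReal (|Q1 t - Q2 t| ^ p) ≠ ⊤ :=
    ne_top_of_le_ne_top (CC_fin h hp hm) (lintegral_mono_ae ptle)
  have hae := ae_eq_of_ae_le_of_lintegral_le ptle hfin (CC_meas h hm) (hcon1.trans key)
  set Bad : Set ℝ := {t | t ∈ Ioo 0 m ∧ ∃ u, Q1 t < u ∧ R u = t} with hBad
  have hBc : Bad.Countable := by
    have : ∀ t, ∃ u, t ∈ Bad → Q1 t < u ∧ R u = t := by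
      intro t
      by_cases ht : t ∈ Bad
      · obtain ⟨-, u, hu⟩ := ht
        exact ⟨u, fun _ => hu⟩
      · exact ⟨0, fun h => absurd h ht⟩
    choose U hU using this
    have hval : ∀ t ∈ Bad, ∀ z ∈ Ioo (Q1 t) (U t), R z = t := by
      intro t ht z hz
      apply le_antisymm
      · have := hRmono hz.2.le
        rwa [(hU t ht).2] at this
      · have := hRmono hz.1.le
        rwa [(hQ1 t ht.1).1] at this
    apply Set.PairwiseDisjoint.countable_of_isOpen (s := fun t => Ioo (Q1 t) (U t))
    · intro s hs t ht hst
      apply Set.disjoint_left.2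
      intro z hz1 hz2
      exact hst ((hval s hs z hz1).symm.trans (hval t ht z hz2))
    · intro t _; exact isOpen_Ioo
    · intro t ht; exact nonempty_Ioo.2 (hU t ht).1
  have hgood : ∀ᵐ t ∂(volume.restrict (Ioo 0 m)), t ∈ Ioo 0 m ∧
      ∃ u, 0 ≤ u ∧ R u = 0 ∧ G (Q1 t) - G u = t := by
    have hBn : ∀ᵐ t ∂(volume.restrict (Ioo 0 m)), t ∉ Bad :=
      ae_restrict_of_ae (hBc.ae_notMem volume)
    filter_upwards [hae, ae_restrict_mem measurableSet_Ioo, hBn] with t h1 ht hB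
    refine ⟨ht, ?_⟩
    have l1 := le12 t ht
    have l2 := le2 t ht
    have l3 := le3 t ht
    have hH := h.Hlt ht.1.le (by linarith : t < t + m)
    have e1 : |Q1 t - Q2 t| ^ p = (H (t + m) - H t) ^ p := by
      rwa [ENNReal.ofReal_eq_ofReal_iff (Real.rpow_nonneg (abs_nonneg _) _)
        (Real.rpow_nonneg (by linarith) _)] at h1
    rw [Real.rpow_left_inj (abs_nonneg _) (by linarith) (by linarith),
      abs_of_nonpos (by linarith)] at e1
    have e2 : Q2 t = H (G (Q1 t) + m) := by linarith
    set z := Q2 t with hz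
    have hz0 : 0 ≤ z := (pos t ht).trans l1
    have hGz : G z = G (Q1 t) + m := by
      rw [e2]; exact h.inv _ (by linarith [h.nonneg (Q1 t)])
    obtain ⟨u, hu, hmax⟩ := isCompact_Icc.exists_isMaxOn (nonempty_Icc.2 hz0) fc.continuousOn
    have hMz : M z ≤ f u := by
      apply Mle
      intro v hv
      rcases le_total v 0 with hc | hc
      · rw [hfz v hc, ← hfz 0 le_rfl]
        exact hmax (show (0:ℝ) ∈ Icc 0 z from ⟨le_rfl, hz0⟩)
      · exact hmax (show v ∈ Icc 0 z from ⟨hc, hv⟩)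
    have hDz : R u + N z - N u ≤ t := by
      have : D z = t := (hQ2 t ht).1
      simp only [hD, hf] at this hMz
      linarith
    have hRQ := (hQ1 t ht).1
    have n1 := hNG z
    have n2 := hNG u
    have n3 := hRm z
    have n4 := hR0 u
    rcases lt_or_ge u (Q1 t) with hc | hc
    · have h6 := hRG u (Q1 t) hc.le
      exact ⟨u, hu.1, by linarith, by linarith⟩
    · exfalso
      apply hB
      have m1 := Nmono hu.2
      have m2 := hRmono hc
      refine ⟨ht, u, lt_of_le_of_ne hc ?_, by linarith⟩
      intro heq
      rw [← heq] at n2 hDz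
      linarith [ht.1]
  have hex : ∀ s, s < m → ∃ t, s < t ∧ t ∈ Ioo 0 m ∧
      ∃ u, 0 ≤ u ∧ R u = 0 ∧ G (Q1 t) - G u = t := by
    intro s hs
    by_contra! hno
    have hnull : (volume.restrict (Ioo 0 m)) (Ioo (max s 0) m) = 0 := by
      apply measure_mono_null _ (ae_iff.1 hgood)
      intro t ht hgt
      obtain ⟨g1, u, g2, g3, g4⟩ := hgt
      exact hno t ((le_max_left _ _).trans_lt ht.1) g1 u g2 g3 g4
    rw [Measure.restrict_apply measurableSet_Ioo,
      inter_eq_left.2 (Ioo_subset_Ioo_left (le_max_right _ _)), Real.volume_Ioo,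
      ENNReal.ofReal_eq_zero] at hnull
    have := max_lt hs hm
    linarith
  obtain ⟨t0, -, ht0, u0, hu0, hRu0, hGu0⟩ := hex 0 hm
  have cmp : ∀ t ∈ Ioo 0 m, ∀ u v, R v = 0 → G (Q1 t) - G u = t → G v ≤ G u := by
    intro t ht u v hv hGt
    have hRQ := (hQ1 t ht).1
    have hlt : v ≤ Q1 t := by
      by_contra! hlt
      have := hRmono hlt.le
      linarith [ht.1]
    have := hRG v (Q1 t) hlt
    linarith
  obtain ⟨x, hx⟩ := hcon2 (G u0) (h.nonneg u0)
  apply hx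
  have up : G u0 ≤ G x → R x ≤ G x - G u0 := by
    intro hc
    rcases le_total u0 x with hc' | hc'
    · have := hRG u0 x hc'
      linarith
    · have := hRmono hc'
      linarith
  rcases le_total (G x) (G u0) with hc | hc
  · rw [max_eq_right (by linarith), min_eq_left hm.le]
    apply le_antisymm _ (hR0 x)
    rcases le_total u0 x with hc' | hc'
    · have := hRG u0 x hc'
      linarith
    · have := hRmono hc'
      linarith
  · rw [max_eq_left (by linarith)]
    apply le_antisymm (le_min (up hc) (hRm x))
    by_contra! hlt
    obtain ⟨t, hst, ht, u, hu, hRu, hGu⟩ := hex (R x) (hlt.trans_le (min_le_right _ _))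
    have e : G u = G u0 := le_antisymm (cmp t0 ht0 u0 u hRu hGu0) (cmp t ht u u0 hRu0 hGu)
    have hRQ := (hQ1 t ht).1
    rcases le_total (Q1 t) x with hc' | hc'
    · have := hRmono hc'
      linarith
    · have := hRG x (Q1 t) hc'
      have := hlt.trans_le (min_le_left _ _)
      linarith

lemma energy_congr {γ : Measure ℝ} {p : ℝ} {ρ σ : ℝ → ℝ} (h : ρ =ᵐ[γ] σ) :
    WEnergyPow p γ ρ = WEnergyPow p γ σ := by
  have h1 : densM γ ρ = densM γ σ := by
    unfold densM
    apply withDensity_congr_ae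
    filter_upwards [h] with x hx
    rw [hx]
  have h3 : ∫⁻ x, ENNReal.ofReal (ρ x) ∂γ = ∫⁻ x, ENNReal.ofReal (σ x) ∂γ := by
    apply lintegral_congr_ae
    filter_upwards [h] with x hx
    rw [hx]
  have h2 : ∀ ρ', Adm γ ρ ρ' ↔ Adm γ σ ρ' := by
    intro ρ'
    unfold Adm
    rw [h3]
    have : (∀ᵐ x ∂γ, ρ x + ρ' x ≤ 1) ↔ ∀ᵐ x ∂γ, σ x + ρ' x ≤ 1 := by
      apply eventually_congr
      filter_upwards [h] with x hx
      rw [hx]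
    rw [this]
  unfold WEnergyPow
  rw [h1]
  simp only [h2]

lemma strict_or {γ : Measure ℝ} {G H : ℝ → ℝ} (h : GHD γ G H) {p m : ℝ} (hp : 1 < p) (hm : 0 < m)
    (ρ : ℝ → ℝ) (hρ_meas : Measurable ρ) (hρ01 : ∀ᵐ x ∂γ, 0 ≤ ρ x ∧ ρ x ≤ 1)
    (hρ_mass : ∫⁻ x, ENNReal.ofReal (ρ x) ∂γ = ENNReal.ofReal m) :
    WEnergyPow p γ ρ < CC H p m ∨ ρ =ᵐ[γ] (Set.Icc 0 (H m)).indicator fun _ => (1 : ℝ) := by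
  have μuniv : densM γ ρ univ = ENNReal.ofReal m := by
    unfold densM
    rwa [withDensity_apply _ MeasurableSet.univ, setLIntegral_univ]
  have μfin : IsFiniteMeasure (densM γ ρ) := ⟨by rw [μuniv]; exact ENNReal.ofReal_lt_top⟩
  have μle : densM γ ρ ≤ γ := by
    conv_rhs => rw [← withDensity_one (μ := γ)]
    unfold densM
    apply withDensity_mono
    filter_upwards [hρ01] with x hx
    simpa using hx.2
  set R : ℝ → ℝ := fun x => (densM γ ρ (Iic x)).toReal with hRdef
  have hR : ∀ x, densM γ ρ (Iic x) = ENNReal.ofReal (R x) := fun x =>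
    (ENNReal.ofReal_toReal (measure_ne_top _ _)).symm
  have hR0 : ∀ x, 0 ≤ R x := fun x => ENNReal.toReal_nonneg
  have hRm : ∀ x, R x ≤ m := by
    intro x
    have : densM γ ρ (Iic x) ≤ ENNReal.ofReal m := by rw [← μuniv]; exact measure_mono (subset_univ _)
    exact ENNReal.toReal_le_of_le_ofReal hm.le this
  have hRmono : Monotone R := fun x y hxy =>
    ENNReal.toReal_mono (measure_ne_top _ _) (measure_mono (Iic_subset_Iic.2 hxy))
  have hRG : ∀ x y, x ≤ y → R y - R x ≤ G y - G x := by
    intro x y hxy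
    have := μle (Ioc x y)
    rw [sub_Ioc _ R hR hR0 hxy, g_Ioc h hxy] at this
    exact (ENNReal.ofReal_le_ofReal_iff (by linarith [h.mono hxy])).1 this
  have hRz : ∀ x, x ≤ 0 → R x = 0 := by
    intro x hx
    apply le_antisymm _ (hR0 x)
    have := μle (Iic x)
    rw [hR, h.cdf, ENNReal.ofReal_le_ofReal_iff (h.nonneg x), h.zero x hx] at this
    exact this
  have hRtop : ∀ t, t < m → ∃ x, t ≤ R x := by
    intro t ht
    have h1 := tendsto_measure_Iic_atTop (densM γ ρ)
    rw [μuniv] at h1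
    have h2 := (ENNReal.tendsto_toReal ENNReal.ofReal_ne_top).comp h1
    rw [ENNReal.toReal_ofReal hm.le] at h2
    obtain ⟨x, hx⟩ := (h2.eventually (lt_mem_nhds ht)).exists
    exact ⟨x, le_of_lt hx⟩
  rcases fifo h hp hm ρ hρ_meas hρ01 hρ_mass R hR hR0 hRm hRmono hRG hRz hRtop with hl | ⟨g, hg, hRg⟩
  · exact Or.inl hl
  rcases hg.eq_or_lt with hg0 | hg0
  · right
    have q := qmap m R H (densM γ ρ) hR hRm (by
      intro t ht x
      rw [h.le_iff ht.1, hRg, ← hg0, sub_zero, max_eq_left (h.nonneg x), le_min_iff]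
      exact ⟨fun h => ⟨h, ht.2.le⟩, fun h => h.1⟩)
    have e := q.2.symm.trans (qmap1 h hm).2
    unfold densM at e
    rw [← withDensity_indicator_one measurableSet_Iic, withDensity_eq_iff (by fun_prop)
      ((measurable_one.indicator measurableSet_Iic).aemeasurable)
      (by rw [hρ_mass]; exact ENNReal.ofReal_ne_top)] at e
    filter_upwards [e, hρ01, g_neg h] with x hx h01 h0
    have : ρ x = (ENNReal.ofReal (ρ x)).toReal := (ENNReal.toReal_ofReal h01.1).symm
    rw [this, hx]
    simp only [indicator, mem_Iic, mem_Icc, h0, true_and, Pi.one_apply]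
    split_ifs <;> simp
  · left
    exact shifted h hp hm ρ hρ_meas hρ01 hρ_mass R hR hR0 hRm hRmono g hg0 hRg

/-- One-dimensional weighted maximality: on `X = [0,∞)` with reference measure
`γ = w·ℒ¹` for a nondecreasing positive weight `w`, the segment `I = [0,ℓ]` of mass `m`
maximizes the weighted Wasserstein energy among densities of mass `m`, with equality
only for `ρ = χ_I` `γ`-a.e. -/
theorem segment_is_unique_maximizer_1D (p : ℝ) (hp : 1 < p) (m : ℝ) (hm : 0 < m)
    (w : ℝ → ℝ) (hw_meas : Measurable w) (hw_pos : ∀ x, 0 < x → 0 < w x)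
    (hw_mono : ∀ x y, 0 < x → x ≤ y → w x ≤ w y)
    (γ : Measure ℝ)
    (hγ : γ = (volume.restrict (Set.Ioi (0 : ℝ))).withDensity fun x => ENNReal.ofReal (w x))
    (ℓ : ℝ) (hℓ : 0 ≤ ℓ) (hI : γ (Set.Icc 0 ℓ) = ENNReal.ofReal m)
    (ρ : ℝ → ℝ) (hρ_meas : Measurable ρ) (hρ01 : ∀ᵐ x ∂γ, 0 ≤ ρ x ∧ ρ x ≤ 1)
    (hρ_mass : ∫⁻ x, ENNReal.ofReal (ρ x) ∂γ = ENNReal.ofReal m) :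
    WEnergy p γ ρ ≤ WEnergy p γ ((Set.Icc 0 ℓ).indicator fun _ => (1 : ℝ)) ∧
    (WEnergy p γ ρ = WEnergy p γ ((Set.Icc 0 ℓ).indicator fun _ => (1 : ℝ)) ↔
      ρ =ᵐ[γ] (Set.Icc 0 ℓ).indicator fun _ => (1 : ℝ)) := by
  obtain ⟨G, H, h⟩ := exists_GH w hw_meas hw_pos hw_mono γ hγ
  have hGℓ : G ℓ = m := by
    have : γ (Icc 0 ℓ) = γ (Iic ℓ) := by
      apply measure_congr
      filter_upwards [g_neg h] with x hx
      apply propext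
      change (0 ≤ x ∧ x ≤ ℓ) ↔ x ≤ ℓ
      simp [hx]
    rw [this, h.cdf, ENNReal.ofReal_eq_ofReal_iff (h.nonneg ℓ) hm.le] at hI
    exact hI
  have hHm : ℓ = H m := by rw [← hGℓ, h.HG ℓ hℓ]
  subst hHm
  have hp' : 0 < 1 / p := by positivity
  have hlow := lower_bound h hp hm
  have hs := strict_or h hp hm ρ hρ_meas hρ01 hρ_mass
  have hlt : ¬ (ρ =ᵐ[γ] (Set.Icc 0 (H m)).indicator fun _ => (1 : ℝ)) →
      WEnergy p γ ρ < WEnergy p γ ((Set.Icc 0 (H m)).indicator fun _ => (1 : ℝ)) := by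
    intro hne
    unfold WEnergy
    exact ENNReal.rpow_lt_rpow ((hs.resolve_right hne).trans_le hlow) hp'
  have heq : (ρ =ᵐ[γ] (Set.Icc 0 (H m)).indicator fun _ => (1 : ℝ)) →
      WEnergy p γ ρ = WEnergy p γ ((Set.Icc 0 (H m)).indicator fun _ => (1 : ℝ)) := by
    intro he
    unfold WEnergy
    rw [energy_congr he]
  refine ⟨?_, ?_, heq⟩
  · by_cases hc : ρ =ᵐ[γ] (Set.Icc 0 (H m)).indicator fun _ => (1 : ℝ)
    · exact (heq hc).le
    · exact (hlt hc).le
  · intro he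
    by_contra hc
    exact (hlt hc).ne he
end
end

section
/- Let p>1 and N≥1. There exists a constant C_N < +∞ (depending only on N; one may take C_N = (2/ω_N)^{1/N}, with ω_N the volume of the unit ball) such that for every m>0, every ρ ∈ A_m, and every optimal plan π ∈ AP_ρ realizing 𝒲_p(ρ), every point (x,y) in the support of π satisfies |x−y| ≤ C_N m^{1/N}. Consequently, 𝒲_p(ρ)^p ≤ C_N^p · m^{1+p/N} for all ρ ∈ A_m. -/
open MeasureTheory ENNReal Set Metric Filter

noncomputable section

lemma bt_energy_le {α : Type*} [MeasurableSpace α] [Dist α] (p : ℝ) (γ : Measure α) [SigmaFinite γ]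
    (ρ : α → ℝ) (h1 : ∀ᵐ x ∂γ, 0 ≤ ρ x ∧ ρ x ≤ 1)
    (π : Measure (α × α)) [IsFiniteMeasure π]
    (hπ : AP γ ρ π) : WEnergyPow p γ ρ ≤ tCost p π := by
  obtain ⟨hf, hs⟩ := hπ
  set ν := π.map Prod.snd with hν
  have hac : ν ≪ γ :=
    (Measure.absolutelyContinuous_of_le hs).trans (withDensity_absolutelyContinuous _ _)
  have hrn := Measure.withDensity_rnDeriv_eq ν γ hac
  have hle : ν.rnDeriv γ ≤ᵐ[γ] fun x => ENNReal.ofReal (1 - ρ x) := by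
    apply ae_le_of_forall_setLIntegral_le_of_sigmaFinite (Measure.measurable_rnDeriv _ _)
    intro s hs' _
    rw [← withDensity_apply _ hs', hrn, ← withDensity_apply _ hs']
    exact hs s
  set ρ' : α → ℝ := fun x => (ν.rnDeriv γ x).toReal with hρ'
  have hd : densM γ ρ' = ν := by
    rw [← hrn]
    apply withDensity_congr_ae
    filter_upwards [ν.rnDeriv_lt_top γ] with x hx
    simp [hρ', ENNReal.ofReal_toReal hx.ne]
  have hadm : Adm γ ρ ρ' := by
    refine ⟨(Measure.measurable_rnDeriv _ _).ennreal_toReal, fun x => ENNReal.toReal_nonneg, ?_, ?_⟩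
    · filter_upwards [hle, h1] with x hx hx1
      have := ENNReal.toReal_mono ENNReal.ofReal_ne_top hx
      rw [ENNReal.toReal_ofReal (by linarith)] at this
      simp only [hρ']; linarith
    · have e1 : ∫⁻ x, ENNReal.ofReal (ρ' x) ∂γ = densM γ ρ' univ := by simp [densM]
      have e2 : ∫⁻ x, ENNReal.ofReal (ρ x) ∂γ = densM γ ρ univ := by simp [densM]
      rw [e1, e2, hd, ← hf, hν, Measure.map_apply measurable_snd MeasurableSet.univ,
        Measure.map_apply measurable_fst MeasurableSet.univ]
      simp
  refine (iInf₂_le ρ' hadm).trans (iInf₂_le π ⟨hf, ?_⟩)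
  rw [hd]

def btK {α : Type*} [MeasurableSpace α] (σ : Measure α) (a : ℕ → ℝ≥0∞) (B : ℕ → Set α) :
    ℕ → Measure α
  | 0 => σ
  | n + 1 => (btK σ a B n).restrict (B n)ᶜ +
      (1 - a n / btK σ a B n (B n)) • (btK σ a B n).restrict (B n)

def btV {α : Type*} [MeasurableSpace α] (σ : Measure α) (a : ℕ → ℝ≥0∞) (B : ℕ → Set α) (n : ℕ) :
    Measure α :=
  (a n / btK σ a B n (B n)) • (btK σ a B n).restrict (B n)

lemma bt_greedy {α : Type*} [MeasurableSpace α] (σ : Measure α) (a : ℕ → ℝ≥0∞) (B : ℕ → Set α)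
    (hB : ∀ n, MeasurableSet (B n)) (hfin : ∀ n, σ (B n) ≠ ∞) (ha : ∑' n, a n ≠ ∞)
    (hle : ∀ n, ∑' n, a n ≤ σ (B n)) :
    ∃ ν : ℕ → Measure α, (∀ n, ν n univ = a n) ∧ (∀ n, ν n (B n)ᶜ = 0) ∧ Measure.sum ν ≤ σ := by
  have key : ∀ n, btK σ a B n + ∑ j ∈ Finset.range n, btV σ a B j = σ ∧
      ∀ j < n, btV σ a B j univ = a j := by
    intro n
    induction n with
    | zero => simp [btK]
    | succ n ih =>
      obtain ⟨ih1, ih2⟩ := ih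
      set κ := btK σ a B n with hκ
      have hsum : ∑ j ∈ Finset.range n, a j ≠ ∞ := ne_top_of_le_ne_top ha (ENNReal.sum_le_tsum _)
      have hκle : κ (B n) ≤ σ (B n) := by
        rw [← ih1]; simp
      have hκfin : κ (B n) ≠ ∞ := ne_top_of_le_ne_top (hfin n) hκle
      have hroom : a n ≤ κ (B n) := by
        have h1 : ∑ j ∈ Finset.range n, a j + a n ≤ κ (B n) + ∑ j ∈ Finset.range n, a j := by
          rw [← Finset.sum_range_succ]
          calc _ ≤ ∑' n, a n := ENNReal.sum_le_tsum _
            _ ≤ σ (B n) := hle n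
            _ = κ (B n) + ∑ j ∈ Finset.range n, btV σ a B j (B n) := by
              conv_lhs => rw [← ih1]
              simp
            _ ≤ _ := by
              gcongr with j hj
              rw [← ih2 j (Finset.mem_range.1 hj)]
              exact measure_mono (subset_univ _)
        rw [add_comm] at h1
        exact (ENNReal.add_le_add_iff_right hsum).1 h1
      have ht : a n / κ (B n) ≤ 1 := ENNReal.div_le_of_le_mul (by simpa using hroom)
      constructor
      · rw [Finset.sum_range_succ]
        have : btK σ a B (n+1) + btV σ a B n = κ := by
          simp only [btK, btV, ← hκ]
          rw [add_assoc, ← add_smul, tsub_add_cancel_of_le ht, one_smul,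
            add_comm, Measure.restrict_add_restrict_compl (hB n)]
        rw [← add_assoc, add_right_comm, this, ih1]
      · intro j hj
        rcases Nat.lt_succ_iff_lt_or_eq.1 hj with h | rfl
        · exact ih2 j h
        · simp only [btV, ← hκ]
          simp only [Measure.smul_apply, Measure.restrict_apply_univ, smul_eq_mul]
          by_cases h0 : κ (B j) = 0
          · have : a j = 0 := by simpa [h0] using hroom
            simp [this]
          · exact ENNReal.div_mul_cancel h0 hκfin
  refine ⟨btV σ a B, fun n => (key (n+1)).2 n (Nat.lt_succ_self n), fun n => ?_, ?_⟩
  · simp [btV, Measure.restrict_apply (hB n).compl]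
  · rw [Measure.le_iff]
    intro s hs
    rw [Measure.sum_apply _ hs]
    refine ENNReal.tsum_le_of_sum_range_le fun n => ?_
    conv_rhs => rw [← (key n).1]
    simp

/-- Existence of a plan moving mass at most `R + δ`. -/
lemma bt_plan {α : Type*} [MeasurableSpace α] [PseudoMetricSpace α] [BorelSpace α]
    [SecondCountableTopology α] [Nonempty α] (μ σ : Measure α) [IsFiniteMeasure μ] (R δ p : ℝ)
    (hδ : 0 < δ) (hR : 0 ≤ R) (hp : 0 ≤ p) (hfin : ∀ x, σ (ball x R) ≠ ∞)
    (hle : ∀ x, μ univ ≤ σ (ball x R)) :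
    ∃ π : Measure (α × α), π.map Prod.fst = μ ∧ π.map Prod.snd ≤ σ ∧
      tCost p π ≤ ENNReal.ofReal ((R + δ) ^ p) * μ univ := by
  set c : ℕ → α := TopologicalSpace.denseSeq α
  set Q : ℕ → Set α := disjointed fun n => ball (c n) δ with hQ
  have hQm : ∀ n, MeasurableSet (Q n) := MeasurableSet.disjointed fun n => measurableSet_ball
  have hQd : Pairwise (Function.onFun Disjoint Q) := disjoint_disjointed _
  have hQu : ⋃ n, Q n = univ := by
    rw [hQ, iUnion_disjointed, eq_univ_iff_forall]
    intro x
    obtain ⟨n, hn⟩ := (TopologicalSpace.denseRange_denseSeq α).exists_dist_lt x hδ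
    exact mem_iUnion.2 ⟨n, hn⟩
  have hsum : ∑' n, μ (Q n) = μ univ := by
    rw [← hQu, measure_iUnion hQd hQm]
  have hrs : Measure.sum (fun n => μ.restrict (Q n)) = μ := by
    rw [← Measure.restrict_iUnion hQd hQm, hQu, Measure.restrict_univ]
  obtain ⟨ν, hν1, hν2, hν3⟩ := bt_greedy σ (fun n => μ (Q n)) (fun n => ball (c n) R)
    (fun n => measurableSet_ball) (fun n => hfin _) (by rw [hsum]; exact measure_ne_top _ _)
    (fun n => by rw [hsum]; exact hle _)
  have hνf : ∀ n, IsFiniteMeasure (ν n) := fun n => ⟨by rw [hν1]; exact measure_lt_top _ _⟩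
  set π : Measure (α × α) := Measure.sum fun n => (μ (Q n))⁻¹ • (μ.restrict (Q n)).prod (ν n) with hπ
  have hf : π.map Prod.fst = μ := by
    rw [hπ, Measure.map_sum measurable_fst.aemeasurable]
    conv_rhs => rw [← hrs]
    congr 1; ext1 n
    rw [Measure.map_smul, Measure.map_fst_prod, smul_smul, hν1]
    by_cases h0 : μ (Q n) = 0
    · rw [Measure.restrict_eq_zero.2 h0]; simp
    · rw [ENNReal.inv_mul_cancel h0 (measure_ne_top _ _), one_smul]
  have hs : π.map Prod.snd = Measure.sum ν := by
    rw [hπ, Measure.map_sum measurable_snd.aemeasurable]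
    congr 1; ext1 n
    rw [Measure.map_smul, Measure.map_snd_prod, smul_smul, Measure.restrict_apply_univ]
    by_cases h0 : μ (Q n) = 0
    · have : ν n = 0 := by rw [← Measure.measure_univ_eq_zero, hν1, h0]
      rw [this]; simp
    · rw [ENNReal.inv_mul_cancel h0 (measure_ne_top _ _), one_smul]
  have hae : ∀ᵐ z ∂π, dist z.1 z.2 ≤ R + δ := by
    rw [hπ, Measure.ae_sum_iff]
    intro n
    apply Measure.ae_smul_measure
    have h1 : ∀ᵐ z ∂((μ.restrict (Q n)).prod (ν n)), z.1 ∈ Q n :=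
      Measure.quasiMeasurePreserving_fst.ae (ae_restrict_mem (hQm n))
    have h2 : ∀ᵐ z ∂((μ.restrict (Q n)).prod (ν n)), z.2 ∈ ball (c n) R :=
      Measure.quasiMeasurePreserving_snd.ae (show ∀ᵐ y ∂(ν n), y ∈ ball (c n) R from hν2 n)
    filter_upwards [h1, h2] with z hz1 hz2
    have hz1' : z.1 ∈ ball (c n) δ := disjointed_subset (fun n => ball (c n) δ) n hz1
    rw [mem_ball] at hz1' hz2
    have := dist_triangle_right z.1 z.2 (c n)
    linarith
  refine ⟨π, hf, hs ▸ hν3, ?_⟩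
  have hu : π univ = μ univ := by
    conv_rhs => rw [← hf]
    rw [Measure.map_apply measurable_fst MeasurableSet.univ]; simp
  calc tCost p π ≤ ∫⁻ z, ENNReal.ofReal ((R + δ) ^ p) ∂π := by
        apply lintegral_mono_ae
        filter_upwards [hae] with z hz
        gcongr
    _ = _ := by rw [lintegral_const, hu]

lemma bt_exchange {α : Type*} [MeasurableSpace α] [PseudoMetricSpace α] [BorelSpace α]
    [SecondCountableTopology α] (π : Measure (α × α)) [IsFiniteMeasure π] (σ κ : Measure α)
    [IsFiniteMeasure κ] (p : ℝ) (hp : 0 < p)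
    (hσ : π.map Prod.snd + κ ≤ σ) (hκ : κ ≠ 0) (hfin : tCost p π ≠ ∞)
    (S : Set (α × α)) (hS : MeasurableSet S) (hSpos : 0 < π S) (U V : Set α)
    (hU : MeasurableSet U) (hSU : ∀ z ∈ S, z.1 ∈ U) (hV : κ Vᶜ = 0) (r b : ℝ) (hb0 : 0 ≤ b)
    (hbr : b < r) (hSr : ∀ z ∈ S, r ≤ dist z.1 z.2) (hUV : ∀ x ∈ U, ∀ y ∈ V, dist x y ≤ b) :
    ∃ π' : Measure (α × α), π'.map Prod.fst = π.map Prod.fst ∧ π'.map Prod.snd ≤ σ ∧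
      tCost p π' < tCost p π := by
  set k := π S with hk
  have hkf : k ≠ ∞ := measure_ne_top _ _
  set η := κ univ with hη
  have hη0 : η ≠ 0 := by rwa [hη, Ne, Measure.measure_univ_eq_zero]
  have hηf : η ≠ ∞ := measure_ne_top _ _
  set t : ℝ≥0∞ := min 1 (η / k) with ht
  have ht1 : t ≤ 1 := min_le_left _ _
  have htk : t * k ≤ η := by
    calc t * k ≤ η / k * k := by gcongr; exact min_le_right _ _
      _ = η := ENNReal.div_mul_cancel hSpos.ne' hkf
  have ht0 : t ≠ 0 := by
    have : 0 < t := lt_min one_pos (ENNReal.div_pos hη0 hkf)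
    exact this.ne'
  have htf : t ≠ ∞ := ne_top_of_le_ne_top one_ne_top ht1
  set μ := (π.restrict S).map Prod.fst with hμ
  have hμu : μ univ = k := by
    rw [hμ, Measure.map_apply measurable_fst MeasurableSet.univ]; simp [hk]
  have : IsFiniteMeasure μ := ⟨by rw [hμu]; exact hkf.lt_top⟩
  set base : Measure (α × α) := (1 - t) • π.restrict S + π.restrict Sᶜ with hbase
  have hπ : base + t • π.restrict S = π := by
    rw [hbase, add_right_comm, ← add_smul, tsub_add_cancel_of_le ht1, one_smul,
      Measure.restrict_add_restrict_compl hS]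
  clear_value base
  set P := μ.prod κ with hP
  have mf : Measurable (Prod.fst : α × α → α) := measurable_fst
  have ms : Measurable (Prod.snd : α × α → α) := measurable_snd
  refine ⟨base + (t / η) • P, ?_, ?_, ?_⟩
  · conv_rhs => rw [← hπ]
    rw [Measure.map_add _ _ mf, Measure.map_add _ _ mf, Measure.map_smul, Measure.map_smul, hP,
      Measure.map_fst_prod, smul_smul, ← hη, ENNReal.div_mul_cancel hη0 hηf]
  · refine le_trans ?_ hσ
    rw [Measure.map_add _ _ ms, Measure.map_smul, hP, Measure.map_snd_prod, smul_smul, hμu]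
    have h1 : base.map Prod.snd ≤ π.map Prod.snd := by
      conv_rhs => rw [← hπ]
      rw [Measure.map_add _ _ ms]
      exact Measure.le_add_right le_rfl
    have h2 : (t / η * k) • κ ≤ κ := by
      have : t / η * k ≤ 1 := by
        rw [div_eq_mul_inv, mul_right_comm, ← div_eq_mul_inv]
        exact ENNReal.div_le_of_le_mul (by simpa using htk)
      intro s
      simp only [Measure.smul_apply, smul_eq_mul]
      exact mul_le_of_le_one_left' this
    exact add_le_add h1 h2
  · have hcb : tCost p π = tCost p base + t * tCost p (π.restrict S) := by
      conv_lhs => rw [← hπ]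
      simp [tCost, lintegral_add_measure, lintegral_smul_measure]
    have hcn : tCost p (base + (t / η) • P) = tCost p base + t / η * tCost p P := by
      simp [tCost, lintegral_add_measure, lintegral_smul_measure]
    have hbf : tCost p base ≠ ∞ := ne_top_of_le_ne_top hfin (hcb ▸ le_self_add)
    rw [hcb, hcn]
    apply ENNReal.add_lt_add_left hbf
    have hlow : ENNReal.ofReal (r ^ p) * k ≤ tCost p (π.restrict S) := by
      rw [hk, ← setLIntegral_const, tCost]
      apply setLIntegral_mono_ae' hS
      refine ae_of_all _ fun z hz => ?_
      have := hSr z hz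
      have : 0 ≤ r := hb0.trans hbr.le
      gcongr
    have hup : tCost p P ≤ ENNReal.ofReal (b ^ p) * (k * η) := by
      have hPu : P univ = k * η := by
        rw [hP, ← univ_prod_univ, Measure.prod_prod, hμu]
      have hμU : ∀ᵐ x ∂μ, x ∈ U := by
        rw [hμ]
        refine (ae_map_iff (p := fun x => x ∈ U) mf.aemeasurable hU).2 ?_
        filter_upwards [ae_restrict_mem hS] with z hz using hSU z hz
      have h1 : ∀ᵐ z ∂P, z.1 ∈ U := Measure.quasiMeasurePreserving_fst.ae hμU
      have h2 : ∀ᵐ z ∂P, z.2 ∈ V :=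
        Measure.quasiMeasurePreserving_snd.ae (show ∀ᵐ y ∂κ, y ∈ V from hV)
      rw [← hPu, ← lintegral_const]
      apply lintegral_mono_ae
      filter_upwards [h1, h2] with z hz1 hz2
      have := hUV _ hz1 _ hz2
      gcongr
    calc t / η * tCost p P ≤ t / η * (ENNReal.ofReal (b ^ p) * (k * η)) := by gcongr
      _ = ENNReal.ofReal (b ^ p) * (t * k) := by
        rw [show t / η * (ENNReal.ofReal (b ^ p) * (k * η)) =
          (t / η * η) * (ENNReal.ofReal (b ^ p) * k) by ring, ENNReal.div_mul_cancel hη0 hηf]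
        ring
      _ < ENNReal.ofReal (r ^ p) * (t * k) := by
        apply ENNReal.mul_lt_mul_left (mul_ne_zero ht0 hSpos.ne') (ENNReal.mul_ne_top htf hkf)
        exact (ENNReal.ofReal_lt_ofReal_iff (Real.rpow_pos_of_pos (hb0.trans_lt hbr) _)).2
          (Real.rpow_lt_rpow hb0 hbr hp)
      _ = t * (ENNReal.ofReal (r ^ p) * k) := by ring
      _ ≤ _ := by gcongr

lemma bt_vol (N : ℕ) (hN : 1 ≤ N) (m : ℝ) (hm : 0 < m) (x : Euc N) (R : ℝ)
    (hR : R = (2 / (volume (Metric.ball (0 : Euc N) 1)).toReal) ^ (1 / (N : ℝ)) *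
      m ^ (1 / (N : ℝ))) :
    0 < R ∧ volume (ball x R) = ENNReal.ofReal (2 * m) ∧
      ∀ R', R < R' → ENNReal.ofReal (2 * m) < volume (ball x R') := by
  set w := (volume (Metric.ball (0 : Euc N) 1)).toReal with hw
  have hwtop : volume (Metric.ball (0 : Euc N) 1) ≠ ∞ := measure_ball_lt_top.ne
  have hw0 : 0 < w := ENNReal.toReal_pos (measure_ball_pos _ _ one_pos).ne' hwtop
  have hwe : volume (Metric.ball (0 : Euc N) 1) = ENNReal.ofReal w := (ENNReal.ofReal_toReal hwtop).symm
  have hR0 : 0 < R := by rw [hR]; positivity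
  have hN' : N ≠ 0 := by omega
  have hRN : R ^ N = 2 / w * m := by
    rw [hR, mul_pow, one_div, Real.rpow_inv_natCast_pow (by positivity) hN',
      Real.rpow_inv_natCast_pow hm.le hN']
  have hv : ∀ s, 0 < s → volume (ball x s) = ENNReal.ofReal (s ^ N * w) := by
    intro s hs
    rw [Measure.addHaar_ball_of_pos _ _ hs, hwe, finrank_euclideanSpace_fin,
      ENNReal.ofReal_mul (by positivity)]
  have e : R ^ N * w = 2 * m := by rw [hRN]; field_simp
  refine ⟨hR0, by rw [hv R hR0, e], fun R' h => ?_⟩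
  rw [hv R' (hR0.trans h), ENNReal.ofReal_lt_ofReal_iff (by have := hR0.trans h; positivity), ← e]
  gcongr

/-- Uniform bound on the transport distance: with `C_N = (2/ω_N)^{1/N}` (`ω_N` the
volume of the unit ball of `ℝ^N`), for every `p > 1`, `m > 0`, `ρ ∈ A_m` and every
optimal plan `π ∈ AP_ρ` realizing `𝒲_p(ρ)`, every `(x,y) ∈ spt π` satisfies
`|x-y| ≤ C_N m^{1/N}`; consequently `𝒲_p(ρ)^p ≤ C_N^p m^{1+p/N}`. -/
theorem bounded_transport_distance (N : ℕ) (hN : 1 ≤ N) :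
    ∃ C : ℝ,
      C = (2 / (volume (Metric.ball (0 : Euc N) 1)).toReal) ^ (1 / (N : ℝ)) ∧
      ∀ p : ℝ, 1 < p → ∀ m : ℝ, 0 < m → ∀ ρ : Euc N → ℝ, memA volume m ρ →
        (∀ π : Measure (Euc N × Euc N), AP volume ρ π →
          tCost p π = WEnergyPow p volume ρ →
          ∀ x y : Euc N, inSupport π (x, y) → dist x y ≤ C * m ^ (1 / (N : ℝ))) ∧
        WEnergyPow p volume ρ ≤ ENNReal.ofReal (C ^ p * m ^ (1 + p / (N : ℝ))) := by
  refine ⟨_, rfl, ?_⟩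
  intro p hp m hm ρ hρ
  obtain ⟨hρm, hρ1, hρi⟩ := hρ
  set C := (2 / (volume (Metric.ball (0 : Euc N) 1)).toReal) ^ (1 / (N : ℝ)) with hC
  have hC0 : 0 ≤ C := by positivity
  set R := C * m ^ (1 / (N : ℝ)) with hR
  have hvol := fun x => bt_vol N hN m hm x R hR
  have hR0 : 0 < R := (hvol 0).1
  set μ := densM volume ρ with hμ
  set σ := densM volume (fun x : Euc N => 1 - ρ x) with hσ
  have hμu : μ univ = ENNReal.ofReal m := by
    have hi : Integrable ρ := by
      by_contra h
      rw [integral_undef h] at hρi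
      linarith
    rw [← hρi, ofReal_integral_eq_lintegral_ofReal hi (hρ1.mono fun x hx => hx.1)]
    simp [hμ, densM]
  have hμf : IsFiniteMeasure μ := ⟨by rw [hμu]; exact ENNReal.ofReal_lt_top⟩
  have hadd : μ + σ = volume := by
    rw [hμ, hσ, densM, densM, ← withDensity_add_left (by fun_prop)]
    conv_rhs => rw [← withDensity_one (μ := (volume : Measure (Euc N)))]
    apply withDensity_congr_ae
    filter_upwards [hρ1] with x hx
    simp only [Pi.add_apply, Pi.one_apply]
    rw [← ENNReal.ofReal_add hx.1 (by linarith [hx.2])]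
    simp
  have hσle : σ ≤ volume := by rw [← hadd]; exact Measure.le_add_left le_rfl
  have h2m : ENNReal.ofReal (2 * m) = ENNReal.ofReal m + ENNReal.ofReal m := by
    rw [two_mul, ENNReal.ofReal_add hm.le hm.le]
  have hμle : ∀ s, μ s ≤ ENNReal.ofReal m := fun s => hμu ▸ measure_mono (subset_univ s)
  have hfinAP : ∀ π : Measure (Euc N × Euc N), π.map Prod.fst = μ → IsFiniteMeasure π := by
    intro π h
    refine ⟨?_⟩
    have : π univ = μ univ := by
      rw [← h, Measure.map_apply measurable_fst MeasurableSet.univ]; simp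
    rw [this]; exact measure_lt_top _ _
  have hen : ∀ π : Measure (Euc N × Euc N), π.map Prod.fst = μ → π.map Prod.snd ≤ σ →
      WEnergyPow p volume ρ ≤ tCost p π := by
    intro π h1 h2
    have := hfinAP π h1
    exact bt_energy_le p volume ρ hρ1 π ⟨h1, h2⟩
  have hbound : WEnergyPow p volume ρ ≤ ENNReal.ofReal (R ^ p) * ENNReal.ofReal m := by
    have hδ : ∀ δ : ℝ, 0 < δ →
        WEnergyPow p volume ρ ≤ ENNReal.ofReal ((R + δ) ^ p) * ENNReal.ofReal m := by
      intro δ hδ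
      obtain ⟨π, h1, h2, h3⟩ := bt_plan μ σ R δ p hδ hR0.le (by linarith)
        (fun x => ne_top_of_le_ne_top measure_ball_lt_top.ne (hσle _))
        (fun x => by
          have h := (hvol x).2.1
          rw [← hadd, Measure.add_apply, h2m] at h
          rw [hμu]
          have h' : ENNReal.ofReal m + ENNReal.ofReal m ≤ ENNReal.ofReal m + σ (ball x R) := by
            rw [← h]; gcongr; exact hμle _
          exact (ENNReal.add_le_add_iff_left ENNReal.ofReal_ne_top).1 h')
      rw [← hμu]
      exact (hen π h1 h2).trans h3
    have hlim : Tendsto (fun δ : ℝ => ENNReal.ofReal ((R + δ) ^ p) * ENNReal.ofReal m)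
        (nhdsWithin 0 (Ioi 0)) (nhds (ENNReal.ofReal (R ^ p) * ENNReal.ofReal m)) := by
      apply ENNReal.Tendsto.mul_const _ (Or.inr ENNReal.ofReal_ne_top)
      apply ENNReal.tendsto_ofReal
      have hc : ContinuousAt (fun δ : ℝ => (R + δ) ^ p) 0 := by
        apply ContinuousAt.rpow_const (by fun_prop)
        left; simpa using hR0.ne'
      have := hc.tendsto
      rw [add_zero] at this
      exact this.mono_left nhdsWithin_le_nhds
    refine ge_of_tendsto hlim ?_
    filter_upwards [self_mem_nhdsWithin] with δ h using hδ δ h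
  constructor
  · intro π hπ hopt x y hxy
    obtain ⟨hπ1, hπ2⟩ := hπ
    by_contra hlt
    push Not at hlt
    have hπf := hfinAP π hπ1
    set ε := (dist x y - R) / 8 with hε
    have hε0 : 0 < ε := by rw [hε]; linarith
    have hd : dist x y = R + 8 * ε := by rw [hε]; ring
    set ν := π.map Prod.snd with hν
    have hsub : σ - ν + ν = σ := Measure.sub_add_cancel_of_le hπ2
    set κ := (σ - ν).restrict (ball x (R + ε)) with hκ
    have hνu : ∀ s, ν s ≤ ENNReal.ofReal m := by
      intro s
      refine (measure_mono (subset_univ s)).trans ?_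
      rw [← hμu, hμ, ← hπ1, hν, Measure.map_apply measurable_snd MeasurableSet.univ,
        Measure.map_apply measurable_fst MeasurableSet.univ]
      simp
    have hκf : IsFiniteMeasure κ := by
      refine ⟨?_⟩
      rw [hκ, Measure.restrict_apply_univ]
      exact ((Measure.sub_le _).trans (hσle _)).trans_lt measure_ball_lt_top
    have hκ0 : κ ≠ 0 := by
      intro h0
      have h00 : (σ - ν) (ball x (R + ε)) = 0 := by
        rw [← Measure.restrict_apply_univ, ← hκ, h0]; simp
      have h1 := (hvol x).2.2 (R + ε) (by linarith)
      rw [← hadd, Measure.add_apply, ← hsub, Measure.add_apply, h00, zero_add, h2m] at h1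
      exact absurd h1 (not_lt.2 (add_le_add (hμle _) (hνu _)))
    have hσκ : ν + κ ≤ σ := by
      conv_rhs => rw [← hsub, add_comm]
      exact add_le_add le_rfl Measure.restrict_le_self
    have hfin : tCost p π ≠ ∞ := by
      rw [hopt]
      exact ne_top_of_le_ne_top (ENNReal.mul_ne_top ENNReal.ofReal_ne_top ENNReal.ofReal_ne_top)
        hbound
    obtain ⟨π', h1, h2, h3⟩ := bt_exchange π σ κ p (by linarith) hσκ hκ0 hfin
      (ball x ε ×ˢ ball y ε) (measurableSet_ball.prod measurableSet_ball)
      (hxy _ (isOpen_ball.prod isOpen_ball) ⟨mem_ball_self hε0, mem_ball_self hε0⟩)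
      (ball x ε) (ball x (R + ε)) measurableSet_ball (fun z hz => hz.1)
      (by rw [hκ, Measure.restrict_apply measurableSet_ball.compl]; simp)
      (R + 6 * ε) (R + 2 * ε) (by linarith) (by linarith)
      (by
        rintro ⟨a, b⟩ ⟨ha, hb⟩
        simp only [mem_ball] at ha hb ⊢
        have t1 := dist_triangle4 x a b y
        rw [dist_comm x a] at t1
        linarith)
      (by
        intro a ha b hb
        simp only [mem_ball] at ha hb
        have := dist_triangle_right a b x
        linarith)
    have := hen π' (h1.trans hπ1) h2
    rw [← hopt] at this
    exact absurd h3 (not_lt.2 this)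
  · refine hbound.trans (le_of_eq ?_)
    rw [← ENNReal.ofReal_mul (by positivity), hR, Real.mul_rpow hC0 (by positivity),
      ← Real.rpow_mul hm.le, Real.rpow_add hm, Real.rpow_one]
    congr 1
    rw [show 1 / (N : ℝ) * p = p / N by ring]
    ring
end
end
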